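/- For every weak composition α and every flag φ, the φ-flagged key polynomial defined via flagged key tableaux equals Reiner and Shimozono's flagged key polynomial: κ_(α,φ) = Σ_{u^• ∈ W(α,φ)} x^{wt(u^•)}. -/

import Mathlib

noncomputable section
attribute [local instance] Classical.propDecidable

/-! ### Words, permutations, reduced words -/

/-- The adjacent transposition `s_i` exchanging `i` and `i+1`. -/
def sPerm (i : ℕ) : Equiv.Perm ℕ := Equiv.swap i (i + 1)

/-- The permutation `s_{i_1} ⋯ s_{i_n}` represented by the word `i_1 ⋯ i_n`. -/
def wordPerm (ρ : List ℕ) : Equiv.Perm ℕ := (ρ.map sPerm).prod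

/-- A word whose letters are positive integers. -/
def PosWord (ρ : List ℕ) : Prop := ∀ x ∈ ρ, 1 ≤ x

/-- A reduced word: a word of positive integers of minimal length among all words of
positive integers representing the same permutation. -/
def IsReducedWord (ρ : List ℕ) : Prop :=
  PosWord ρ ∧ ∀ σ : List ℕ, PosWord σ → wordPerm σ = wordPerm ρ → ρ.length ≤ σ.length

/-- `ρ` is a reduced word for the permutation `w`. -/
def IsReducedWordFor (w : Equiv.Perm ℕ) (ρ : List ℕ) : Prop :=
  IsReducedWord ρ ∧ wordPerm ρ = w

/-- A member of `S∞`: a permutation of the positive integers (it fixes `0`)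
fixing all but finitely many points. -/
def FinitaryPerm (w : Equiv.Perm ℕ) : Prop := w 0 = 0 ∧ {i : ℕ | w i ≠ i}.Finite

/-- A flag: a weakly increasing function `φ : ℤ_{>0} → ℤ_{>0}` with `φ(n) ≥ n`. -/
def IsFlag (φ : ℕ → ℕ) : Prop :=
  (∀ m n : ℕ, 1 ≤ m → m ≤ n → φ m ≤ φ n) ∧ ∀ n : ℕ, 1 ≤ n → n ≤ φ n

/-- A weak composition, as a function on the positive integers (value `0` at `0`)
with finitely many nonzero entries. -/
def WeakComp (α : ℕ → ℕ) : Prop := α 0 = 0 ∧ {i : ℕ | α i ≠ 0}.Finite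

/-- `φ - e_i`, i.e. `l ↦ φ(l) - δ_{il}`. -/
def subE (φ : ℕ → ℕ) (i : ℕ) : ℕ → ℕ := fun l => if l = i then φ l - 1 else φ l

/-- The right action of `s_i` on weak compositions, swapping entries `i` and `i+1`. -/
def swapC (α : ℕ → ℕ) (i : ℕ) : ℕ → ℕ := fun j => α (sPerm i j)

/-- `α` has length `k`: `k` is minimal with `α i = 0` for all `i > k`. -/
def HasLen (α : ℕ → ℕ) (k : ℕ) : Prop :=
  (∀ i, k < i → α i = 0) ∧ ∀ m, (∀ i, m < i → α i = 0) → k ≤ m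

/-! ### Coxeter–Knuth equivalence -/

/-- One Coxeter–Knuth move. -/
def CKStep (u v : List ℕ) : Prop :=
  (∃ (a b : List ℕ) (x y z : ℕ), y < x ∧ x < z ∧
      u = a ++ [x, y, z] ++ b ∧ v = a ++ [x, z, y] ++ b) ∨
  (∃ (a b : List ℕ) (x y z : ℕ), y < z ∧ z < x ∧
      u = a ++ [x, y, z] ++ b ∧ v = a ++ [y, x, z] ++ b) ∨
  (∃ (a b : List ℕ) (i : ℕ),
      u = a ++ [i, i + 1, i] ++ b ∧ v = a ++ [i + 1, i, i + 1] ++ b)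

/-- Coxeter–Knuth equivalence: the transitive (symmetric, reflexive) closure of `CKStep`. -/
def CKEquiv : List ℕ → List ℕ → Prop := Relation.EqvGen CKStep

/-! ### Run factorizations and weak descent tableaux -/

/-- The run factorization of a word into maximal strictly increasing blocks
(listed from left to right). -/
def runFact : List ℕ → List (List ℕ)
  | [] => []
  | a :: rest =>
    match runFact rest with
    | [] => [[a]]
    | r :: rs => if a < r.headI then (a :: r) :: rs else [a] :: r :: rs

/-- Auxiliary: rows of the remaining blocks, given the row of the previous block. -/
def wdtRowsAux : ℤ → List (List ℕ) → List ℤ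
  | _, [] => []
  | prev, b :: bs =>
      min (prev - 1) (b.headI : ℤ) :: wdtRowsAux (min (prev - 1) (b.headI : ℤ)) bs

/-- The row indices assigned to the blocks of a run factorization (blocks listed
left to right): the leftmost block goes to the row indexed by its first letter, and each
subsequent block goes to the row indexed by its first letter if this is below the previous
block's row, and otherwise directly below the previous block's row. -/
def wdtRows : List (List ℕ) → List ℤ
  | [] => []
  | b :: bs => (b.headI : ℤ) :: wdtRowsAux (b.headI : ℤ) bs

/-- A tableau: rows indexed by `ℤ` (bottom to top), columns indexed by `ℕ` starting at `1`;
the value `0` means that there is no box, a nonzero value is the (positive) entry. -/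
abbrev Tableau := ℤ → ℕ → ℕ

/-- The weak descent tableau of a word. -/
def weakDesTab (ρ : List ℕ) : Tableau := fun r c =>
  if c = 0 then 0
  else
    match ((wdtRows (runFact ρ)).zip (runFact ρ)).find? (fun p => decide (p.1 = r)) with
    | some p => p.2.getD (c - 1) 0
    | none => 0

/-- A word is non-virtual if its weak descent tableau only occupies rows of positive index. -/
def NonVirtual (ρ : List ℕ) : Prop := ∀ r ∈ wdtRows (runFact ρ), 1 ≤ r

/-- The shape of a tableau: the number of boxes in each (positively indexed) row. -/
def shapeOf (T : Tableau) : ℕ → ℕ := fun i => Set.ncard {c : ℕ | T (i : ℤ) c ≠ 0}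

/-- The weak descent composition of a word: the shape of its weak descent tableau. -/
def desComp (ρ : List ℕ) : ℕ → ℕ := shapeOf (weakDesTab ρ)

/-- Partial-sum (dominance) order on weak compositions. -/
def compLE (μ ν : ℕ → ℕ) : Prop :=
  ∀ k : ℕ, ∑ i ∈ Finset.Icc 1 k, μ i ≤ ∑ i ∈ Finset.Icc 1 k, ν i

/-- A Yamanouchi reduced word: a non-virtual reduced word that is minimal in its
Coxeter–Knuth class among non-virtual words, for the order
`ρ ≤ τ ↔ ρ ~ τ ∧ des ρ ≤ des τ`. -/
def Yamanouchi (ρ : List ℕ) : Prop :=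
  IsReducedWord ρ ∧ NonVirtual ρ ∧
    ∀ σ : List ℕ, NonVirtual σ → CKEquiv ρ σ → compLE (desComp ρ) (desComp σ)

/-- The (unique) Yamanouchi reduced word Coxeter–Knuth equivalent to `ρ`. -/
def hatRho (ρ : List ℕ) : List ℕ :=
  if h : ∃ σ, Yamanouchi σ ∧ CKEquiv ρ σ then h.choose else []

/-- The weak Edelman–Greene insertion tableau of a word: the weak descent tableau of the
unique Yamanouchi reduced word Coxeter–Knuth equivalent to it. -/
def hatP (ρ : List ℕ) : Tableau := weakDesTab (hatRho ρ)

/-! ### Factorizations -/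

/-- The factorization `f : ℕ → List ℕ` stores the block `ρ^{(i)}` at index `i ≥ 1`
(blocks indexed from the right); the largest index of a nonempty block. -/
def topIdx (f : ℕ → List ℕ) : ℕ := sSup {i : ℕ | f i ≠ []}

/-- The concatenation `ρ^{(top)} ⋯ ρ^{(i+1)} ρ^{(i)}` of the blocks of `f` with index `≥ i`. -/
def factWordGe (f : ℕ → List ℕ) (i : ℕ) : List ℕ :=
  ((((List.range (topIdx f + 1)).reverse).filter (fun j => decide (i ≤ j))).map f).foldr
    (· ++ ·) []

/-- The underlying word of a factorization. -/
def factWord (f : ℕ → List ℕ) : List ℕ := factWordGe f 0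

/-- The weak Edelman–Greene recording tableau of a factorization: it has the same shape as
the weak EG insertion tableau of the underlying word, and has entry `i` in all boxes of
`P̂(ρ^{(k)}|⋯|ρ^{(i)})` that are not in `P̂(ρ^{(k)}|⋯|ρ^{(i+1)})`. -/
def hatQfact (f : ℕ → List ℕ) : Tableau := fun r c =>
  sSup {i : ℕ | 1 ≤ i ∧ hatP (factWordGe f i) r c ≠ 0 ∧ hatP (factWordGe f (i + 1)) r c = 0}

/-- Every block is strictly increasing. -/
def IncreasingFact (f : ℕ → List ℕ) : Prop := ∀ i, List.Chain' (· < ·) (f i)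

/-- The factorization is `φ`-flagged: every nonempty block `ρ^{(i)}` has first letter
`ρ^{(i)}_1` with `φ(ρ^{(i)}_1) ≥ i`. -/
def FlaggedFact (φ : ℕ → ℕ) (f : ℕ → List ℕ) : Prop :=
  ∀ i, f i ≠ [] → i ≤ φ ((f i).headI)

/-- `RFC(w, φ)`: all `φ`-flagged increasing factorizations of reduced words for `w`. -/
def RFCset (w : Equiv.Perm ℕ) (φ : ℕ → ℕ) : Set (ℕ → List ℕ) :=
  {f | f 0 = [] ∧ {i : ℕ | f i ≠ []}.Finite ∧ IncreasingFact f ∧ FlaggedFact φ f ∧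
       IsReducedWordFor w (factWord f)}

/-- `RF_n(w)`: increasing factorizations of reduced words for `w` with exactly `n` blocks
(indexed `1, …, n`, possibly empty). -/
def RFn (n : ℕ) (w : Equiv.Perm ℕ) : Set (ℕ → List ℕ) :=
  {f | f 0 = [] ∧ (∀ j, n < j → f j = []) ∧ IncreasingFact f ∧
       IsReducedWordFor w (factWord f)}

/-- `RFC_n(w, φ)`: the `φ`-flagged elements of `RF_n(w)`. -/
def RFCn (n : ℕ) (w : Equiv.Perm ℕ) (φ : ℕ → ℕ) : Set (ℕ → List ℕ) :=
  {f | f ∈ RFn n w ∧ FlaggedFact φ f}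

/-! ### Morse–Schilling crystal operators -/

/-- Pairing procedure: first argument is the block `r^{(i)}` in *decreasing* order, second is
the not-yet-paired part of the block `r^{(i+1)}` (in increasing order). Each letter `b` of
`r^{(i)}`, from largest to smallest, is paired with the smallest still unpaired letter of
`r^{(i+1)}` strictly larger than `b`. Returns the unpaired letters of `r^{(i+1)}`. -/
def unpairedUpper : List ℕ → List ℕ → List ℕ
  | [], A => A
  | b :: bs, A =>
    match A.find? (fun a => decide (b < a)) with
    | some a => unpairedUpper bs (A.erase a)
    | none => unpairedUpper bs A

/-- As in `unpairedUpper`, but returns the unpaired letters of `r^{(i)}`. -/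
def unpairedLower : List ℕ → List ℕ → List ℕ
  | [], _ => []
  | b :: bs, A =>
    match A.find? (fun a => decide (b < a)) with
    | some a => unpairedLower bs (A.erase a)
    | none => b :: unpairedLower bs A

/-- Insert a letter into a weakly increasing list, keeping it increasing. -/
def insAsc (x : ℕ) : List ℕ → List ℕ
  | [] => [x]
  | y :: ys => if x ≤ y then x :: y :: ys else y :: insAsc x ys

/-- The Morse–Schilling raising operator `e_i`: if every letter of block `i+1` is paired,
the result is `none` (i.e. `0`); otherwise the largest unpaired letter `a` of block `i+1` is
removed and `a + s` is added to block `i`, where `s = min {j ≥ 0 | a+j+1 ∉ r^{(i+1)}}`. -/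
def msE (i : ℕ) (f : ℕ → List ℕ) : Option (ℕ → List ℕ) :=
  let B := f i
  let A := f (i + 1)
  let L := unpairedUpper B.reverse A
  if L = [] then none
  else
    let a := L.foldr max 0
    let s := sInf {j : ℕ | (a + j + 1) ∉ A}
    some (Function.update (Function.update f (i + 1) (A.erase a)) i (insAsc (a + s) B))

/-- The Morse–Schilling lowering operator `f_i`: if every letter of block `i` is paired,
the result is `none`; otherwise the smallest unpaired letter `b` of block `i` is removed and
`b - t` is added to block `i+1`, where `t = min {j ≥ 0 | b-j-1 ∉ r^{(i)}}`. -/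
def msF (i : ℕ) (f : ℕ → List ℕ) : Option (ℕ → List ℕ) :=
  let B := f i
  let A := f (i + 1)
  let R := unpairedLower B.reverse A
  if R = [] then none
  else
    let b := R.foldr min R.headI
    let t := sInf {j : ℕ | (b - j - 1) ∉ B}
    some (Function.update (Function.update f i (B.erase b)) (i + 1) (insAsc (b - t) A))

/-- Iteration `e_j^k` of the raising operator. -/
def msEIter (j : ℕ) : ℕ → (ℕ → List ℕ) → Option (ℕ → List ℕ)
  | 0, f => some f
  | k + 1, f => (msE j f).bind (msEIter j k)

/-- The Demazure operator `𝔇_j` on subsets of the crystal `RF_n(w)`: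
`𝔇_j X = {b ∈ RF_n(w) | e_j^k(b) ∈ X for some k ≥ 0}`. -/
def demOp (n : ℕ) (w : Equiv.Perm ℕ) (j : ℕ) (X : Set (ℕ → List ℕ)) : Set (ℕ → List ℕ) :=
  {b | b ∈ RFn n w ∧ ∃ (k : ℕ) (c : ℕ → List ℕ), msEIter j k b = some c ∧ c ∈ X}

/-- `𝔇_{i_1} 𝔇_{i_2} ⋯ 𝔇_{i_k} X` for a word `i_1 i_2 ⋯ i_k` (the head is applied last). -/
def demWord (n : ℕ) (w : Equiv.Perm ℕ) : List ℕ → Set (ℕ → List ℕ) → Set (ℕ → List ℕ)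
  | [], X => X
  | j :: rest, X => demOp n w j (demWord n w rest X)

/-- `𝔇_{b↓a} = 𝔇_{b-1} 𝔇_{b-2} ⋯ 𝔇_a` (the identity when `b ≤ a`). -/
def demDown (n : ℕ) (w : Equiv.Perm ℕ) (b a : ℕ) (X : Set (ℕ → List ℕ)) :
    Set (ℕ → List ℕ) :=
  demWord n w ((List.range' a (b - a)).reverse) X

/-! ### Key tableaux -/

/-- A key tableau: a filling of a left-justified diagram in the positively indexed rows,
with positive entries, weakly decreasing rows, distinct column entries, and the key
condition (c) of Assaf–Schilling. -/
def IsKeyTableau (T : Tableau) : Prop :=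
  (∀ (r : ℤ) (c : ℕ), r ≤ 0 → T r c = 0) ∧
  (∀ r : ℤ, T r 0 = 0) ∧
  {p : ℤ × ℕ | T p.1 p.2 ≠ 0}.Finite ∧
  (∀ (r : ℤ) (c : ℕ), 1 ≤ c → T r (c + 1) ≠ 0 → T r c ≠ 0) ∧
  (∀ (r : ℤ) (c : ℕ), 1 ≤ c → T r (c + 1) ≠ 0 → T r (c + 1) ≤ T r c) ∧
  (∀ (r r' : ℤ) (c : ℕ), r ≠ r' → T r c ≠ 0 → T r' c ≠ 0 → T r c ≠ T r' c) ∧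
  (∀ (r r' : ℤ) (c : ℕ), r < r' → T r c ≠ 0 → T r' c ≠ 0 → T r' c < T r c →
      T r (c + 1) ≠ 0 ∧ T r' c < T r (c + 1))

/-- The tableau is `φ`-flagged: every entry in row `i` is at most `φ(i)`. -/
def FlaggedTab (φ : ℕ → ℕ) (T : Tableau) : Prop := ∀ (i c : ℕ), T (i : ℤ) c ≤ φ i

/-- `SSKT(α, φ)`: the `φ`-flagged key tableaux of shape `α`. -/
def SSKT (α φ : ℕ → ℕ) : Set Tableau :=
  {T | IsKeyTableau T ∧ shapeOf T = α ∧ FlaggedTab φ T}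

/-- The weight of a tableau: `wt(T)_v` is the number of entries equal to `v`. -/
def wtTab (T : Tableau) : ℕ → ℕ := fun v =>
  if v = 0 then 0 else Set.ncard {p : ℤ × ℕ | T p.1 p.2 = v}

/-- The weight of a word: the multiplicity of each positive letter. -/
def wtWord (u : List ℕ) : ℕ → ℕ := fun v => if v = 0 then 0 else u.count v

/-- The statistic `m_i(col(T), j)` where position `j` of the reverse column reading word
(entries read down columns, from right to left) is the box in row `r`, column `c`:
the number of entries `i+1` weakly after this box minus the number of entries `i`. -/
def mi (T : Tableau) (i : ℕ) (r : ℤ) (c : ℕ) : ℤ :=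
  (Set.ncard {p : ℤ × ℕ | T p.1 p.2 = i + 1 ∧ (p.2 < c ∨ (p.2 = c ∧ p.1 ≤ r))} : ℤ) -
  (Set.ncard {p : ℤ × ℕ | T p.1 p.2 = i ∧ (p.2 < c ∨ (p.2 = c ∧ p.1 ≤ r))} : ℤ)

/-- The box `(r, c)` maximizes `m_i` among all boxes of `T`. -/
def isMaxBox (T : Tableau) (i : ℕ) (r : ℤ) (c : ℕ) : Prop :=
  T r c ≠ 0 ∧ ∀ (r' : ℤ) (c' : ℕ), T r' c' ≠ 0 → mi T i r' c' ≤ mi T i r c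

/-- The Assaf–Schilling raising operator `e_i` on key tableaux.  If `m_i(col(T)) ≤ 0` the
result is `none` (i.e. `0`); otherwise, with `q` the largest position of the reverse column
reading word achieving the maximum (i.e. the maximizing box with the smallest column index,
and the smallest row index in that column), all entries `i+1` in the row of `q` weakly to its
right are changed to `i`, and all entries `i` in the same columns as these entries are
changed to `i+1`. -/
def keyE (i : ℕ) (T : Tableau) : Option Tableau :=
  if h : ∃ (r : ℤ) (c : ℕ), isMaxBox T i r c ∧ 1 ≤ mi T i r c then
    let cq := sInf {c : ℕ | ∃ r : ℤ, isMaxBox T i r c}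
    let rq : ℤ := ((sInf {m : ℕ | isMaxBox T i ((m : ℕ) : ℤ) cq} : ℕ) : ℤ)
    some (fun r c =>
      if cq ≤ c ∧ T rq c = i + 1 then
        (if T r c = i + 1 then i else if T r c = i then i + 1 else T r c)
      else T r c)
  else none

/-- The Assaf–Schilling lowering operator `f_i`: the (unique) inverse of `e_i`. -/
def keyF (i : ℕ) (T : Tableau) : Option Tableau :=
  if h : ∃ T', keyE i T' = some T then some h.choose else none

/-- Restriction of a partially defined crystal operator to a subset: the operator returns
`none` (i.e. `0`) whenever it would leave the subset. -/
def restrictOp {β : Type} (S : Set β) (op : β → Option β) (x : β) : Option β :=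
  (op x).bind fun y => if y ∈ S then some y else none

/-! ### Polynomials: divided differences and key polynomials -/

/-- The divided difference operator `∂_i f = (f - s_i · f) / (x_i - x_{i+1})`. -/
def divDiff (i : ℕ) (fp : MvPolynomial ℕ ℤ) : MvPolynomial ℕ ℤ :=
  if h : ∃ g : MvPolynomial ℕ ℤ,
      g * (MvPolynomial.X i - MvPolynomial.X (i + 1)) =
        fp - MvPolynomial.rename (fun j => sPerm i j) fp
  then h.choose else 0

/-- The isobaric divided difference operator `π_i f = ∂_i (x_i f)`. -/
def piOp (i : ℕ) (fp : MvPolynomial ℕ ℤ) : MvPolynomial ℕ ℤ :=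
  divDiff i (MvPolynomial.X i * fp)

/-- `π_{i_1} π_{i_2} ⋯ π_{i_k} f` for a word `i_1 i_2 ⋯ i_k` (the head is applied last). -/
def piWord : List ℕ → MvPolynomial ℕ ℤ → MvPolynomial ℕ ℤ
  | [], fp => fp
  | i :: rest, fp => piOp i (piWord rest fp)

/-- `π_{b↓a} = π_{b-1} π_{b-2} ⋯ π_a` (the identity when `b ≤ a`). -/
def piDown (b a : ℕ) (fp : MvPolynomial ℕ ℤ) : MvPolynomial ℕ ℤ :=
  piWord ((List.range' a (b - a)).reverse) fp

/-- The conjugate of a weak composition: `conjC α t = #{j ≥ 1 | α_j ≥ t}` for `t ≥ 1`. -/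
def conjC (α : ℕ → ℕ) (t : ℕ) : ℕ :=
  Set.ncard {j : ℕ | 1 ≤ j ∧ 1 ≤ t ∧ t ≤ α j}

/-- The partition rearrangement of a weak composition (the conjugate of its conjugate). -/
def sortC (α : ℕ → ℕ) : ℕ → ℕ := conjC (conjC α)

/-- The length of a permutation: the common length of its reduced words. -/
def permLength (w : Equiv.Perm ℕ) : ℕ :=
  sInf {n : ℕ | ∃ ρ : List ℕ, PosWord ρ ∧ wordPerm ρ = w ∧ ρ.length = n}

/-- The monomial `x^β = x_1^{β_1} x_2^{β_2} ⋯`. -/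
def xExp (β : ℕ → ℕ) : MvPolynomial ℕ ℤ :=
  ∏ i ∈ Finset.range (sSup {n : ℕ | β n ≠ 0} + 1), MvPolynomial.X i ^ β i

/-- The key polynomial `κ_α = π_w x^λ` where `λ` is the partition rearrangement of `α` and
`w` is the minimal-length permutation of `S∞` with `α · w = λ`. -/
def keyPoly (α : ℕ → ℕ) : MvPolynomial ℕ ℤ :=
  if h : ∃ (ρ : List ℕ) (w : Equiv.Perm ℕ), IsReducedWordFor w ρ ∧
      (∀ i, α (w i) = sortC α i) ∧
      (∀ v : Equiv.Perm ℕ, (∃ τ, IsReducedWordFor v τ) → (∀ i, α (v i) = sortC α i) →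
        permLength w ≤ permLength v)
  then piWord h.choose (xExp (sortC α)) else 0

/-- The `φ`-flagged key polynomial `κ_{(α,φ)} = Σ_{T ∈ SSKT(α,φ)} x^{wt(T)}`. -/
def flaggedKeyPoly (α φ : ℕ → ℕ) : MvPolynomial ℕ ℤ :=
  ∑ᶠ T ∈ SSKT α φ, xExp (wtTab T)

/-! ### Column insertion, keys, standardization -/

/-- The number of boxes in column `c` of a tableau. -/
def colHeightN (T : Tableau) (c : ℕ) : ℕ := Set.ncard {r : ℤ | T r c ≠ 0}

/-- One pass of column insertion: insert the value `x` starting at column `c`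
(`fuel` bounds the number of columns visited). -/
def colInsertAux : ℕ → Tableau → ℕ → ℕ → Tableau
  | 0, T, _, _ => T
  | fuel + 1, T, c, x =>
    if ∀ r : ℤ, T r c ≠ 0 → T r c < x then
      -- x is greater than every entry of column c: place it at the end of the column
      fun r c' => if c' = c ∧ r = (colHeightN T c + 1 : ℤ) then x else T r c'
    else if ∃ r : ℤ, T r c = x then
      -- column c contains x: move on to the next column with the same value
      colInsertAux fuel T (c + 1) x
    else
      -- bump the smallest entry of column c that is larger than x
      let y := sInf {v : ℕ | x < v ∧ ∃ r : ℤ, T r c = v}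
      colInsertAux fuel (fun r c' => if c' = c ∧ T r c' = y then x else T r c') (c + 1) y

/-- Column insertion of `x` into the semistandard Young tableau `T`. -/
def colInsert (T : Tableau) (x : ℕ) : Tableau :=
  colInsertAux (sSup {c : ℕ | ∃ r : ℤ, T r c ≠ 0} + 2) T 1 x

/-- The insertion tableau `P` of `(v → ∅)`: successively column insert
`v_n, v_{n-1}, …, v_1` into the empty tableau. -/
def insertP (v : List ℕ) : Tableau :=
  v.reverse.foldl colInsert (fun _ _ => 0)

/-- The recording tableau `Q` of `(v → ∅)`: the standard Young tableau whose restriction to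
`{1, …, j}` has the same shape as the insertion tableau of the last `j` letters of `v`. -/
def insertQ (v : List ℕ) : Tableau := fun r c =>
  sInf {j : ℕ | insertP (v.drop (v.length - j)) r c ≠ 0}

/-- The key `key(α)`: the unique semistandard Young tableau of weight `α` such that the set
of entries of column `i+1` is a subset of the entries of column `i`; its column `c` consists
of the elements of `{x ≥ 1 | α_x ≥ c}` in increasing order from bottom to top. -/
def keyTab (α : ℕ → ℕ) : Tableau := fun r c =>
  if c = 0 then 0
  else sInf {x : ℕ | 1 ≤ x ∧ c ≤ α x ∧
    ((Set.ncard {y : ℕ | 1 ≤ y ∧ c ≤ α y ∧ y ≤ x} : ℕ) : ℤ) = r}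

/-- The standardization of a semistandard Young tableau: the `1`'s are replaced from left to
right by `1, …, β_1`, the `2`'s by `β_1 + 1, …, β_1 + β_2`, and so on. -/
def stdTab (T : Tableau) : Tableau := fun r c =>
  if T r c = 0 then 0
  else Set.ncard {p : ℤ × ℕ |
    T p.1 p.2 ≠ 0 ∧ (T p.1 p.2 < T r c ∨ (T p.1 p.2 = T r c ∧ p.2 ≤ c))}

/-! ### Maximal factorizations (Reiner–Shimozono) -/

/-- Every block is weakly increasing. -/
def WeaklyIncrFact (g : ℕ → List ℕ) : Prop := ∀ i, List.Chain' (· ≤ ·) (g i)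

/-- Maximality: the nonempty blocks have maximal length, i.e. there is a strict descent
between any two consecutive nonempty blocks (no letter can be moved from the end of a block
to the front of the next one to the right). -/
def MaxFact (g : ℕ → List ℕ) : Prop :=
  ∀ i j : ℕ, 1 ≤ i → i < j → g i ≠ [] → g j ≠ [] → (∀ m, i < m → m < j → g m = []) →
    (g i).headI < (g j).getLastD 0

/-- Reiner–Shimozono's set `𝒲(α, φ)` of `φ`-flagged maximal factorizations
`u^• = u^n ⋯ u^2 u^1` with `ℓ(u^i) = α_i` and `(u → ∅) = (P, std(key(α)))`. -/
def Wset (α φ : ℕ → ℕ) : Set (ℕ → List ℕ) :=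
  {g | g 0 = [] ∧ (∀ i, (g i).length = α i) ∧ (∀ i, ∀ x ∈ g i, 1 ≤ x) ∧
       WeaklyIncrFact g ∧ MaxFact g ∧ (∀ i, ∀ x ∈ g i, x ≤ φ i) ∧
       insertQ (factWord g) = stdTab (keyTab α)}

/-! ### Shifts and highest weight key tableaux -/

/-- `shift_N`: add `N` to every letter of every block. -/
def shiftFact (N : ℕ) (f : ℕ → List ℕ) : ℕ → List ℕ := fun i => (f i).map (· + N)

/-- The tableau of shape `α` whose column `i` is filled by `1, 2, …, λ^T_i` in increasing
order from bottom to top (where `λ^T` is the conjugate of the partition rearrangement `λ`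
of `α`): the box of column `c` in row `m` (where `α_m ≥ c`) contains the number of indices
`m' ≤ m` with `α_{m'} ≥ c`. -/
def highKeyTab (α : ℕ → ℕ) : Tableau := fun r c =>
  if c = 0 then 0
  else if ∃ m : ℕ, (m : ℤ) = r ∧ 1 ≤ m ∧ c ≤ α m then
    Set.ncard {m : ℕ | 1 ≤ m ∧ c ≤ α m ∧ (m : ℤ) ≤ r}
  else 0


/-- A `gl_n`-crystal isomorphism between two sets of key tableaux, both equipped with the
Assaf–Schilling operators (restricted to the sets): a weight-preserving bijection commuting
with all raising and lowering operators `e_i, f_i` for `1 ≤ i < n`. -/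
def SSKTIso (n : ℕ) (S₁ S₂ : Set Tableau) : Prop :=
  ∃ g : Tableau → Tableau, Set.BijOn g S₁ S₂ ∧
    (∀ T ∈ S₁, wtTab T = wtTab (g T)) ∧
    ∀ T ∈ S₁, ∀ i : ℕ, 1 ≤ i → i < n →
      Option.map g (restrictOp S₁ (keyE i) T) = restrictOp S₂ (keyE i) (g T) ∧
      Option.map g (restrictOp S₁ (keyF i) T) = restrictOp S₂ (keyF i) (g T)

namespace FlaggedKey

/-! ### Column insertion of words over a linear order -/

section Insertion

variable {L : Type*} [LinearOrder L]

/-- Insert `y` into a column, listed in decreasing order: `y` replaces the largest entry `≤ y`,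
or is appended when there is none. -/
def stepC : List L → L → List L
  | [], y => [y]
  | a :: l, y => if a ≤ y then y :: l else a :: stepC l y

/-- The entry replaced by `stepC`, if any. -/
def stepO : List L → L → Option L
  | [], _ => none
  | a :: l, y => if a ≤ y then some a else stepO l y

/-- The column obtained by inserting the letters of a word from left to right. -/
def passC : List L → List L → List L
  | C, [] => C
  | C, y :: w => passC (stepC C y) w

/-- The word of replaced letters when inserting a word into a column. -/
def passO : List L → List L → List L
  | _, [] => []
  | C, y :: w => (stepO C y).toList ++ passO (stepC C y) w

/-- The columns of the insertion tableau of a word. -/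
def col : List L → ℕ → List L
  | w, 0 => passC [] w
  | w, c + 1 => col (passO [] w) c

/-- The column heights of the insertion tableau of a word. -/
def ht (w : List L) (c : ℕ) : ℕ := (col w c).length

/-- Strictly decreasing lists. -/
abbrev Desc (l : List L) : Prop := l.Pairwise (· > ·)

/-- The number of entries of `l` larger than `t`. -/
def cnt (t : L) (l : List L) : ℕ := l.countP (fun a => decide (t < a))

lemma cnt_cons (t a : L) (l : List L) : cnt t (a :: l) = cnt t l + if t < a then 1 else 0 := by
  simp [cnt, List.countP_cons]

lemma cnt_append (t : L) (l l' : List L) : cnt t (l ++ l') = cnt t l + cnt t l' := by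
  simp [cnt]

lemma cnt_perm (t : L) {l l' : List L} (h : l.Perm l') : cnt t l = cnt t l' := h.countP_eq _

lemma cnt_le_length (t : L) (l : List L) : cnt t l ≤ l.length := List.countP_le_length

lemma cnt_mono {t t' : L} (h : t ≤ t') (l : List L) : cnt t' l ≤ cnt t l := by
  apply List.countP_mono_left
  intro a _ ha
  simp only [decide_eq_true_eq] at *
  exact lt_of_le_of_lt h ha

lemma cnt_eq_of {t t' : L} (h : t ≤ t') {l : List L} (hl : ∀ a ∈ l, t < a → t' < a) :
    cnt t l = cnt t' l := by
  refine le_antisymm ?_ (cnt_mono h l)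
  apply List.countP_mono_left
  intro a ha h'
  simp only [decide_eq_true_eq] at *
  exact hl a ha h'

lemma cnt_lt_of {t t' a : L} {l : List L} (ha : a ∈ l) (h1 : t < a) (h2 : a ≤ t') :
    cnt t' l + 1 ≤ cnt t l := by
  obtain ⟨s, s', rfl⟩ := List.append_of_mem ha
  have e1 := cnt_mono (h1.le.trans h2) s
  have e2 := cnt_mono (h1.le.trans h2) s'
  simp only [cnt_append, cnt_cons, if_pos h1, if_neg (not_lt.2 h2)]
  omega

lemma cnt_eq_length {t : L} {l : List L} (h : ∀ a ∈ l, t < a) : cnt t l = l.length := by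
  rw [cnt, List.countP_eq_length]
  simpa using h

lemma cnt_lt_length {t a : L} {l : List L} (ha : a ∈ l) (h : a ≤ t) : cnt t l + 1 ≤ l.length := by
  obtain ⟨s, s', rfl⟩ := List.append_of_mem ha
  have e1 := cnt_le_length t s
  have e2 := cnt_le_length t s'
  simp only [cnt_append, cnt_cons, if_neg (not_lt.2 h), List.length_append, List.length_cons]
  omega

lemma step_perm (C : List L) (y : L) : ((stepO C y).toList ++ stepC C y).Perm (y :: C) := by
  induction C with
  | nil => simp [stepO, stepC]
  | cons a l ih =>
    by_cases h : a ≤ y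
    · simpa [stepO, stepC, h] using List.Perm.swap y a l
    · simp only [stepO, stepC, h, if_false]
      refine List.perm_middle.trans ?_
      exact (ih.cons a).trans (List.Perm.swap _ _ _)

lemma stepO_eq_none {C : List L} {y : L} : stepO C y = none ↔ ∀ c ∈ C, y < c := by
  induction C with
  | nil => simp [stepO]
  | cons a l ih =>
    by_cases h : a ≤ y
    · simp [stepO, h]
    · simp [stepO, h, ih, not_le.1 h]

lemma stepC_of_none {C : List L} {y : L} (h : stepO C y = none) : stepC C y = C ++ [y] := by
  induction C with
  | nil => simp [stepC]
  | cons a l ih =>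
    have h1 := stepO_eq_none.1 h
    have h2 : ¬ a ≤ y := not_le.2 (h1 a (by simp))
    simp only [stepO, h2, if_false] at h
    simp [stepC, h2, ih h]

lemma self_mem_stepC (C : List L) (y : L) : y ∈ stepC C y := by
  induction C with
  | nil => simp [stepC]
  | cons a l ih => by_cases h : a ≤ y <;> simp [stepC, h, ih]

lemma mem_of_mem_stepC {C : List L} {y z : L} (h : z ∈ stepC C y) : z = y ∨ z ∈ C := by
  have := (step_perm C y).mem_iff.1 (List.mem_append_right _ h)
  simpa using this

lemma mem_of_stepO {C : List L} {y p : L} (h : stepO C y = some p) : p ∈ C ∧ p ≤ y := by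
  induction C with
  | nil => simp [stepO] at h
  | cons a l ih =>
    by_cases h' : a ≤ y
    · simp only [stepO, h', if_true, Option.some.injEq] at h
      subst h; simp [h']
    · simp only [stepO, h', if_false] at h
      have := ih h
      simp [this]

lemma le_of_stepO {C : List L} (hC : Desc C) {y p : L} (h : stepO C y = some p) :
    ∀ c ∈ C, c ≤ y → c ≤ p := by
  induction C with
  | nil => simp
  | cons a l ih =>
    rw [Desc, List.pairwise_cons] at hC
    by_cases h' : a ≤ y
    · simp only [stepO, h', if_true, Option.some.injEq] at h
      subst h
      intro c hc _
      rcases List.mem_cons.1 hc with rfl | hc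
      · exact le_rfl
      · exact (hC.1 c hc).le
    · simp only [stepO, h', if_false] at h
      intro c hc hcy
      rcases List.mem_cons.1 hc with rfl | hc
      · exact absurd hcy h'
      · exact ih hC.2 h c hc hcy

lemma desc_stepC {C : List L} (hC : Desc C) (y : L) : Desc (stepC C y) := by
  induction C with
  | nil => simp [stepC]
  | cons a l ih =>
    rw [Desc, List.pairwise_cons] at hC
    by_cases h : a ≤ y
    · simp only [Desc, stepC, h, if_true, List.pairwise_cons]
      exact ⟨fun b hb => lt_of_lt_of_le (hC.1 b hb) h, hC.2⟩
    · simp only [Desc, stepC, h, if_false, List.pairwise_cons]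
      refine ⟨fun b hb => ?_, ih hC.2⟩
      rcases mem_of_mem_stepC hb with rfl | hb
      · exact not_le.1 h
      · exact hC.1 b hb

lemma Desc.nodup {C : List L} (hC : Desc C) : C.Nodup := hC.imp (fun h => ne_of_gt h)

lemma mem_stepC_iff {C : List L} (hC : Desc C) {y p : L} (h : stepO C y = some p) (z : L) :
    z ∈ stepC C y ↔ (z ∈ C ∧ z ≠ p) ∨ z = y := by
  have hp := step_perm C y
  rw [h] at hp
  simp only [Option.toList_some, List.singleton_append] at hp
  have hm := hp.mem_iff (a := z)
  simp only [List.mem_cons] at hm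
  constructor
  · intro hz
    by_cases hzy : z = y
    · exact Or.inr hzy
    · left
      refine ⟨(mem_of_mem_stepC hz).resolve_left hzy, ?_⟩
      rintro rfl
      have h1 : (z :: stepC C y).count z = (y :: C).count z := hp.count_eq z
      have h2 : 1 ≤ (stepC C y).count z := List.one_le_count_iff.2 hz
      have h3 : C.count z ≤ 1 := List.nodup_iff_count_le_one.1 hC.nodup z
      have h4 : (y :: C).count z = C.count z := List.count_cons_of_ne (fun h => hzy h.symm)
      have h5 : (z :: stepC C y).count z = (stepC C y).count z + 1 := List.count_cons_self
      omega
  · rintro (⟨hz, hzp⟩ | rfl)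
    · exact (hm.2 (Or.inr hz)).resolve_left hzp
    · exact self_mem_stepC _ _

lemma cnt_stepC_some {C : List L} {y p : L} (h : stepO C y = some p) (t : L) :
    cnt t (stepC C y) + (if t < p then 1 else 0) = cnt t C + if t < y then 1 else 0 := by
  have hp := cnt_perm t (step_perm C y)
  rw [h] at hp
  simpa [cnt_cons] using hp

lemma cnt_stepC_none {C : List L} {y : L} (h : stepO C y = none) (t : L) :
    cnt t (stepC C y) = cnt t C + if t < y then 1 else 0 := by
  have hp := cnt_perm t (step_perm C y)
  rw [h] at hp
  simpa [cnt_cons] using hp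

lemma passC_append (C a b : List L) : passC C (a ++ b) = passC (passC C a) b := by
  induction a generalizing C with
  | nil => rfl
  | cons x a ih => simp [passC, ih]

lemma passO_append (C a b : List L) :
    passO C (a ++ b) = passO C a ++ passO (passC C a) b := by
  induction a generalizing C with
  | nil => rfl
  | cons x a ih => simp [passC, passO, ih]

lemma desc_passC {C : List L} (hC : Desc C) (w : List L) : Desc (passC C w) := by
  induction w generalizing C with
  | nil => exact hC
  | cons x a ih => exact ih (desc_stepC hC x)

lemma pass_perm (C w : List L) : (passO C w ++ passC C w).Perm (C ++ w) := by
  induction w generalizing C with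
  | nil => simp [passO, passC]
  | cons x a ih =>
    simp only [passO, passC, List.append_assoc]
    refine ((ih (stepC C x)).append_left _).trans ?_
    rw [← List.append_assoc]
    refine ((step_perm C x).append_right _).trans ?_
    exact List.perm_middle.symm

lemma desc_nil : Desc ([] : List L) := List.Pairwise.nil

lemma desc_col (w : List L) (c : ℕ) : Desc (col w c) := by
  induction c generalizing w with
  | zero => exact desc_passC desc_nil w
  | succ c ih => exact ih _

lemma stepO_stepC_of_le {C : List L} (hC : Desc C) {x y : L} (h : x ≤ y) :
    ∃ q, stepO (stepC C x) y = some q ∧ x ≤ q := by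
  cases hq : stepO (stepC C x) y with
  | none => exact absurd (stepO_eq_none.1 hq x (self_mem_stepC C x)) (not_lt.2 h)
  | some q => exact ⟨q, rfl, le_of_stepO (desc_stepC hC x) hq x (self_mem_stepC C x) h⟩

lemma stepO_stepC_of_lt {C : List L} (hC : Desc C) {x y q : L} (h : x < y)
    (hq : stepO (stepC C y) x = some q) : ∃ p, stepO C y = some p ∧ q < p := by
  obtain ⟨h1, h2⟩ := mem_of_stepO hq
  have h3 : q ∈ C := (mem_of_mem_stepC h1).resolve_left (ne_of_lt (h2.trans_lt h))
  cases hp : stepO C y with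
  | none => exact absurd (stepO_eq_none.1 hp q h3) (not_lt.2 (h2.trans h.le))
  | some p =>
    refine ⟨p, rfl, lt_of_le_of_ne (le_of_stepO hC hp q h3 (h2.trans h.le)) ?_⟩
    rintro rfl
    rcases (mem_stepC_iff hC hp q).1 h1 with h | h
    · exact h.2 rfl
    · exact absurd h (ne_of_lt (h2.trans_lt ‹_›))

/-! ### Knuth equivalence -/

/-- An elementary Knuth transformation. -/
inductive KStep : List L → List L → Prop
  | right (a b : List L) (x y z : L) : x < y → y ≤ z →
      KStep (a ++ [y, z, x] ++ b) (a ++ [y, x, z] ++ b)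
  | left (a b : List L) (x y z : L) : x ≤ y → y < z →
      KStep (a ++ [x, z, y] ++ b) (a ++ [z, x, y] ++ b)

/-- Knuth equivalence of words. -/
def KEq : List L → List L → Prop := Relation.EqvGen KStep

lemma KEq.refl (a : List L) : KEq a a := Relation.EqvGen.refl a

lemma KEq.symm {a b : List L} (h : KEq a b) : KEq b a := Relation.EqvGen.symm _ _ h

lemma KEq.trans {a b c : List L} (h : KEq a b) (h' : KEq b c) : KEq a c :=
  Relation.EqvGen.trans _ _ _ h h'

lemma KStep.context {u v : List L} (h : KStep u v) (a b : List L) :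
    KStep (a ++ u ++ b) (a ++ v ++ b) := by
  cases h with
  | right a' b' x y z h1 h2 =>
    have := KStep.right (a ++ a') (b' ++ b) x y z h1 h2
    simpa using this
  | left a' b' x y z h1 h2 =>
    have := KStep.left (a ++ a') (b' ++ b) x y z h1 h2
    simpa using this

lemma KEq.context {u v : List L} (h : KEq u v) (a b : List L) :
    KEq (a ++ u ++ b) (a ++ v ++ b) := by
  induction h with
  | rel _ _ h => exact Relation.EqvGen.rel _ _ (h.context a b)
  | refl _ => exact KEq.refl _
  | symm _ _ _ ih => exact ih.symm
  | trans _ _ _ _ _ ih1 ih2 => exact ih1.trans ih2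

lemma KEq.append_left {u v : List L} (h : KEq u v) (a : List L) : KEq (a ++ u) (a ++ v) := by
  simpa using h.context a []

lemma KEq.append_right {u v : List L} (h : KEq u v) (b : List L) : KEq (u ++ b) (v ++ b) := by
  simpa using h.context [] b

lemma KEq.cons {u v : List L} (h : KEq u v) (a : L) : KEq (a :: u) (a :: v) :=
  h.append_left [a]

lemma kEq_right {x y z : L} (h1 : x < y) (h2 : y ≤ z) (b : List L) :
    KEq (y :: z :: x :: b) (y :: x :: z :: b) :=
  Relation.EqvGen.rel _ _ (KStep.right [] b x y z h1 h2)

lemma kEq_left {x y z : L} (h1 : x ≤ y) (h2 : y < z) (b : List L) :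
    KEq (x :: z :: y :: b) (z :: x :: y :: b) :=
  Relation.EqvGen.rel _ _ (KStep.left [] b x y z h1 h2)

lemma pass_left {C : List L} (hC : Desc C) {x y z : L} (h1 : x ≤ y) (h2 : y < z) :
    passC C [x, z, y] = passC C [z, x, y] ∧ KEq (passO C [x, z, y]) (passO C [z, x, y]) := by
  induction C with
  | nil =>
    have e1 : x ≤ z := h1.trans h2.le
    have e2 : ¬ z ≤ y := not_le.2 h2
    have e3 : ¬ z ≤ x := not_le.2 (h1.trans_lt h2)
    simp [passC, passO, stepC, stepO, h1, e1, e2, e3, KEq.refl]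
  | cons a l ih =>
    rw [Desc, List.pairwise_cons] at hC
    have e1 : x ≤ z := h1.trans h2.le
    have e2 : ¬ z ≤ y := not_le.2 h2
    have e3 : ¬ z ≤ x := not_le.2 (h1.trans_lt h2)
    by_cases ax : a ≤ x
    · have az : a ≤ z := ax.trans e1
      cases l with
      | nil => simp [passC, passO, stepC, stepO, h1, e1, e2, e3, ax, az, KEq.refl]
      | cons b l =>
        have ba : b < a := hC.1 b (by simp)
        have bx : b ≤ x := ba.le.trans ax
        have bY : b ≤ y := bx.trans h1
        simp only [passC, passO, stepC, stepO, h1, e1, e2, e3, ax, az, bx, bY, if_true, if_false,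
          Option.toList_some, List.singleton_append, List.append_nil, true_and]
        exact kEq_right ba ax []
    · by_cases az : a ≤ z
      · obtain ⟨q, hq, hxq⟩ := stepO_stepC_of_le hC.2 h1
        have qa : q < a := by
          rcases mem_of_mem_stepC (mem_of_stepO hq).1 with rfl | h
          · exact not_le.1 ax
          · exact hC.1 q h
        simp only [passC, passO, stepC, stepO, e2, e3, ax, az, if_true, if_false,
          Option.toList_some, List.singleton_append, List.append_nil, true_and, hq]
        cases hp : stepO l x with
        | none => exact KEq.refl _
        | some p => exact kEq_left ((mem_of_stepO hp).2.trans hxq) qa []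
      · have ay : ¬ a ≤ y := fun h => az (h.trans h2.le)
        have := ih hC.2
        simpa [passC, passO, stepC, stepO, ax, ay, az] using this

lemma pass_right {C : List L} (hC : Desc C) {x y z : L} (h1 : x < y) (h2 : y ≤ z) :
    passC C [y, z, x] = passC C [y, x, z] ∧ KEq (passO C [y, z, x]) (passO C [y, x, z]) := by
  have e2 : ¬ y ≤ x := not_le.2 h1
  have e3 : ¬ z ≤ x := not_le.2 (h1.trans_le h2)
  induction C with
  | nil => simp [passC, passO, stepC, stepO, h2, e2, e3, KEq.refl]
  | cons a l ih =>
    rw [Desc, List.pairwise_cons] at hC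
    by_cases ay : a ≤ y
    · simp only [passC, passO, stepC, stepO, h2, e2, e3, ay, if_true, if_false,
          Option.toList_some, List.singleton_append, List.append_nil, true_and]
      cases hp : stepO l x with
      | none => exact KEq.refl _
      | some p => exact kEq_right (hC.1 p (mem_of_stepO hp).1) ay []
    · have ax : ¬ a ≤ x := fun h => ay (h.trans h1.le)
      by_cases az : a ≤ z
      · simp only [passC, passO, stepC, stepO, e3, ax, ay, az, if_true, if_false,
          Option.toList_some, List.singleton_append, List.append_nil, true_and]
        cases hp : stepO (stepC l y) x with
        | none => exact KEq.refl _
        | some p =>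
          obtain ⟨q, hq, hpq⟩ := stepO_stepC_of_lt hC.2 h1 hp
          rw [hq]
          exact kEq_right hpq (hC.1 q (mem_of_stepO hq).1).le []
      · have := ih hC.2
        simpa [passC, passO, stepC, stepO, ax, ay, az] using this

lemma KEq.pass {u v : List L} (h : KEq u v) {C : List L} (hC : Desc C) :
    passC C u = passC C v ∧ KEq (passO C u) (passO C v) := by
  induction h with
  | rel _ _ h =>
    cases h with
    | right a b x y z h1 h2 =>
      have := pass_right (desc_passC hC a) h1 h2
      simp only [passC_append, passO_append, this.1, true_and]
      exact this.2.context _ _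
    | left a b x y z h1 h2 =>
      have := pass_left (desc_passC hC a) h1 h2
      simp only [passC_append, passO_append, this.1, true_and]
      exact this.2.context _ _
  | refl _ => exact ⟨rfl, KEq.refl _⟩
  | symm _ _ _ ih => exact ⟨ih.1.symm, ih.2.symm⟩
  | trans _ _ _ _ _ ih1 ih2 => exact ⟨ih1.1.trans ih2.1, ih1.2.trans ih2.2⟩

lemma KEq.col_eq {u v : List L} (h : KEq u v) (c : ℕ) : col u c = col v c := by
  induction c generalizing u v with
  | zero => exact (h.pass desc_nil).1
  | succ c ih => exact ih (h.pass desc_nil).2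

lemma KEq.map_reverse {M : Type*} [LinearOrder M] {f : L → M} (hf : StrictAnti f)
    {u v : List L} (h : KEq u v) : KEq (u.map f).reverse (v.map f).reverse := by
  induction h with
  | rel _ _ h =>
    cases h with
    | right a b x y z h1 h2 =>
      have := KStep.left (b.map f).reverse (a.map f).reverse (f z) (f y) (f x)
        (hf.antitone h2) (hf h1)
      refine KEq.symm (Relation.EqvGen.rel _ _ ?_)
      simpa using this
    | left a b x y z h1 h2 =>
      have := KStep.right (b.map f).reverse (a.map f).reverse (f z) (f y) (f x)
        (hf h2) (hf.antitone h1)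
      refine KEq.symm (Relation.EqvGen.rel _ _ ?_)
      simpa using this
  | refl _ => exact KEq.refl _
  | symm _ _ _ ih => exact ih.symm
  | trans _ _ _ _ _ ih1 ih2 => exact ih1.trans ih2

lemma kEq_slide {y : L} {l : List L} (hl : Desc l) {a : L} (ha : ∀ b ∈ l, b < a) (hay : a ≤ y) :
    KEq (a :: l ++ [y]) (a :: y :: l) := by
  induction l generalizing a with
  | nil => exact KEq.refl _
  | cons b l ih =>
    rw [Desc, List.pairwise_cons] at hl
    have hb : b < a := ha b (by simp)
    exact ((ih hl.2 hl.1 (hb.le.trans hay)).cons a).trans (kEq_right hb hay l).symm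

lemma kEq_step {C : List L} (hC : Desc C) (y : L) :
    KEq (C ++ [y]) ((stepO C y).toList ++ stepC C y) := by
  induction C with
  | nil => exact KEq.refl _
  | cons a l ih =>
    rw [Desc, List.pairwise_cons] at hC
    by_cases h : a ≤ y
    · simpa [stepO, stepC, h] using kEq_slide hC.2 hC.1 h
    · have h' := (ih hC.2).cons a
      simp only [stepO, stepC, h, if_false]
      refine h'.trans ?_
      cases hp : stepO l y with
      | none => exact KEq.refl _
      | some p =>
        obtain ⟨h1, h2⟩ := mem_of_stepO hp
        have hd := desc_stepC hC.2 y
        have hm := self_mem_stepC l y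
        have hall : ∀ b ∈ stepC l y, b < a := by
          intro b hb
          rcases mem_of_mem_stepC hb with rfl | hb
          · exact not_le.1 h
          · exact hC.1 b hb
        cases hs : stepC l y with
        | nil => rw [hs] at hm; simp at hm
        | cons e s =>
          rw [hs] at hd hm hall
          rw [Desc, List.pairwise_cons] at hd
          have hye : y ≤ e := by
            rcases List.mem_cons.1 hm with rfl | hm
            · exact le_rfl
            · exact (hd.1 y hm).le
          exact (kEq_left (h2.trans hye) (hall e (by simp)) s).symm

lemma kEq_pass {C : List L} (hC : Desc C) (w : List L) :
    KEq (C ++ w) (passO C w ++ passC C w) := by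
  induction w generalizing C with
  | nil => simpa [passO, passC] using KEq.refl C
  | cons y w ih =>
    have h1 := (kEq_step hC y).append_right w
    have h2 := (ih (desc_stepC hC y)).append_left (stepO C y).toList
    simp only [passO, passC]
    simp only [List.append_assoc, List.singleton_append] at h1 h2 ⊢
    exact h1.trans h2

/-- The word `col_{N-1} ⋯ col_1 col_0` obtained from the first `N` columns. -/
def colWord (w : List L) : ℕ → List L
  | 0 => []
  | N + 1 => colWord (passO [] w) N ++ passC [] w

lemma length_passO_lt {w : List L} (h : w ≠ []) : (passO [] w).length < w.length := by
  have h1 := (pass_perm [] w).length_eq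
  have h2 : passC [] w ≠ [] := by
    obtain ⟨l, y, rfl⟩ := List.eq_nil_or_concat w |>.resolve_left h
    rw [List.concat_eq_append, passC_append]
    exact List.ne_nil_of_mem (self_mem_stepC _ y)
  have h3 := List.length_pos_iff.2 h2
  simp only [List.length_append, List.length_nil] at h1
  omega

lemma kEq_colWord (w : List L) (N : ℕ) (h : w.length ≤ N) : KEq w (colWord w N) := by
  induction N generalizing w with
  | zero => simp only [nonpos_iff_eq_zero, List.length_eq_zero_iff] at h; subst h; exact KEq.refl _
  | succ N ih =>
    by_cases hw : w = []
    · subst hw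
      have := ih (passO [] ([] : List L)) (by simp [passO])
      exact this.append_right []
    · have h1 := length_passO_lt hw
      exact (kEq_pass desc_nil w).trans ((ih _ (by omega)).append_right _)

lemma col_perm (w : List L) (N : ℕ) (h : w.length ≤ N) : w.Perm (colWord w N) := by
  induction N generalizing w with
  | zero => simp only [nonpos_iff_eq_zero, List.length_eq_zero_iff] at h; subst h; rfl
  | succ N ih =>
    by_cases hw : w = []
    · subst hw
      have := ih (passO [] ([] : List L)) (by simp [passO])
      simpa [colWord, passC, passO] using this
    · have h1 := length_passO_lt hw
      have h2 := (pass_perm [] w).symm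
      exact h2.trans ((ih _ (by omega)).append_right _)

lemma col_eq_nil (w : List L) (c : ℕ) (h : w.length ≤ c) : col w c = [] := by
  induction c generalizing w with
  | zero => simp only [nonpos_iff_eq_zero, List.length_eq_zero_iff] at h; subst h; rfl
  | succ c ih =>
    by_cases hw : w = []
    · subst hw; exact ih _ (by simp [passO])
    · have h1 := length_passO_lt hw
      exact ih _ (by omega)

end Insertion

/-! ### Positions of new boxes -/

section Positions

variable {L : Type*} [LinearOrder L]

/-- The column in which a new box appears when `y` is inserted after the word `w`. -/
def dcol (w : List L) (y : L) : ℕ :=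
  match h : stepO (passC [] w) y with
  | none => 0
  | some p => dcol (passO [] w) p + 1
termination_by w.length
decreasing_by
  apply length_passO_lt
  rintro rfl
  simp [passC, stepO] at h

lemma dcol_of_none {w : List L} {y : L} (h : stepO (passC [] w) y = none) : dcol w y = 0 := by
  rw [dcol]; split <;> simp_all

lemma dcol_of_some {w : List L} {y p : L} (h : stepO (passC [] w) y = some p) :
    dcol w y = dcol (passO [] w) p + 1 := by
  rw [dcol]; split <;> simp_all

lemma passC_concat (C w : List L) (y : L) : passC C (w ++ [y]) = stepC (passC C w) y := by
  rw [passC_append]; rfl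

lemma passO_concat (C w : List L) (y : L) :
    passO C (w ++ [y]) = passO C w ++ (stepO (passC C w) y).toList := by
  rw [passO_append]; simp [passO]

/-- `InsF d S y S'`: inserting `y` into the family of columns `S` yields `S'`, and the new box
appears in column `d`. -/
def InsF : ℕ → (ℕ → List L) → L → (ℕ → List L) → Prop
  | 0, S, y, S' => stepO (S 0) y = none ∧ S' 0 = stepC (S 0) y ∧ ∀ c, S' (c + 1) = S (c + 1)
  | d + 1, S, y, S' => ∃ p, stepO (S 0) y = some p ∧ S' 0 = stepC (S 0) y ∧
      InsF d (fun c => S (c + 1)) p (fun c => S' (c + 1))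

lemma insF_col (w : List L) (y : L) : InsF (dcol w y) (col w) y (col (w ++ [y])) := by
  induction hn : w.length using Nat.strong_induction_on generalizing w y with
  | _ n ih =>
    subst hn
    cases h : stepO (passC [] w) y with
    | none =>
      rw [dcol_of_none h]
      refine ⟨h, passC_concat _ _ _, fun c => ?_⟩
      simp [col, passO_concat, h]
    | some p =>
      rw [dcol_of_some h]
      refine ⟨p, h, passC_concat _ _ _, ?_⟩
      have hw : w ≠ [] := by
        rintro rfl
        simp [passC, stepO] at h
      have := ih _ (length_passO_lt hw) (passO [] w) p rfl
      simpa [col, passO_concat, h] using this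

lemma length_stepC_none {C : List L} {y : L} (h : stepO C y = none) :
    (stepC C y).length = C.length + 1 := by
  simpa [h] using (step_perm C y).length_eq

lemma length_stepC_some {C : List L} {y p : L} (h : stepO C y = some p) :
    (stepC C y).length = C.length := by
  simpa [h] using (step_perm C y).length_eq

lemma InsF.length {d : ℕ} {S S' : ℕ → List L} {y : L} (h : InsF d S y S') (c : ℕ) :
    (S' c).length = (S c).length + if c = d then 1 else 0 := by
  induction d generalizing S S' y c with
  | zero =>
    obtain ⟨h1, h2, h3⟩ := h
    cases c with
    | zero => simp [h2, length_stepC_none h1]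
    | succ c => simp [h3]
  | succ d ih =>
    obtain ⟨p, h1, h2, h3⟩ := h
    cases c with
    | zero => simp [h2, length_stepC_some h1]
    | succ c => simpa using ih h3 c

lemma ht_concat (w : List L) (y : L) (c : ℕ) :
    ht (w ++ [y]) c = ht w c + if c = dcol w y then 1 else 0 :=
  (insF_col w y).length c

lemma stepC_stepO_inj {l l' : List L} (hl : Desc l) (hl' : Desc l') {y y' : L}
    (h1 : stepC l y = stepC l' y') (h2 : stepO l y = stepO l' y') : l = l' ∧ y = y' := by
  have key : ∀ {l l' : List L}, Desc l → Desc l' → ∀ {y y' : L},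
      stepC l y = stepC l' y' → stepO l y = stepO l' y' → ¬ y < y' := by
    intro l l' hl hl' y y' h1 h2 hlt
    have hy' : y' ∈ l := by
      have : y' ∈ stepC l y := h1 ▸ self_mem_stepC l' y'
      exact (mem_of_mem_stepC this).resolve_left (ne_of_gt hlt)
    have hy : y ∈ l' := by
      have : y ∈ stepC l' y' := h1 ▸ self_mem_stepC l y
      exact (mem_of_mem_stepC this).resolve_left (ne_of_lt hlt)
    cases hp : stepO l' y' with
    | none => exact absurd (stepO_eq_none.1 hp y hy) (not_lt.2 hlt.le)
    | some p =>
      have h3 := le_of_stepO hl' hp y hy hlt.le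
      rw [hp] at h2
      have h4 : y = p := le_antisymm h3 (mem_of_stepO h2).2
      subst h4
      have : y ∈ stepC l' y' := h1 ▸ self_mem_stepC l y
      rcases (mem_stepC_iff hl' hp y).1 this with h | h
      · exact h.2 rfl
      · exact absurd h (ne_of_lt hlt)
  have hyy : y = y' := by
    rcases lt_trichotomy y y' with h | h | h
    · exact absurd h (key hl hl' h1 h2)
    · exact h
    · exact absurd h (key hl' hl h1.symm h2.symm)
  subst hyy
  refine ⟨?_, rfl⟩
  have p1 := step_perm l y
  rw [h1, h2] at p1
  have p2 := List.Perm.cons_inv (p1.symm.trans (step_perm l' y))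
  exact p2.eq_of_pairwise (fun a b _ _ h h' => absurd h (lt_asymm h')) hl hl'

lemma InsF.unique {d : ℕ} {S T S' : ℕ → List L} {y z : L} (hS : ∀ c, Desc (S c))
    (hT : ∀ c, Desc (T c)) (h : InsF d S y S') (h' : InsF d T z S') :
    (∀ c, S c = T c) ∧ y = z := by
  induction d generalizing S T S' y z with
  | zero =>
    obtain ⟨h1, h2, h3⟩ := h
    obtain ⟨k1, k2, k3⟩ := h'
    obtain ⟨e1, e2⟩ := stepC_stepO_inj (hS 0) (hT 0) (h2.symm.trans k2) (h1.trans k1.symm)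
    refine ⟨fun c => ?_, e2⟩
    cases c with
    | zero => exact e1
    | succ c => rw [← h3, ← k3]
  | succ d ih =>
    obtain ⟨p, h1, h2, h3⟩ := h
    obtain ⟨q, k1, k2, k3⟩ := h'
    obtain ⟨e3, e4⟩ := ih (fun c => hS (c + 1)) (fun c => hT (c + 1)) h3 k3
    obtain ⟨e1, e2⟩ := stepC_stepO_inj (hS 0) (hT 0) (h2.symm.trans k2) (by rw [h1, k1, e4])
    refine ⟨fun c => ?_, e2⟩
    cases c with
    | zero => exact e1
    | succ c => exact e3 c

lemma InsF.det {d e : ℕ} {S S' T' : ℕ → List L} {y : L} (h : InsF d S y S')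
    (h' : InsF e S y T') : d = e ∧ ∀ c, S' c = T' c := by
  induction d generalizing e S S' T' y with
  | zero =>
    obtain ⟨h1, h2, h3⟩ := h
    cases e with
    | zero =>
      obtain ⟨k1, k2, k3⟩ := h'
      refine ⟨rfl, fun c => ?_⟩
      cases c with
      | zero => rw [h2, k2]
      | succ c => rw [h3, k3]
    | succ e =>
      obtain ⟨q, k1, k2, k3⟩ := h'
      rw [h1] at k1; cases k1
  | succ d ih =>
    obtain ⟨p, h1, h2, h3⟩ := h
    cases e with
    | zero =>
      obtain ⟨k1, k2, k3⟩ := h'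
      rw [h1] at k1; cases k1
    | succ e =>
      obtain ⟨q, k1, k2, k3⟩ := h'
      rw [h1] at k1; cases k1
      obtain ⟨e1, e2⟩ := ih h3 k3
      refine ⟨by rw [e1], fun c => ?_⟩
      cases c with
      | zero => rw [h2, k2]
      | succ c => exact e2 c

lemma dcol_lt_dcol {w : List L} {y y' : L} (h : y ≤ y') : dcol w y < dcol (w ++ [y]) y' := by
  induction hn : w.length using Nat.strong_induction_on generalizing w y y' with
  | _ n ih =>
    subst hn
    obtain ⟨q, hq, hyq⟩ := stepO_stepC_of_le (desc_passC desc_nil w) h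
    rw [← passC_concat] at hq
    rw [dcol_of_some hq]
    cases hp : stepO (passC [] w) y with
    | none => rw [dcol_of_none hp]; omega
    | some p =>
      have hw : w ≠ [] := by
        rintro rfl
        simp [passC, stepO] at hp
      rw [dcol_of_some hp, passO_concat, hp]
      have := ih _ (length_passO_lt hw) ((mem_of_stepO hp).2.trans hyq) rfl
      simpa using this

lemma dcol_le_dcol {w : List L} {y y' : L} (h : y' < y) : dcol (w ++ [y]) y' ≤ dcol w y := by
  induction hn : w.length using Nat.strong_induction_on generalizing w y y' with
  | _ n ih =>
    subst hn
    cases hq : stepO (passC [] (w ++ [y])) y' with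
    | none => rw [dcol_of_none hq]; omega
    | some q =>
      have hq' := hq
      rw [passC_concat] at hq'
      obtain ⟨p, hp, hqp⟩ := stepO_stepC_of_lt (desc_passC desc_nil w) h hq'
      have hw : w ≠ [] := by
        rintro rfl
        simp [passC, stepO] at hp
      rw [dcol_of_some hq, dcol_of_some hp, passO_concat, hp]
      have := ih _ (length_passO_lt hw) hqp rfl
      simpa using this

/-! ### Dominance between consecutive columns -/

/-- `Dom C D`: listed increasingly from the top, the column `D` fits entrywise below `C`. -/
def Dom (C D : List L) : Prop := (∀ t, cnt t D ≤ cnt t C) ∧ D.length ≤ C.length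

lemma Dom.stepC_right {C D : List L} (hD : Desc D) (h : Dom C D) {p : L} (hp : p ∈ C) :
    Dom C (stepC D p) := by
  cases hq : stepO D p with
  | none =>
    have hall := stepO_eq_none.1 hq
    refine ⟨fun t => ?_, ?_⟩
    · rw [cnt_stepC_none hq]
      split_ifs with htp
      · have e1 : cnt t D = cnt p D := cnt_eq_of htp.le fun a ha _ => hall a ha
        have e2 := h.1 p
        have e3 := cnt_lt_of hp htp le_rfl
        omega
      · simpa using h.1 t
    · rw [length_stepC_none hq, ← cnt_eq_length hall]
      have e2 := h.1 p
      have e3 := cnt_lt_length hp le_rfl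
      omega
  | some q =>
    refine ⟨fun t => ?_, by rw [length_stepC_some hq]; exact h.2⟩
    have e := cnt_stepC_some hq t
    have e2 := h.1 t
    by_cases h1 : t < q
    · have h2 : t < p := h1.trans_le (mem_of_stepO hq).2
      simp only [if_pos h1, if_pos h2] at e
      omega
    · by_cases h2 : t < p
      · have e1 : cnt t D = cnt p D := by
          refine cnt_eq_of h2.le fun a ha hta => ?_
          by_contra hap
          exact h1 (hta.trans_le (le_of_stepO hD hq a ha (not_lt.1 hap)))
        have e3 := h.1 p
        have e4 := cnt_lt_of hp h2 le_rfl
        simp only [if_neg h1, if_pos h2] at e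
        omega
      · simp only [if_neg h1, if_neg h2] at e
        omega

lemma Dom.stepC_left {C D : List L} (h : Dom C D) (y : L) : Dom (stepC C y) D := by
  cases hp : stepO C y with
  | none =>
    refine ⟨fun t => ?_, by rw [length_stepC_none hp]; exact h.2.trans (Nat.le_succ _)⟩
    rw [cnt_stepC_none hp]
    exact (h.1 t).trans (Nat.le_add_right _ _)
  | some p =>
    refine ⟨fun t => ?_, by rw [length_stepC_some hp]; exact h.2⟩
    have e := cnt_stepC_some hp t
    have e2 := h.1 t
    have e3 := (mem_of_stepO hp).2
    by_cases h1 : t < p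
    · simp only [if_pos h1, if_pos (h1.trans_le e3)] at e
      omega
    · simp only [if_neg h1] at e
      omega

lemma dom_col (w : List L) (c : ℕ) : Dom (col w c) (col w (c + 1)) := by
  induction c generalizing w with
  | zero =>
    simp only [col]
    induction w using List.reverseRecOn with
    | nil => exact ⟨fun t => by simp [passC, passO], by simp [passC, passO]⟩
    | append_singleton w y ih =>
      rw [passC_concat, passO_concat]
      refine Dom.stepC_left ?_ y
      cases hp : stepO (passC [] w) y with
      | none => simpa using ih
      | some p =>
        simp only [Option.toList_some, passC_concat]
        exact ih.stepC_right (desc_passC desc_nil _) (mem_of_stepO hp).1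
  | succ c ih => exact ih _

lemma ht_antitone (w : List L) : Antitone (ht w) :=
  antitone_nat_of_succ_le fun c => (dom_col w c).2

lemma dcol_lt_length (w : List L) (y : L) : dcol w y < w.length + 1 := by
  by_contra h
  have h1 := ht_concat w y (dcol w y)
  have h2 : ht (w ++ [y]) (dcol w y) = 0 := by
    rw [ht, col_eq_nil _ _ (by simpa using h)]; rfl
  simp only [if_true] at h1
  omega

/-! ### The sequences of columns and rows of new boxes -/

/-- The columns of the new boxes when the letters of a word are inserted after `w`. -/
def dlist : List L → List L → List ℕ
  | _, [] => []
  | w, y :: b => dcol w y :: dlist (w ++ [y]) b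

/-- The rows of the new boxes when the letters of a word are inserted after `w`. -/
def rlist : List L → List L → List ℕ
  | _, [] => []
  | w, y :: b => ht w (dcol w y) :: rlist (w ++ [y]) b

lemma dlist_append (w a b : List L) : dlist w (a ++ b) = dlist w a ++ dlist (w ++ a) b := by
  induction a generalizing w with
  | nil => simp [dlist]
  | cons x a ih => simp [dlist, ih]

lemma rlist_append (w a b : List L) : rlist w (a ++ b) = rlist w a ++ rlist (w ++ a) b := by
  induction a generalizing w with
  | nil => simp [rlist]
  | cons x a ih => simp [rlist, ih]

lemma length_dlist (w b : List L) : (dlist w b).length = b.length := by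
  induction b generalizing w with
  | nil => rfl
  | cons x b ih => simp [dlist, ih]

lemma length_rlist (w b : List L) : (rlist w b).length = b.length := by
  induction b generalizing w with
  | nil => rfl
  | cons x b ih => simp [rlist, ih]

lemma ht_append (w b : List L) (c : ℕ) : ht (w ++ b) c = ht w c + (dlist w b).count c := by
  induction b generalizing w with
  | nil => simp [dlist]
  | cons x b ih =>
    have h1 := ih (w ++ [x])
    rw [ht_concat] at h1
    simp only [List.append_assoc, List.singleton_append] at h1
    rw [h1, dlist, List.count_cons]
    simp only [beq_iff_eq, eq_comm (a := c)]
    ring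

lemma ht_nil (c : ℕ) : ht ([] : List L) c = 0 := by rw [ht, col_eq_nil _ _ (by simp)]; rfl

lemma ht_eq_count (w : List L) (c : ℕ) : ht w c = (dlist [] w).count c := by
  have := ht_append [] w c
  rwa [ht_nil, Nat.zero_add, List.nil_append] at this

lemma dlist_strict {b : List L} (h : b.IsChain (· ≤ ·)) (w : List L) :
    (dlist w b).IsChain (· < ·) := by
  induction b generalizing w with
  | nil => simp [dlist]
  | cons x b ih =>
    cases b with
    | nil => simp [dlist]
    | cons y b =>
      rw [List.isChain_cons_cons] at h
      have := ih h.2 (w ++ [x])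
      simp only [dlist] at this ⊢
      exact List.isChain_cons_cons.2 ⟨dcol_lt_dcol h.1, this⟩

lemma rlist_strict {b : List L} (h : b.IsChain (· > ·)) (w : List L) :
    (rlist w b).IsChain (· < ·) := by
  induction b generalizing w with
  | nil => simp [rlist]
  | cons x b ih =>
    cases b with
    | nil => simp [rlist]
    | cons y b =>
      rw [List.isChain_cons_cons] at h
      have := ih h.2 (w ++ [x])
      simp only [rlist] at this ⊢
      refine List.isChain_cons_cons.2 ⟨?_, this⟩
      have h1 := ht_antitone (w ++ [x]) (dcol_le_dcol (w := w) h.1)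
      have h2 := ht_concat w x (dcol w x)
      simp only [if_true] at h2
      omega

lemma count_range (r h : ℕ) : (List.range h).count r = if r < h then 1 else 0 := by
  split_ifs with hr
  · exact List.count_eq_one_of_mem List.nodup_range (by simpa using hr)
  · exact List.count_eq_zero_of_not_mem (by simpa using hr)

lemma count_rlist (w : List L) (N r : ℕ) (hN : w.length ≤ N) :
    (rlist [] w).count r = ((List.range N).filter fun c => decide (r < ht w c)).length := by
  have key : ∀ w : List L, w.length ≤ N → (rlist [] w).count r =
      ((Finset.range N).filter fun c => r < ht w c).card := by
    intro w
    induction w using List.reverseRecOn with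
    | nil => intro _; simp [rlist, ht_nil]
    | append_singleton w y ih =>
      intro hw
      simp only [List.length_append, List.length_singleton] at hw
      have hd : dcol w y < N := (dcol_lt_length w y).trans_le hw
      rw [rlist_append, List.count_append, ih (by omega)]
      simp only [rlist, List.nil_append, List.count_cons, List.count_nil, beq_iff_eq]
      have e : ∀ c, c ≠ dcol w y → ht (w ++ [y]) c = ht w c := fun c hc => by
        rw [ht_concat, if_neg hc]; rfl
      have e' : ht (w ++ [y]) (dcol w y) = ht w (dcol w y) + 1 := by
        rw [ht_concat, if_pos rfl]
      by_cases h : ht w (dcol w y) = r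
      · have : (Finset.range N).filter (fun c => r < ht (w ++ [y]) c) =
            insert (dcol w y) ((Finset.range N).filter fun c => r < ht w c) := by
          ext c
          simp only [Finset.mem_filter, Finset.mem_range, Finset.mem_insert]
          by_cases hc : c = dcol w y
          · subst hc; simp [hd, e', h]
          · simp [hc, e c hc]
        rw [this, Finset.card_insert_of_notMem (by simp [h]), if_pos h]
      · rw [if_neg h]
        simp only [Nat.add_zero]
        congr 1
        ext c
        simp only [Finset.mem_filter, Finset.mem_range, and_congr_right_iff]
        intro _
        by_cases hc : c = dcol w y
        · subst hc; rw [e']; omega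
        · rw [e c hc]
  rw [key w hN]
  simp [Finset.card, Finset.filter, Finset.range, Multiset.range]

end Positions

/-! ### Factorizations into monotone blocks -/

lemma length_le_of_strict {l : List ℕ} {x : ℕ} (h : (l ++ [x]).Pairwise (· < ·)) :
    l.length ≤ x := by
  induction l using List.reverseRecOn generalizing x with
  | nil => exact Nat.zero_le _
  | append_singleton l z ih =>
    rw [List.pairwise_append] at h
    have h1 := ih h.1
    have h2 := h.2.2 z (by simp) x (by simp)
    rw [List.length_append, List.length_singleton]
    omega

lemma sum_range_le {l : List ℕ} (h : l.Pairwise (· < ·)) :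
    (List.range l.length).sum ≤ l.sum ∧
      (l.sum ≤ (List.range l.length).sum → l = List.range l.length) := by
  induction l using List.reverseRecOn with
  | nil => simp
  | append_singleton l x ih =>
    have h1 := length_le_of_strict h
    have h2 := ih (List.pairwise_append.1 h).1
    simp only [List.length_append, List.length_singleton, List.range_succ, List.sum_append,
      List.sum_singleton]
    refine ⟨by omega, fun h3 => ?_⟩
    rw [← h2.2 (by omega), show l.length = x by omega]

/-- Among families of strictly increasing blocks of given lengths, the initial segments have the
smallest total sum. -/
lemma blocks_sum_le {B : List (List ℕ)} (h : ∀ b ∈ B, b.Pairwise (· < ·)) :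
    (B.map fun b => List.range b.length).flatten.sum ≤ B.flatten.sum ∧
      (B.flatten.sum ≤ (B.map fun b => List.range b.length).flatten.sum →
        ∀ b ∈ B, b = List.range b.length) := by
  induction B with
  | nil => simp
  | cons b B ih =>
    have h1 := sum_range_le (h b (by simp))
    have h2 := ih fun b' hb' => h b' (by simp [hb'])
    simp only [List.map_cons, List.flatten_cons, List.sum_append, List.mem_cons]
    refine ⟨by omega, ?_⟩
    rintro h3 b' (rfl | hb')
    · exact h1.2 (by omega)
    · exact h2.2 (by omega) b' hb'

lemma count_ranges {L : Type*} (B : List (List L)) (c : ℕ) :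
    (B.map fun b => List.range b.length).flatten.count c =
      B.countP fun b => decide (c < b.length) := by
  induction B with
  | nil => rfl
  | cons b B ih =>
    simp only [List.map_cons, List.flatten_cons, List.count_append, count_range, ih,
      List.countP_cons, decide_eq_true_eq]
    ring

section Blocks

variable {L : Type*} [LinearOrder L]

/-- The column sequences of the successive blocks. -/
def dblocks : List L → List (List L) → List (List ℕ)
  | _, [] => []
  | w, b :: B => dlist w b :: dblocks (w ++ b) B

/-- The row sequences of the successive blocks. -/
def rblocks : List L → List (List L) → List (List ℕ)
  | _, [] => []
  | w, b :: B => rlist w b :: rblocks (w ++ b) B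

lemma flatten_dblocks (w : List L) (B : List (List L)) :
    (dblocks w B).flatten = dlist w B.flatten := by
  induction B generalizing w with
  | nil => rfl
  | cons b B ih => simp [dblocks, ih, dlist_append]

lemma flatten_rblocks (w : List L) (B : List (List L)) :
    (rblocks w B).flatten = rlist w B.flatten := by
  induction B generalizing w with
  | nil => rfl
  | cons b B ih => simp [rblocks, ih, rlist_append]

lemma lengths_dblocks (w : List L) (B : List (List L)) :
    (dblocks w B).map (fun b => List.range b.length) = B.map (fun b => List.range b.length) := by
  induction B generalizing w with
  | nil => rfl
  | cons b B ih => simp [dblocks, ih, length_dlist]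

lemma lengths_rblocks (w : List L) (B : List (List L)) :
    (rblocks w B).map (fun b => List.range b.length) = B.map (fun b => List.range b.length) := by
  induction B generalizing w with
  | nil => rfl
  | cons b B ih => simp [rblocks, ih, length_rlist]

lemma strict_dblocks {B : List (List L)} (h : ∀ b ∈ B, b.IsChain (· ≤ ·)) (w : List L) :
    ∀ b ∈ dblocks w B, b.Pairwise (· < ·) := by
  induction B generalizing w with
  | nil => simp [dblocks]
  | cons b B ih =>
    simp only [dblocks, List.mem_cons, forall_eq_or_imp] at h ⊢
    exact ⟨List.isChain_iff_pairwise.1 (dlist_strict h.1 w), ih h.2 _⟩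

lemma strict_rblocks {B : List (List L)} (h : ∀ b ∈ B, b.IsChain (· > ·)) (w : List L) :
    ∀ b ∈ rblocks w B, b.Pairwise (· < ·) := by
  induction B generalizing w with
  | nil => simp [rblocks]
  | cons b B ih =>
    simp only [rblocks, List.mem_cons, forall_eq_or_imp] at h ⊢
    exact ⟨List.isChain_iff_pairwise.1 (rlist_strict h.1 w), ih h.2 _⟩

lemma mem_dblocks (w : List L) (B B' : List (List L)) (b : List L) :
    dlist (w ++ B.flatten) b ∈ dblocks w (B ++ b :: B') := by
  induction B generalizing w with
  | nil => simp [dblocks]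
  | cons a B ih =>
    have := ih (w ++ a)
    simp only [List.append_assoc] at this
    simp [dblocks, this]

/-- If the shape of a product of weakly increasing blocks is as small as possible, each block
occupies an initial segment of columns. -/
lemma dlist_block_eq_range {B B' : List (List L)} {b : List L}
    (h : ∀ a ∈ B ++ b :: B', a.IsChain (· ≤ ·))
    (hht : ∀ c, ht (B ++ b :: B').flatten c =
      (B ++ b :: B').countP fun a => decide (c < a.length)) :
    dlist B.flatten b = List.range b.length := by
  have h1 := (blocks_sum_le (strict_dblocks h [])).2
  have h2 : (dblocks [] (B ++ b :: B')).flatten.Perm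
      ((dblocks [] (B ++ b :: B')).map fun b => List.range b.length).flatten := by
    rw [List.perm_iff_count]
    intro c
    rw [lengths_dblocks, count_ranges, ← hht, flatten_dblocks, ← ht_eq_count]
  have h3 := h1 h2.sum_eq.le _ (mem_dblocks [] B B' b)
  simpa [length_dlist] using h3

/-! ### Shapes of reversed words -/

lemma count_rlist_eq (w : List L) (N r : ℕ) (hN : w.length ≤ N) :
    (rlist [] w).count r =
      ((List.range N).map fun c => List.range (ht w c)).flatten.count r := by
  rw [count_rlist w N r hN]
  generalize List.range N = l
  induction l with
  | nil => rfl
  | cons c l ih =>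
    rw [List.map_cons, List.flatten_cons, List.count_append, count_range, ← ih, List.filter_cons]
    split_ifs <;> simp_all
    omega

lemma map_reverse_colWord {M : Type*} (f : L → M) (u : List L) (N : ℕ) :
    ((colWord u N).map f).reverse =
      ((List.range N).map fun c => ((col u c).map f).reverse).flatten := by
  induction N generalizing u with
  | zero => rfl
  | succ N ih =>
    rw [colWord, List.range_succ_eq_map, List.map_append, List.reverse_append, ih]
    simp [col, Function.comp_def]

lemma rlist_reverse_le {M : Type*} [LinearOrder M] {f : L → M} (hf : StrictAnti f) (u : List L)
    {N : ℕ} (hN : u.length ≤ N) :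
    ((List.range N).map fun c => List.range (ht u c)).flatten.sum ≤
        ((List.range N).map fun c => List.range (ht (u.map f).reverse c)).flatten.sum ∧
      (((List.range N).map fun c => List.range (ht (u.map f).reverse c)).flatten.sum ≤
          ((List.range N).map fun c => List.range (ht u c)).flatten.sum →
        ∀ r, ((List.range N).map fun c => List.range (ht u c)).flatten.count r =
          ((List.range N).map fun c => List.range (ht (u.map f).reverse c)).flatten.count r) := by
  set B := (List.range N).map fun c => ((col u c).map f).reverse with hB
  have hht : ∀ c, ht (u.map f).reverse c = ht B.flatten c := by
    intro c
    have := ((kEq_colWord u N hN).map_reverse hf).col_eq c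
    rw [map_reverse_colWord, ← hB] at this
    rw [ht, ht, this]
  have hlen : B.flatten.length = u.length := by
    rw [hB, ← map_reverse_colWord, List.length_reverse, List.length_map]
    exact (col_perm u N hN).length_eq.symm
  have hdec : ∀ b ∈ B, b.IsChain (· > ·) := by
    intro b hb
    rw [hB, List.mem_map] at hb
    obtain ⟨c, -, rfl⟩ := hb
    rw [List.isChain_iff_pairwise, List.pairwise_reverse, List.pairwise_map]
    exact (desc_col u c).imp fun h => hf h
  have e1 : (rblocks [] B).map (fun b => List.range b.length) =
      (List.range N).map fun c => List.range (ht u c) := by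
    rw [lengths_rblocks, hB, List.map_map]
    simp [Function.comp_def, ht]
  have e2 : (rlist [] B.flatten).Perm
      ((List.range N).map fun c => List.range (ht (u.map f).reverse c)).flatten := by
    rw [List.perm_iff_count]
    intro r
    rw [count_rlist_eq _ N r (hlen.trans_le hN)]
    simp only [hht]
  have h := blocks_sum_le (strict_rblocks hdec [])
  rw [e1, flatten_rblocks, e2.sum_eq] at h
  refine ⟨h.1, fun h' r => ?_⟩
  rw [← e2.count_eq, ← e1, ← flatten_rblocks]
  congr 2
  refine (List.map_congr_left fun b hb => (h.2 h' b hb).symm).trans (List.map_id _)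

lemma antitone_eq_of_count {h k : ℕ → ℕ} (hh : Antitone h) (hk : Antitone k) (N : ℕ)
    (e : ∀ r, ((List.range N).map fun c => List.range (h c)).flatten.count r =
      ((List.range N).map fun c => List.range (k c)).flatten.count r) :
    ∀ c < N, h c ≤ k c := by
  have key : ∀ (h : ℕ → ℕ) r, ((List.range N).map fun c => List.range (h c)).flatten.count r =
      ((Finset.range N).filter fun c => r < h c).card := by
    intro h r
    have : ((Finset.range N).filter fun c => r < h c).card =
        ((List.range N).filter fun c => decide (r < h c)).length := by
      simp [Finset.card, Finset.filter, Finset.range, Multiset.range]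
    rw [this]
    generalize List.range N = l
    induction l with
    | nil => rfl
    | cons c l ih =>
      rw [List.map_cons, List.flatten_cons, List.count_append, count_range, ih, List.filter_cons]
      split_ifs <;> simp_all <;> omega
  intro c hc
  by_contra hlt
  have e1 := e (k c)
  rw [key, key] at e1
  have h1 : (Finset.range N).filter (fun c' => k c < k c') ⊆ Finset.range c := by
    intro c' hc'
    simp only [Finset.mem_filter, Finset.mem_range] at hc' ⊢
    by_contra h'
    exact absurd (hk (not_lt.1 h')) (not_le.2 hc'.2)
  have h2 : Finset.range (c + 1) ⊆ (Finset.range N).filter (fun c' => k c < h c') := by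
    intro c' hc'
    simp only [Finset.mem_filter, Finset.mem_range] at hc' ⊢
    exact ⟨by omega, (not_le.1 hlt).trans_le (hh (Nat.lt_succ_iff.1 hc'))⟩
  have h3 := Finset.card_le_card h1
  have h4 := Finset.card_le_card h2
  simp only [Finset.card_range] at h3 h4
  omega

/-- Reversing a word and its alphabet does not change the column heights. -/
lemma ht_map_reverse {M : Type*} [LinearOrder M] {f : L → M} {f' : M → L} (hf : StrictAnti f)
    (hf' : StrictAnti f') (hff : ∀ x, f' (f x) = x) (u : List L) (c : ℕ) :
    ht (u.map f).reverse c = ht u c := by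
  have h1 := rlist_reverse_le hf u le_rfl
  have h2 := rlist_reverse_le hf' (u.map f).reverse (N := u.length) (by simp)
  have e : (((u.map f).reverse).map f').reverse = u := by
    simp [List.map_reverse, Function.comp_def, hff]
  rw [e] at h2
  have h3 := h1.2 h2.1
  by_cases hc : c < u.length
  · exact le_antisymm
      (antitone_eq_of_count (ht_antitone _) (ht_antitone _) _ (fun r => (h3 r).symm) c hc)
      (antitone_eq_of_count (ht_antitone _) (ht_antitone _) _ h3 c hc)
  · rw [ht, ht, col_eq_nil _ _ (by simpa using hc), col_eq_nil _ _ (by simpa using hc)]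
    rfl

end Blocks

/-! ### Inserting the same word into two columns -/

section Invariant

variable {L : Type*} [LinearOrder L]

/-- The invariant relating the columns obtained by inserting a word into a column (`C`), into the
empty column (`A`), and by inserting the letters bumped from the former into the empty column
(`B`). -/
structure ColRel (C A B : List L) : Prop where
  descC : Desc C
  descA : Desc A
  descB : Desc B
  sub : ∀ x ∈ A, x ∈ C
  dom : Dom A B
  cnt_eq : ∀ c ∈ C, c ∉ A → cnt c A = cnt c B

lemma cnt_eq_of_stepO {C : List L} (hC : Desc C) {y p t : L} (hp : stepO C y = some p)
    (h1 : p ≤ t) (h2 : t ≤ y) : cnt t C = cnt y C := by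
  refine cnt_eq_of h2 fun a ha hta => ?_
  by_contra hay
  exact absurd (h1.trans_lt hta) (not_lt.2 (le_of_stepO hC hp a ha (not_lt.1 hay)))

lemma cnt_eq_of_none {C : List L} {y t : L} (hp : stepO C y = none)
    (h2 : t ≤ y) : cnt t C = cnt y C :=
  cnt_eq_of h2 fun a ha _ => stepO_eq_none.1 hp a ha

lemma ColRel.step_none {C A B : List L} (h : ColRel C A B) {y : L} (hy : stepO C y = none) :
    ColRel (stepC C y) (stepC A y) B := by
  have hC := stepO_eq_none.1 hy
  have hA : stepO A y = none := stepO_eq_none.2 fun c hc => hC c (h.sub c hc)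
  have eC := stepC_of_none hy
  have eA := stepC_of_none hA
  refine ⟨desc_stepC h.descC y, desc_stepC h.descA y, h.descB, ?_, h.dom.stepC_left y, ?_⟩
  · intro x hx
    rw [eA] at hx
    rw [eC]
    simp only [List.mem_append, List.mem_singleton] at hx ⊢
    exact hx.imp_left (h.sub x)
  · intro c hc hcA
    rw [eC] at hc
    rw [eA] at hcA
    simp only [List.mem_append, List.mem_singleton, not_or] at hc hcA
    have hc := hc.resolve_right hcA.2
    rw [cnt_stepC_none hA, if_neg (not_lt.2 (hC c hc).le), h.cnt_eq c hc hcA.1, Nat.add_zero]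

lemma ColRel.step_mem {C A B : List L} (h : ColRel C A B) {y p : L} (hy : stepO C y = some p)
    (hp : p ∈ A) : ColRel (stepC C y) (stepC A y) (stepC B p) := by
  obtain ⟨hpC, hpy⟩ := mem_of_stepO hy
  have hA : stepO A y = some p := by
    cases hs : stepO A y with
    | none => exact absurd (stepO_eq_none.1 hs p hp) (not_lt.2 hpy)
    | some s =>
      obtain ⟨h1, h2⟩ := mem_of_stepO hs
      rw [le_antisymm (le_of_stepO h.descC hy s (h.sub s h1) h2)
        (le_of_stepO h.descA hs p hp hpy)]
  refine ⟨desc_stepC h.descC y, desc_stepC h.descA y, desc_stepC h.descB p, ?_,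
    (h.dom.stepC_right h.descB hp).stepC_left y, ?_⟩
  · intro x hx
    rw [mem_stepC_iff h.descA hA] at hx
    rw [mem_stepC_iff h.descC hy]
    exact hx.imp_left fun h' => ⟨h.sub x h'.1, h'.2⟩
  · intro c hc hcA
    rw [mem_stepC_iff h.descA hA] at hcA
    rw [mem_stepC_iff h.descC hy] at hc
    simp only [not_or, not_and, not_not] at hcA
    have hc := hc.resolve_right hcA.2
    have hcA' : c ∉ A := fun h' => hc.2 (hcA.1 h')
    have e0 := h.cnt_eq c hc.1 hcA'
    have hle : c < y → c < p := fun h' =>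
      lt_of_le_of_ne (le_of_stepO h.descC hy c hc.1 h'.le) hc.2
    have e1 := cnt_stepC_some hA c
    have e2 := h.dom.1 p
    by_cases hcp : c < p
    · have e3 := cnt_lt_of hp hcp le_rfl
      simp only [if_pos hcp, if_pos (hcp.trans_le hpy)] at e1
      cases hq : stepO B p with
      | none =>
        have e4 := cnt_eq_of_none hq hcp.le
        omega
      | some q =>
        have e4 := cnt_stepC_some hq c
        by_cases hcq : c < q
        · simp only [if_pos hcp, if_pos hcq] at e4
          omega
        · have e5 := cnt_eq_of_stepO h.descB hq (not_lt.1 hcq) hcp.le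
          omega
    · simp only [if_neg hcp, if_neg (fun h' => hcp (hle h'))] at e1
      cases hq : stepO B p with
      | none =>
        have e4 := cnt_stepC_none hq c
        simp only [if_neg hcp] at e4
        omega
      | some q =>
        have e4 := cnt_stepC_some hq c
        simp only [if_neg hcp, if_neg (fun h' => hcp (lt_of_lt_of_le h' (mem_of_stepO hq).2))] at e4
        omega

lemma ColRel.step_not_mem {C A B : List L} (h : ColRel C A B) {y p : L}
    (hy : stepO C y = some p) (hp : p ∉ A) :
    ColRel (stepC C y) (stepC A y) (stepC B p) := by
  obtain ⟨hpC, hpy⟩ := mem_of_stepO hy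
  have e0 := h.cnt_eq p hpC hp
  have hsp : ∀ s ∈ A, s ≤ y → s < p := fun s hs hsy =>
    lt_of_le_of_ne (le_of_stepO h.descC hy s (h.sub s hs) hsy) fun h' => hp (h' ▸ hs)
  refine ⟨desc_stepC h.descC y, desc_stepC h.descA y, desc_stepC h.descB p, ?_, ⟨?_, ?_⟩, ?_⟩
  · intro x hx
    rw [mem_stepC_iff h.descC hy]
    rcases mem_of_mem_stepC hx with hx | hx
    · exact Or.inr hx
    · exact Or.inl ⟨h.sub x hx, fun h' => hp (h' ▸ hx)⟩
  · intro t
    have hd := h.dom.1 t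
    by_cases htp : t < p
    · have hty := htp.trans_le hpy
      cases hs : stepO A y with
      | none =>
        have e1 := cnt_stepC_none hs t
        simp only [if_pos hty] at e1
        cases hq : stepO B p with
        | none =>
          have e2 := cnt_stepC_none hq t
          simp only [if_pos htp] at e2
          omega
        | some q =>
          have e2 := cnt_stepC_some hq t
          simp only [if_pos htp] at e2
          omega
      | some s =>
        have e1 := cnt_stepC_some hs t
        obtain ⟨hsA, hsy⟩ := mem_of_stepO hs
        simp only [if_pos hty] at e1
        by_cases hts : t < s
        · have e3 := cnt_lt_of hsA hts (hsp s hsA hsy).le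
          simp only [if_pos hts] at e1
          cases hq : stepO B p with
          | none =>
            have e2 := cnt_stepC_none hq t
            have e4 := cnt_eq_of_none hq htp.le
            simp only [if_pos htp] at e2
            omega
          | some q =>
            have e2 := cnt_stepC_some hq t
            by_cases htq : t < q
            · simp only [if_pos htp, if_pos htq] at e2
              omega
            · have e4 := cnt_eq_of_stepO h.descB hq (not_lt.1 htq) htp.le
              simp only [if_pos htp] at e2
              omega
        · simp only [if_neg hts] at e1
          cases hq : stepO B p with
          | none =>
            have e2 := cnt_stepC_none hq t
            simp only [if_pos htp] at e2
            omega
          | some q =>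
            have e2 := cnt_stepC_some hq t
            simp only [if_pos htp] at e2
            omega
    · have e1 : cnt t (stepC B p) ≤ cnt t B := by
        cases hq : stepO B p with
        | none =>
          have e2 := cnt_stepC_none hq t
          simp only [if_neg htp] at e2
          omega
        | some q =>
          have e2 := cnt_stepC_some hq t
          simp only [if_neg htp] at e2
          omega
      have e2 : cnt t A ≤ cnt t (stepC A y) := by
        cases hs : stepO A y with
        | none => rw [cnt_stepC_none hs]; omega
        | some s =>
          have e3 := cnt_stepC_some hs t
          have h4 : ¬ t < s := fun h' =>
            htp (h'.trans (hsp s (mem_of_stepO hs).1 (mem_of_stepO hs).2))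
          simp only [if_neg h4] at e3
          omega
      omega
  · have hd := h.dom.2
    cases hs : stepO A y with
    | none =>
      have e1 := length_stepC_none hs
      cases hq : stepO B p with
      | none => have e2 := length_stepC_none hq; omega
      | some q => have e2 := length_stepC_some hq; omega
    | some s =>
      have e1 := length_stepC_some hs
      obtain ⟨hsA, hsy⟩ := mem_of_stepO hs
      cases hq : stepO B p with
      | none =>
        have e2 := length_stepC_none hq
        have e3 := cnt_lt_length hsA (hsp s hsA hsy).le
        have e4 := cnt_eq_length (stepO_eq_none.1 hq)
        omega
      | some q => have e2 := length_stepC_some hq; omega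
  · intro c hc hcA
    rw [mem_stepC_iff h.descC hy] at hc
    have hcy : c ≠ y := fun h' => hcA (h' ▸ self_mem_stepC A y)
    have hc := hc.resolve_right hcy
    by_cases hcp : c < p
    · have hcy' := hcp.trans_le hpy
      have hB : cnt c B = cnt p B → cnt c (stepC B p) = cnt c B + 1 := by
        intro e
        cases hq : stepO B p with
        | none =>
          have e2 := cnt_stepC_none hq c
          simpa only [if_pos hcp] using e2
        | some q =>
          have e2 := cnt_stepC_some hq c
          obtain ⟨hqB, hqp⟩ := mem_of_stepO hq
          have hcq : ¬ c < q := fun h' => by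
            have := cnt_lt_of hqB h' hqp
            omega
          simpa only [if_pos hcp, if_neg hcq, Nat.add_zero] using e2
      cases hs : stepO A y with
      | none =>
        have e1 := cnt_stepC_none hs c
        simp only [if_pos hcy'] at e1
        have hcA' : c ∉ A := fun h' => absurd (stepO_eq_none.1 hs c h') (not_lt.2 hcy'.le)
        have e2 := h.cnt_eq c hc.1 hcA'
        have e3 := cnt_eq_of_none hs hcy'.le
        have e4 := cnt_eq_of_none hs hpy
        have e5 := hB (by omega)
        omega
      | some s =>
        obtain ⟨hsA, hsy⟩ := mem_of_stepO hs
        have hsp' := hsp s hsA hsy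
        have e1 := cnt_stepC_some hs c
        simp only [if_pos hcy'] at e1
        have e4 := cnt_eq_of_stepO h.descA hs hsp'.le hpy
        rw [mem_stepC_iff h.descA hs] at hcA
        simp only [not_or, not_and, not_not] at hcA
        by_cases hcs : c < s
        · have e2 := h.cnt_eq c hc.1 fun h' => absurd (hcA.1 h') hcs.ne
          simp only [if_pos hcs] at e1
          have e3 := cnt_lt_of hsA hcs hsp'.le
          cases hq : stepO B p with
          | none => have := cnt_eq_of_none hq hcp.le; omega
          | some q =>
            have e5 := cnt_stepC_some hq c
            by_cases hcq : c < q
            · simp only [if_pos hcp, if_pos hcq] at e5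
              omega
            · have := cnt_eq_of_stepO h.descB hq (not_lt.1 hcq) hcp.le
              omega
        · simp only [if_neg hcs] at e1
          have e3 := cnt_eq_of_stepO h.descA hs (not_lt.1 hcs) hcy'.le
          have e5 := h.dom.1 c
          have e6 := cnt_mono hcp.le B
          have e7 := hB (by omega)
          by_cases hcA' : c ∈ A
          · omega
          · have := h.cnt_eq c hc.1 hcA'
            omega
    · have hcy' : ¬ c < y := fun h' =>
        hcp (lt_of_le_of_ne (le_of_stepO h.descC hy c hc.1 h'.le) hc.2)
      have e1 : cnt c (stepC B p) = cnt c B := by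
        cases hq : stepO B p with
        | none =>
          have e2 := cnt_stepC_none hq c
          simpa only [if_neg hcp, Nat.add_zero] using e2
        | some q =>
          have e2 := cnt_stepC_some hq c
          have hcq : ¬ c < q := fun h' => hcp (h'.trans_le (mem_of_stepO hq).2)
          simpa only [if_neg hcp, if_neg hcq, Nat.add_zero] using e2
      cases hs : stepO A y with
      | none =>
        have e2 := cnt_stepC_none hs c
        simp only [if_neg hcy'] at e2
        have hcA' : c ∉ A := fun h' => hcA (by
          rw [stepC_of_none hs]; exact List.mem_append_left _ h')
        have := h.cnt_eq c hc.1 hcA'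
        omega
      | some s =>
        obtain ⟨hsA, hsy⟩ := mem_of_stepO hs
        have hcs : ¬ c < s := fun h' => hcp (h'.trans (hsp s hsA hsy))
        have e2 := cnt_stepC_some hs c
        simp only [if_neg hcy', if_neg hcs] at e2
        have hcA' : c ∉ A := fun h' => hcA (by
          rw [mem_stepC_iff h.descA hs]
          exact Or.inl ⟨h', fun h'' => hcp (h'' ▸ hsp s hsA hsy)⟩)
        have := h.cnt_eq c hc.1 hcA'
        omega

lemma colRel_pass {C : List L} (hC : Desc C) (a : List L) :
    ColRel (passC C a) (passC [] a) (passC [] (passO C a)) ∧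
      (passC C a).length ≤ (passC [] a).length + C.length := by
  induction a using List.reverseRecOn with
  | nil =>
    exact ⟨⟨hC, desc_nil, desc_nil, by simp [passC], ⟨fun t => le_rfl, le_rfl⟩,
      fun _ _ _ => rfl⟩, by simp [passC]⟩
  | append_singleton a y ih =>
    obtain ⟨h, hl⟩ := ih
    simp only [passC_concat, passO_concat]
    cases hp : stepO (passC C a) y with
    | none =>
      have hA : stepO (passC [] a) y = none :=
        stepO_eq_none.2 fun c hc => stepO_eq_none.1 hp c (h.sub c hc)
      refine ⟨by simpa using h.step_none hp, ?_⟩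
      rw [length_stepC_none hp, length_stepC_none hA]
      omega
    | some p =>
      refine ⟨?_, ?_⟩
      · simp only [Option.toList_some, passC_concat]
        by_cases hpA : p ∈ passC [] a
        · exact h.step_mem hp hpA
        · exact h.step_not_mem hp hpA
      · rw [length_stepC_some hp]
        cases hs : stepO (passC [] a) y with
        | none => rw [length_stepC_none hs]; omega
        | some s => rw [length_stepC_some hs]; omega

/-! ### The words inserted into each column -/

/-- The word inserted into column `c` when the letters of `b` are inserted after `w`. -/
def levw : List L → List L → ℕ → List L
  | _, b, 0 => b
  | w, b, c + 1 => levw (passO [] w) (passO (passC [] w) b) c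

lemma col_append (w b : List L) (c : ℕ) : col (w ++ b) c = passC (col w c) (levw w b c) := by
  induction c generalizing w b with
  | zero => exact passC_append _ _ _
  | succ c ih => rw [col, passO_append, ih]; rfl

lemma levw_succ (w b : List L) (c : ℕ) : levw w b (c + 1) = passO (col w c) (levw w b c) := by
  induction c generalizing w b with
  | zero => rfl
  | succ c ih => rw [levw, ih]; rfl

lemma levw_append (w a b : List L) (c : ℕ) :
    levw w (a ++ b) c = levw w a c ++ levw (w ++ a) b c := by
  induction c generalizing w a b with
  | zero => rfl
  | succ c ih => simp only [levw, passO_append, passC_append, ih]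

lemma le_of_mem_passO {C w : List L} {x : L} (h : x ∈ passO C w) : ∃ y ∈ w, x ≤ y := by
  induction w generalizing C with
  | nil => simp [passO] at h
  | cons y w ih =>
    simp only [passO, List.mem_append, Option.mem_toList] at h
    rcases h with h | h
    · exact ⟨y, by simp, (mem_of_stepO h).2⟩
    · obtain ⟨z, hz, hxz⟩ := ih h
      exact ⟨z, by simp [hz], hxz⟩

lemma le_of_mem_levw {w b : List L} {c : ℕ} {x : L} (h : x ∈ levw w b c) : ∃ y ∈ b, x ≤ y := by
  induction c generalizing x with
  | zero => exact ⟨x, h, le_rfl⟩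
  | succ c ih =>
    rw [levw_succ] at h
    obtain ⟨z, hz, hxz⟩ := le_of_mem_passO h
    obtain ⟨y, hy, hzy⟩ := ih hz
    exact ⟨y, hy, hxz.trans hzy⟩

lemma mem_of_mem_passC_nil {w : List L} {x : L} (h : x ∈ passC [] w) : x ∈ w := by
  have := (pass_perm [] w).mem_iff.1 (List.mem_append_right _ h)
  simpa using this

lemma exists_le_mem_passC {w : List L} {y : L} (h : y ∈ w) : ∃ z ∈ passC [] w, y ≤ z := by
  induction w using List.reverseRecOn with
  | nil => simp at h
  | append_singleton w x ih =>
    rw [passC_concat]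
    simp only [List.mem_append, List.mem_singleton] at h
    rcases h with h | rfl
    · obtain ⟨z, hz, hyz⟩ := ih h
      cases hp : stepO (passC [] w) x with
      | none => exact ⟨z, by rw [stepC_of_none hp]; simp [hz], hyz⟩
      | some p =>
        by_cases hzp : z = p
        · exact ⟨x, self_mem_stepC _ _, hyz.trans (hzp ▸ (mem_of_stepO hp).2)⟩
        · exact ⟨z, (mem_stepC_iff (desc_passC desc_nil w) hp z).2 (Or.inl ⟨hz, hzp⟩), hyz⟩
    · exact ⟨y, self_mem_stepC _ _, le_rfl⟩

lemma pairwise_cons_passO {b : List L} {y : L} (hb : (y :: b).Pairwise (· ≤ ·)) {C : List L}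
    (hC : Desc C) (hy : y ∈ C) : (y :: passO C b).Pairwise (· ≤ ·) := by
  induction b generalizing y C with
  | nil => simp [passO]
  | cons z b ih =>
    have hyz : y ≤ z := (List.pairwise_cons.1 hb).1 z (by simp)
    have h1 := List.pairwise_cons.1 (ih (List.pairwise_cons.1 hb).2 (desc_stepC hC z)
      (self_mem_stepC C z))
    cases hq : stepO C z with
    | none => exact absurd (stepO_eq_none.1 hq y hy) (not_lt.2 hyz)
    | some q =>
      have hyq := le_of_stepO hC hq y hy hyz
      have hqz := (mem_of_stepO hq).2
      simp only [passO, hq, Option.toList_some, List.singleton_append, List.pairwise_cons,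
        List.mem_cons, forall_eq_or_imp]
      exact ⟨⟨hyq, fun a ha => hyz.trans (h1.1 a ha)⟩, fun a ha => hqz.trans (h1.1 a ha), h1.2⟩

lemma pairwise_passO {b : List L} (hb : b.Pairwise (· ≤ ·)) {C : List L} (hC : Desc C) :
    (passO C b).Pairwise (· ≤ ·) := by
  cases b with
  | nil => simp [passO]
  | cons y b =>
    have h1 := List.pairwise_cons.1 (pairwise_cons_passO hb (desc_stepC hC y) (self_mem_stepC C y))
    cases hq : stepO C y with
    | none => simpa [passO, hq] using h1.2
    | some q =>
      simp only [passO, hq, Option.toList_some, List.singleton_append, List.pairwise_cons]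
      exact ⟨fun a ha => (mem_of_stepO hq).2.trans (h1.1 a ha), h1.2⟩

lemma pairwise_levw {b : List L} (hb : b.Pairwise (· ≤ ·)) (w : List L) (c : ℕ) :
    (levw w b c).Pairwise (· ≤ ·) := by
  induction c with
  | zero => exact hb
  | succ c ih => rw [levw_succ]; exact pairwise_passO ih (desc_col w c)

lemma length_passC_nil_le {b : List L} (hb : b.Pairwise (· ≤ ·)) :
    (passC [] b).length ≤ if 0 < b.length then 1 else 0 := by
  have key : ∀ (b : List L) (y : L), (y :: b).Pairwise (· ≤ ·) → (passC [y] b).length = 1 := by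
    intro b
    induction b with
    | nil => intro y _; rfl
    | cons z b ih =>
      intro y h
      have hyz : y ≤ z := (List.pairwise_cons.1 h).1 z (by simp)
      simpa [passC, stepC, hyz] using ih z (List.pairwise_cons.1 h).2
  cases b with
  | nil => simp [passC]
  | cons y b => simpa [passC, stepC] using (key b y hb).le

lemma length_levw (w b : List L) (h : dlist w b = List.range b.length) (c : ℕ) :
    (levw w b c).length = b.length - c := by
  induction c with
  | zero => rfl
  | succ c ih =>
    have h1 := (pass_perm (col w c) (levw w b c)).length_eq
    rw [← levw_succ, ← col_append, List.length_append, List.length_append, ih] at h1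
    have h2 := ht_append w b c
    rw [h, count_range, ht, ht] at h2
    split_ifs at h2 <;> omega

end Invariant

/-! ### Key tableaux from factorizations -/

section Words

variable {L : Type*}

/-- The list of blocks `g (i + k), …, g (i + 1)`. -/
def blk (g : ℕ → List L) (i : ℕ) : ℕ → List (List L)
  | 0 => []
  | k + 1 => g (i + k + 1) :: blk g i k

/-- The word `g (i + k) ⋯ g (i + 1)`. -/
def pw (g : ℕ → List L) (i k : ℕ) : List L := (blk g i k).flatten

lemma blk_add (g : ℕ → List L) (i k l : ℕ) : blk g i (k + l) = blk g (i + k) l ++ blk g i k := by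
  induction l with
  | zero => rfl
  | succ l ih => rw [← Nat.add_assoc, blk, ih]; simp [blk, Nat.add_assoc]

lemma pw_add (g : ℕ → List L) (i k l : ℕ) : pw g i (k + l) = pw g (i + k) l ++ pw g i k := by
  simp [pw, blk_add]

lemma pw_succ (g : ℕ → List L) (i k : ℕ) : pw g i (k + 1) = g (i + k + 1) ++ pw g i k := by
  simp [pw, blk]

lemma pw_succ' (g : ℕ → List L) (i k : ℕ) : pw g i (k + 1) = pw g (i + 1) k ++ g (i + 1) := by
  rw [Nat.add_comm k 1, pw_add]; simp [pw, blk]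

lemma pw_split {n i : ℕ} (g : ℕ → List L) (h : i ≤ n) :
    pw g 0 n = pw g i (n - i) ++ pw g 0 i := by
  obtain ⟨k, rfl⟩ := Nat.exists_eq_add_of_le h
  rw [pw_add]; simp

lemma pw_sub {n i : ℕ} (g : ℕ → List L) (h : i < n) :
    pw g i (n - i) = pw g (i + 1) (n - (i + 1)) ++ g (i + 1) := by
  rw [← pw_succ']; congr 1; omega

lemma mem_blk {g : ℕ → List L} {i k : ℕ} {b : List L} (h : b ∈ blk g i k) :
    ∃ j, i < j ∧ j ≤ i + k ∧ b = g j := by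
  induction k with
  | zero => simp [blk] at h
  | succ k ih =>
    rcases List.mem_cons.1 h with rfl | h
    · exact ⟨_, by omega, by omega, rfl⟩
    · obtain ⟨j, h1, h2, rfl⟩ := ih h
      exact ⟨j, h1, by omega, rfl⟩

lemma mem_pw {g : ℕ → List L} {i k : ℕ} {x : L} :
    x ∈ pw g i k ↔ ∃ j, i < j ∧ j ≤ i + k ∧ x ∈ g j := by
  induction k with
  | zero =>
    simp only [pw, blk, List.flatten_nil, List.not_mem_nil, false_iff]
    rintro ⟨j, h1, h2, -⟩
    omega
  | succ k ih =>
    rw [pw_succ, List.mem_append, ih]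
    constructor
    · rintro (h | ⟨j, h1, h2, h3⟩)
      · exact ⟨_, by omega, by omega, h⟩
      · exact ⟨j, h1, by omega, h3⟩
    · rintro ⟨j, h1, h2, h3⟩
      by_cases hj : j = i + k + 1
      · exact Or.inl (hj ▸ h3)
      · exact Or.inr ⟨j, h1, by omega, h3⟩

/-- The number of indices `i < j ≤ i + k` with `α j > c`. -/
def hgt (α : ℕ → ℕ) (c i : ℕ) : ℕ → ℕ
  | 0 => 0
  | k + 1 => hgt α c i k + if c < α (i + k + 1) then 1 else 0

lemma hgt_add (α : ℕ → ℕ) (c i k l : ℕ) :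
    hgt α c i (k + l) = hgt α c i k + hgt α c (i + k) l := by
  induction l with
  | zero => rfl
  | succ l ih => rw [← Nat.add_assoc, hgt, ih, hgt]; simp only [Nat.add_assoc]

lemma countP_blk {α : ℕ → ℕ} {g : ℕ → List L} (h : ∀ i, (g i).length = α i) (c i k : ℕ) :
    (blk g i k).countP (fun b => decide (c < b.length)) = hgt α c i k := by
  induction k with
  | zero => rfl
  | succ k ih => simp [blk, hgt, List.countP_cons, ih, h]

end Words

/-- Factorizations into weakly increasing blocks of positive letters, of lengths `α`, whose
insertion tableau has the smallest possible shape. -/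
structure KF (α : ℕ → ℕ) (n : ℕ) (g : ℕ → List ℕ) : Prop where
  zero : g 0 = []
  len : ∀ i, (g i).length = α i
  pos : ∀ i, ∀ x ∈ g i, 1 ≤ x
  inc : ∀ i, (g i).IsChain (· ≤ ·)
  shape : ∀ c, ht (pw g 0 n) c = hgt α c 0 n

section Tab

variable {α : ℕ → ℕ} {n : ℕ} {g : ℕ → List ℕ}

lemma KF.dlist_eq (hg : KF α n g) {i : ℕ} (hi : i < n) :
    dlist (pw g (i + 1) (n - (i + 1))) (g (i + 1)) = List.range (g (i + 1)).length := by
  have e : blk g 0 n = blk g (i + 1) (n - (i + 1)) ++ g (i + 1) :: blk g 0 i := by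
    obtain ⟨k, rfl⟩ := Nat.exists_eq_add_of_le (Nat.succ_le_of_lt hi)
    rw [blk_add]
    simp [blk]
  rw [pw]
  refine dlist_block_eq_range (B' := blk g 0 i) ?_ ?_
  · rw [← e]
    intro a ha
    obtain ⟨j, -, -, rfl⟩ := mem_blk ha
    exact hg.inc j
  · intro c
    rw [← e, countP_blk hg.len]
    exact hg.shape c

lemma KF.ht_suffix (hg : KF α n g) {i : ℕ} (hi : i ≤ n) (c : ℕ) :
    ht (pw g i (n - i)) c = hgt α c i (n - i) := by
  obtain ⟨k, rfl⟩ := Nat.exists_eq_add_of_le hi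
  simp only [Nat.add_sub_cancel_left]
  induction k generalizing i with
  | zero => simp [pw, blk, hgt, ht_nil]
  | succ k ih =>
    have e : i + (k + 1) = i + 1 + k := by omega
    have h1 := hg.dlist_eq (i := i) (by omega)
    have h2 := ih (i := i + 1) (e ▸ hg) (by omega)
    rw [show i + (k + 1) - (i + 1) = k by omega] at h1
    rw [pw_succ', ht_append, h2, h1, count_range, hg.len, Nat.add_comm k 1, hgt_add]
    simp only [hgt, Nat.add_zero, Nat.zero_add]
    ring

/-- Column `c` of the tableau obtained from the letters coming from the first `i` blocks. -/
def acol (g : ℕ → List ℕ) (n i c : ℕ) : List ℕ :=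
  passC [] (levw (pw g i (n - i)) (pw g 0 i) c)

lemma acol_colRel (g : ℕ → List ℕ) {i : ℕ} (hi : i ≤ n) (c : ℕ) :
    ColRel (col (pw g 0 n) c) (acol g n i c) (acol g n i (c + 1)) := by
  have h := (colRel_pass (desc_col (pw g i (n - i)) c) (levw (pw g i (n - i)) (pw g 0 i) c)).1
  rwa [← col_append, ← pw_split g hi, ← levw_succ] at h

lemma acol_zero (g : ℕ → List ℕ) (n c : ℕ) : acol g n 0 c = [] := by
  have h : levw (pw g 0 n) [] c = [] := by
    induction c with
    | zero => rfl
    | succ c ih => rw [levw_succ, ih]; rfl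
  simp only [acol, pw, blk, List.flatten_nil, Nat.sub_zero] at h ⊢
  rw [h]; rfl

lemma acol_succ (g : ℕ → List ℕ) {i : ℕ} (hi : i < n) (c : ℕ) :
    (∀ x ∈ acol g n i c, x ∈ acol g n (i + 1) c) ∧
      (acol g n (i + 1) c).length ≤ (acol g n i c).length +
        (passC [] (levw (pw g (i + 1) (n - (i + 1))) (g (i + 1)) c)).length := by
  have e : acol g n (i + 1) c =
      passC (passC [] (levw (pw g (i + 1) (n - (i + 1))) (g (i + 1)) c))
        (levw (pw g i (n - i)) (pw g 0 i) c) := by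
    rw [acol, pw_succ, levw_append, passC_append, Nat.zero_add, pw_sub g hi]
  have h := colRel_pass (desc_passC desc_nil (levw (pw g (i + 1) (n - (i + 1))) (g (i + 1)) c))
    (levw (pw g i (n - i)) (pw g 0 i) c)
  rw [← e] at h
  exact ⟨h.1.sub, h.2⟩

lemma KF.length_acol (hg : KF α n g) {i : ℕ} (hi : i ≤ n) (c : ℕ) :
    (acol g n i c).length = hgt α c 0 i := by
  refine le_antisymm ?_ ?_
  · induction i with
    | zero => simp [acol_zero]
    | succ i ih =>
      have h1 := (acol_succ g (Nat.lt_of_succ_le hi) c).2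
      have h2 := length_passC_nil_le
        (pairwise_levw (List.isChain_iff_pairwise.1 (hg.inc (i + 1)))
          (pw g (i + 1) (n - (i + 1))) c)
      rw [length_levw _ _ (hg.dlist_eq (Nat.lt_of_succ_le hi)), hg.len] at h2
      have h3 := ih (by omega)
      simp only [hgt, Nat.zero_add]
      split_ifs at h2 ⊢ <;> omega
  · have h := (colRel_pass (desc_col (pw g i (n - i)) c)
      (levw (pw g i (n - i)) (pw g 0 i) c)).2
    rw [← col_append, ← pw_split g hi] at h
    have h1 := hg.shape c
    have h2 := hg.ht_suffix hi c
    have h3 := hgt_add α c 0 i (n - i)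
    rw [Nat.add_sub_cancel' hi, Nat.zero_add] at h3
    rw [ht] at h1 h2
    rw [acol]
    omega

/-- The tableau recording, row by row, the growth of the columns `acol g n i c`. -/
def tabOf (g : ℕ → List ℕ) (n : ℕ) : Tableau := fun r c =>
  if 1 ≤ r ∧ r ≤ n ∧ 1 ≤ c then
    (acol g n r.toNat (c - 1)).sum - (acol g n (r.toNat - 1) (c - 1)).sum
  else 0

lemma tabOf_succ (g : ℕ → List ℕ) {i : ℕ} (hi : i < n) (c : ℕ) :
    tabOf g n ((i : ℤ) + 1) (c + 1) = (acol g n (i + 1) c).sum - (acol g n i c).sum := by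
  have e : ((i : ℤ) + 1).toNat = i + 1 := by omega
  rw [tabOf, if_pos ⟨by omega, by omega, by omega⟩, e]
  rfl

lemma mem_letters_of_mem_acol {i c x : ℕ} (h : x ∈ acol g n i c) : ∃ y ∈ pw g 0 i, x ≤ y :=
  le_of_mem_levw (mem_of_mem_passC_nil h)

lemma mem_of_mem_col {L : Type*} [LinearOrder L] {w : List L} {c : ℕ} {x : L}
    (h : x ∈ col w c) : x ∈ w := by
  induction c generalizing w with
  | zero => exact mem_of_mem_passC_nil h
  | succ c ih =>
    have := (pass_perm [] w).mem_iff.1 (List.mem_append_left _ (ih h))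
    simpa using this

lemma KF.acol_pos (hg : KF α n g) {i c x : ℕ} (hi : i ≤ n) (h : x ∈ acol g n i c) : 1 ≤ x := by
  have h1 := mem_of_mem_col ((acol_colRel g hi c).sub x h)
  obtain ⟨j, -, -, hj⟩ := mem_pw.1 h1
  exact hg.pos j x hj

lemma KF.acol_same (hg : KF α n g) {i c : ℕ} (hi : i < n) (hc : ¬ c < α (i + 1)) :
    acol g n (i + 1) c = acol g n i c ∧ tabOf g n ((i : ℤ) + 1) (c + 1) = 0 := by
  have h1 := hg.length_acol hi.le c
  have h2 : (acol g n (i + 1) c).length = hgt α c 0 (i + 1) :=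
    hg.length_acol (Nat.succ_le_of_lt hi) c
  simp only [hgt, Nat.zero_add, if_neg hc, Nat.add_zero] at h2
  have d1 := (acol_colRel g hi.le c).descA
  have d2 := (acol_colRel g (Nat.succ_le_of_lt hi) c).descA
  have h3 : (acol g n i c).Perm (acol g n (i + 1) c) :=
    (d1.nodup.subperm (acol_succ g hi c).1).perm_of_length_le (by omega)
  have h4 := h3.eq_of_pairwise (fun a b _ _ h h' => absurd h (lt_asymm h')) d1 d2
  exact ⟨h4.symm, by rw [tabOf_succ g hi, h4, Nat.sub_self]⟩

lemma KF.acol_new (hg : KF α n g) {i c : ℕ} (hi : i < n) (hc : c < α (i + 1)) :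
    (acol g n (i + 1) c).Perm (tabOf g n ((i : ℤ) + 1) (c + 1) :: acol g n i c) ∧
      tabOf g n ((i : ℤ) + 1) (c + 1) ∉ acol g n i c ∧
      1 ≤ tabOf g n ((i : ℤ) + 1) (c + 1) := by
  have h1 := hg.length_acol hi.le c
  have h2 : (acol g n (i + 1) c).length = hgt α c 0 (i + 1) :=
    hg.length_acol (Nat.succ_le_of_lt hi) c
  simp only [hgt, Nat.zero_add, if_pos hc] at h2
  have d1 := (acol_colRel g hi.le c).descA
  have d2 := (acol_colRel g (Nat.succ_le_of_lt hi) c).descA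
  obtain ⟨l, hl⟩ : ∃ l, (acol g n (i + 1) c).Perm (acol g n i c ++ l) := by
    obtain ⟨l', hp, hs⟩ := d1.nodup.subperm (acol_succ g hi c).1
    obtain ⟨l, hl⟩ := hs.exists_perm_append
    exact ⟨l, hl.trans (hp.append_right l)⟩
  have h3 := hl.length_eq
  rw [List.length_append] at h3
  obtain ⟨t, rfl⟩ : ∃ t, l = [t] := List.length_eq_one_iff.1 (by omega)
  have h4 := hl.trans List.perm_append_comm
  rw [List.singleton_append] at h4
  have h5 : tabOf g n ((i : ℤ) + 1) (c + 1) = t := by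
    rw [tabOf_succ g hi, h4.sum_eq, List.sum_cons, Nat.add_sub_cancel]
  rw [h5]
  refine ⟨h4, ?_, ?_⟩
  · exact (List.nodup_cons.1 (h4.nodup_iff.1 d2.nodup)).1
  · exact hg.acol_pos (Nat.succ_le_of_lt hi) (h4.mem_iff.2 (by simp))

lemma KF.tabOf_ne_zero_iff (hg : KF α n g) {r : ℤ} {c : ℕ} :
    tabOf g n r c ≠ 0 ↔ ∃ i c', i < n ∧ r = (i : ℤ) + 1 ∧ c = c' + 1 ∧ c' < α (i + 1) := by
  constructor
  · intro h
    by_cases h' : 1 ≤ r ∧ r ≤ n ∧ 1 ≤ c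
    · obtain ⟨h1, h2, h3⟩ := h'
      obtain ⟨c', rfl⟩ := Nat.exists_eq_add_of_le' h3
      obtain ⟨i, rfl⟩ : ∃ i : ℕ, r = (i : ℤ) + 1 := ⟨(r - 1).toNat, by omega⟩
      refine ⟨i, c', by omega, rfl, rfl, ?_⟩
      by_contra hc
      exact h (hg.acol_same (by omega) hc).2
    · exact absurd (if_neg h') h
  · rintro ⟨i, c', h1, rfl, rfl, h2⟩
    have := (hg.acol_new h1 h2).2.2
    omega

lemma KF.mem_acol_iff (hg : KF α n g) {i c x : ℕ} (hi : i ≤ n) :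
    x ∈ acol g n i c ↔ ∃ j < i, c < α (j + 1) ∧ tabOf g n ((j : ℤ) + 1) (c + 1) = x := by
  induction i with
  | zero => simp [acol_zero]
  | succ i ih =>
    have ih := ih (by omega)
    by_cases hc : c < α (i + 1)
    · rw [(hg.acol_new (Nat.lt_of_succ_le hi) hc).1.mem_iff, List.mem_cons, ih]
      constructor
      · rintro (rfl | ⟨j, h1, h2, h3⟩)
        · exact ⟨i, by omega, hc, rfl⟩
        · exact ⟨j, by omega, h2, h3⟩
      · rintro ⟨j, h1, h2, h3⟩
        by_cases hj : j = i
        · subst hj; exact Or.inl h3.symm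
        · exact Or.inr ⟨j, by omega, h2, h3⟩
    · rw [(hg.acol_same (Nat.lt_of_succ_le hi) hc).1, ih]
      constructor
      · rintro ⟨j, h1, h2, h3⟩
        exact ⟨j, by omega, h2, h3⟩
      · rintro ⟨j, h1, h2, h3⟩
        by_cases hj : j = i
        · subst hj; exact absurd h2 hc
        · exact ⟨j, by omega, h2, h3⟩

lemma acol_top (g : ℕ → List ℕ) (n c : ℕ) : acol g n n c = col (pw g 0 n) c := by
  have h := col_append [] (pw g 0 n) c
  have e : col ([] : List ℕ) c = [] := col_eq_nil _ _ (by simp)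
  rw [List.nil_append, e] at h
  rw [acol, Nat.sub_self]
  exact h.symm

lemma acol_mono (g : ℕ → List ℕ) {i j : ℕ} (hij : i ≤ j) (hj : j ≤ n) {c x : ℕ}
    (h : x ∈ acol g n i c) : x ∈ acol g n j c := by
  induction j, hij using Nat.le_induction with
  | base => exact h
  | succ j hij ih => exact (acol_succ g (by omega) c).1 x (ih (by omega))

lemma KF.isKeyTableau (hg : KF α n g) : IsKeyTableau (tabOf g n) := by
  refine ⟨fun r c h => if_neg (by omega), fun r => if_neg (by omega), ?_, ?_, ?_, ?_, ?_⟩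
  · refine Set.Finite.subset (((Set.finite_Iio n).prod
      (Set.finite_Iio ((Finset.range n).sup fun i => α (i + 1)))).image
      fun p : ℕ × ℕ => ((p.1 : ℤ) + 1, p.2 + 1)) ?_
    rintro ⟨r, c⟩ h
    obtain ⟨i, c', h1, rfl, rfl, h2⟩ := hg.tabOf_ne_zero_iff.1 h
    refine ⟨(i, c'), ⟨h1, ?_⟩, rfl⟩
    exact h2.trans_le (Finset.le_sup (f := fun i => α (i + 1)) (Finset.mem_range.2 h1))
  · intro r c hc h
    obtain ⟨i, c', h1, rfl, h3, h2⟩ := hg.tabOf_ne_zero_iff.1 h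
    obtain rfl : c = c' := by omega
    exact hg.tabOf_ne_zero_iff.2 ⟨i, c - 1, h1, rfl, by omega, by omega⟩
  · intro r c hc h
    obtain ⟨i, c', h1, rfl, h3, h2⟩ := hg.tabOf_ne_zero_iff.1 h
    obtain ⟨c, rfl⟩ := Nat.exists_eq_add_of_le' hc
    obtain rfl : c' = c + 1 := by omega
    have n1 := hg.acol_new h1 h2
    have n2 := hg.acol_new (c := c) h1 (by omega)
    by_contra hlt
    have r1 := acol_colRel g h1.le c
    have r2 := acol_colRel g (Nat.succ_le_of_lt h1) c
    have e1 := r1.cnt_eq _ (r2.sub _ (n2.1.mem_iff.2 (by simp))) n2.2.1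
    have e2 := r2.dom.1 (tabOf g n ((i : ℤ) + 1) (c + 1))
    rw [cnt_perm _ n1.1, cnt_perm _ n2.1, cnt_cons, cnt_cons, if_neg (lt_irrefl _),
      if_pos (not_le.1 hlt)] at e2
    omega
  · intro r r' c hne h h' heq
    obtain ⟨i, c', h1, rfl, rfl, h2⟩ := hg.tabOf_ne_zero_iff.1 h
    obtain ⟨j, c'', k1, rfl, h3, k2⟩ := hg.tabOf_ne_zero_iff.1 h'
    obtain rfl : c' = c'' := by omega
    rcases lt_trichotomy i j with hij | rfl | hij
    · exact (hg.acol_new k1 k2).2.1 ((hg.mem_acol_iff k1.le).2 ⟨i, hij, h2, heq⟩)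
    · exact hne rfl
    · exact (hg.acol_new h1 h2).2.1 ((hg.mem_acol_iff h1.le).2 ⟨j, hij, k2, heq.symm⟩)
  · intro r r' c hlt h h' hgt
    obtain ⟨i, c', h1, rfl, rfl, h2⟩ := hg.tabOf_ne_zero_iff.1 h
    obtain ⟨j, c'', k1, rfl, h3, k2⟩ := hg.tabOf_ne_zero_iff.1 h'
    obtain rfl : c' = c'' := by omega
    have hij : i + 1 ≤ j := by omega
    set x := tabOf g n ((j : ℤ) + 1) (c' + 1) with hx
    have nx := (hg.acol_new k1 k2).2.1
    have hxC := (acol_colRel g (Nat.succ_le_of_lt k1) c').sub x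
      ((hg.acol_new k1 k2).1.mem_iff.2 (by simp [hx]))
    have r1 := acol_colRel g h1.le c'
    have r2 := acol_colRel g (Nat.succ_le_of_lt h1) c'
    have e1 := r1.cnt_eq x hxC fun h => nx (acol_mono g (by omega) k1.le h)
    have e2 := r2.cnt_eq x hxC fun h => nx (acol_mono g hij k1.le h)
    rw [cnt_perm _ (hg.acol_new h1 h2).1, cnt_cons, if_pos hgt] at e2
    by_cases hc : c' + 1 < α (i + 1)
    · have n1 := hg.acol_new h1 hc
      rw [cnt_perm _ n1.1, cnt_cons] at e2
      refine ⟨by omega, ?_⟩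
      by_contra hn
      rw [if_neg hn] at e2
      omega
    · rw [(hg.acol_same h1 hc).1] at e2
      omega

lemma KF.shapeOf_tabOf (hg : KF α n g) (hn : ∀ i, n < i → α i = 0) :
    shapeOf (tabOf g n) = α := by
  funext i
  have h0 : α 0 = 0 := by rw [← hg.len, hg.zero]; rfl
  have : {c : ℕ | tabOf g n (i : ℤ) c ≠ 0} = Finset.Icc 1 (α i) := by
    ext c
    simp only [Set.mem_ofPred_eq, hg.tabOf_ne_zero_iff, Finset.coe_Icc, Set.mem_Icc]
    constructor
    · rintro ⟨j, c', h1, h2, rfl, h3⟩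
      obtain rfl : i = j + 1 := by omega
      omega
    · rintro ⟨h1, h2⟩
      have hi : i ≠ 0 := by rintro rfl; omega
      have hin : i ≤ n := by
        by_contra h
        rw [hn i (by omega)] at h2
        omega
      refine ⟨i - 1, c - 1, by omega, by omega, by omega, ?_⟩
      rw [Nat.sub_add_cancel (by omega)]
      omega
  rw [shapeOf, this, Set.ncard_coe_finset, Nat.card_Icc, Nat.add_sub_cancel]

lemma KF.flaggedTab_iff (hg : KF α n g) (hn : ∀ i, n < i → α i = 0) {φ : ℕ → ℕ}
    (hφ : IsFlag φ) : FlaggedTab φ (tabOf g n) ↔ ∀ i, ∀ x ∈ g i, x ≤ φ i := by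
  constructor
  · intro h i y hy
    have hi : i ≠ 0 := by
      rintro rfl
      rw [hg.zero] at hy
      simp at hy
    have hin : i ≤ n := by
      by_contra h'
      have := hg.len i
      rw [hn i (by omega), List.length_eq_zero_iff] at this
      rw [this] at hy
      simp at hy
    have hy' : y ∈ pw g 0 i := mem_pw.2 ⟨i, by omega, by omega, hy⟩
    obtain ⟨z, hz, hyz⟩ := exists_le_mem_passC hy'
    have hz' : z ∈ acol g n i 0 := hz
    obtain ⟨j, hj, -, rfl⟩ := (hg.mem_acol_iff hin).1 hz'
    have h1 := h (j + 1) (0 + 1)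
    rw [Nat.cast_succ] at h1
    exact hyz.trans (h1.trans (hφ.1 _ _ (by omega) (by omega)))
  · intro h r c
    by_cases h0 : tabOf g n (r : ℤ) c = 0
    · omega
    · obtain ⟨i, c', h1, h2, rfl, h3⟩ := hg.tabOf_ne_zero_iff.1 h0
      have h4 := (hg.acol_new h1 h3).1.mem_iff.2 (List.mem_cons_self (l := acol g n i c'))
      obtain ⟨y, hy, hxy⟩ := mem_letters_of_mem_acol h4
      obtain ⟨j, j1, j2, hj⟩ := mem_pw.1 hy
      rw [h2]
      exact hxy.trans ((h j y hj).trans (hφ.1 _ _ (by omega) (by omega)))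

lemma KF.exists_tabOf_iff (hg : KF α n g) {c x : ℕ} :
    (∃ r : ℤ, tabOf g n r (c + 1) = x ∧ x ≠ 0) ↔ x ∈ col (pw g 0 n) c := by
  rw [← acol_top, hg.mem_acol_iff le_rfl]
  constructor
  · rintro ⟨r, rfl, h0⟩
    obtain ⟨i, c', h1, rfl, h3, h4⟩ := hg.tabOf_ne_zero_iff.1 h0
    obtain rfl : c = c' := by omega
    exact ⟨i, h1, h4, rfl⟩
  · rintro ⟨j, h1, h2, rfl⟩
    exact ⟨_, rfl, by have := (hg.acol_new h1 h2).2.2; omega⟩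

end Tab

/-! ### Weights, and tableaux and factorizations determined by columns -/

section Determined

lemma count_colWord {L : Type*} [LinearOrder L] [BEq L] [LawfulBEq L] (w : List L) (N : ℕ) (v : L) :
    (colWord w N).count v = ((Finset.range N).filter fun c => v ∈ col w c).card := by
  induction N generalizing w with
  | zero => simp [colWord]
  | succ N ih =>
    rw [colWord, List.count_append, ih, Finset.card_filter, Finset.card_filter,
      Finset.sum_range_succ', (desc_passC desc_nil w).nodup.count]
    rfl

lemma count_eq_ncard {L : Type*} [LinearOrder L] [BEq L] [LawfulBEq L] (w : List L) (v : L) :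
    w.count v = Set.ncard {c : ℕ | v ∈ col w c} := by
  have e : {c : ℕ | v ∈ col w c} =
      ((Finset.range w.length).filter fun c => v ∈ col w c : Finset ℕ) := by
    ext c
    simp only [Set.mem_ofPred_eq, Finset.coe_filter, Finset.mem_range]
    refine ⟨fun h => ⟨?_, h⟩, fun h => h.2⟩
    by_contra hc
    rw [col_eq_nil _ _ (not_lt.1 hc)] at h
    simp at h
  rw [e, Set.ncard_coe_finset, ← count_colWord]
  exact (col_perm w _ le_rfl).count_eq v

variable {α : ℕ → ℕ} {n : ℕ} {g g' : ℕ → List ℕ}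

lemma KF.wtTab_tabOf (hg : KF α n g) : wtTab (tabOf g n) = wtWord (pw g 0 n) := by
  funext v
  rw [wtTab, wtWord]
  split_ifs with hv
  · rfl
  rw [count_eq_ncard]
  have hk := hg.isKeyTableau
  refine Set.ncard_congr (fun p _ => p.2 - 1) ?_ ?_ ?_
  · rintro ⟨r, c⟩ h
    have h' : tabOf g n r c = v := h
    obtain ⟨i, c', -, -, rfl, -⟩ := hg.tabOf_ne_zero_iff.1 (h'.trans_ne hv)
    exact hg.exists_tabOf_iff.1 ⟨r, h', hv⟩
  · rintro ⟨r, c⟩ ⟨r', d⟩ h h' heq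
    have h1 : tabOf g n r c = v := h
    have h2 : tabOf g n r' d = v := h'
    obtain ⟨i, c', -, -, rfl, -⟩ := hg.tabOf_ne_zero_iff.1 (h1.trans_ne hv)
    obtain ⟨i', d', -, -, rfl, -⟩ := hg.tabOf_ne_zero_iff.1 (h2.trans_ne hv)
    obtain rfl : c' = d' := by simpa using heq
    by_cases hr : r = r'
    · rw [hr]
    · exact absurd (h1.trans h2.symm)
        (hk.2.2.2.2.2.1 r r' _ hr (h1.trans_ne hv) (h2.trans_ne hv))
  · intro c hc
    obtain ⟨r, h, -⟩ := hg.exists_tabOf_iff.2 hc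
    exact ⟨(r, c + 1), h, rfl⟩

lemma KF.maxFact (hg : KF α n g) (hn : ∀ i, n < i → α i = 0) : MaxFact g := by
  intro i j hi hij h1 h2 h3
  by_contra hlt
  have hjn : j ≤ n := by
    by_contra h
    exact h2 (List.length_eq_zero_iff.1 ((hg.len j).trans (hn j (by omega))))
  obtain ⟨x, b, hb⟩ := List.exists_cons_of_ne_nil h1
  obtain ⟨a, z, ha⟩ := (List.eq_nil_or_concat (g j)).resolve_left h2
  rw [List.concat_eq_append] at ha
  rw [hb, ha] at hlt
  simp only [List.headI_cons, List.getLastD_concat, not_lt] at hlt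
  have e1 : pw g i (n - i) = pw g j (n - j) ++ g j := by
    obtain ⟨k, rfl⟩ := Nat.exists_eq_add_of_lt hij
    have e2 : pw g i k = [] := by
      rw [List.eq_nil_iff_forall_not_mem]
      intro y hy
      obtain ⟨m, m1, m2, hm⟩ := mem_pw.1 hy
      rw [h3 m m1 (by omega)] at hm
      simp at hm
    rw [show n - i = k + (1 + (n - (i + k + 1))) by omega, pw_add, e2, List.append_nil,
      Nat.add_comm 1, pw_succ']
  have e3 := hg.dlist_eq (i := i - 1) (by omega)
  rw [Nat.sub_add_cancel hi, e1, ha, hb, dlist, List.length_cons, List.range_succ_eq_map,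
    ← List.append_assoc] at e3
  have e4 := dcol_lt_dcol (w := pw g j (n - j) ++ a) hlt
  rw [(List.cons.inj e3).1] at e4
  omega

lemma eq_of_dlist_eq {L : Type*} [LinearOrder L] {w w' : List L} (h : dlist [] w = dlist [] w')
    (hc : ∀ c, col w c = col w' c) : w = w' := by
  have hl : w.length = w'.length := by
    rw [← length_dlist [] w, h, length_dlist]
  induction w using List.reverseRecOn generalizing w' with
  | nil => exact (List.length_eq_zero_iff.1 hl.symm).symm
  | append_singleton w y ih =>
    obtain ⟨w', y', rfl⟩ : ∃ v z, w' = v ++ [z] := by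
      rcases List.eq_nil_or_concat w' with rfl | ⟨v, z, rfl⟩
      · simp at hl
      · exact ⟨v, z, by simp⟩
    rw [dlist_append, dlist_append] at h
    obtain ⟨h1, h2⟩ := List.append_inj' h rfl
    simp only [dlist, List.nil_append, List.cons.injEq, and_true] at h2
    have f1 := insF_col w y
    have f2 := insF_col w' y'
    rw [funext hc, h2] at f1
    obtain ⟨k1, rfl⟩ := f1.unique (desc_col w) (desc_col w') f2
    rw [ih h1 k1 (by simpa using hl)]

lemma KF.dlist_suffix (hg : KF α n g) (hg' : KF α n g') {i : ℕ} (hi : i ≤ n) :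
    dlist [] (pw g i (n - i)) = dlist [] (pw g' i (n - i)) := by
  obtain ⟨k, rfl⟩ := Nat.exists_eq_add_of_le hi
  induction k generalizing i with
  | zero => simp [pw, blk]
  | succ k ih =>
    have e : i + (k + 1) = i + 1 + k := by omega
    have h := ih (i := i + 1) (e ▸ hg) (e ▸ hg') (by omega)
    rw [← e] at h
    rw [pw_sub g (by omega), pw_sub g' (by omega), dlist_append, dlist_append, h,
      List.nil_append, List.nil_append, hg.dlist_eq (by omega), hg'.dlist_eq (by omega),
      hg.len, hg'.len]

lemma KF.eq_of_col_eq (hg : KF α n g) (hg' : KF α n g') (hn : ∀ i, n < i → α i = 0)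
    (hc : ∀ c, col (pw g 0 n) c = col (pw g' 0 n) c) : g = g' := by
  have hw : ∀ i ≤ n, pw g i (n - i) = pw g' i (n - i) := by
    intro i hi
    induction i with
    | zero => exact eq_of_dlist_eq (hg.dlist_suffix hg' (Nat.zero_le n)) hc
    | succ i ih =>
      have h := ih (by omega)
      rw [pw_sub g (by omega), pw_sub g' (by omega)] at h
      exact (List.append_inj' h (by rw [hg.len, hg'.len])).1
  funext i
  by_cases hi : i = 0
  · rw [hi, hg.zero, hg'.zero]
  by_cases hin : n < i
  · have h1 := (hg.len i).trans (hn i hin)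
    have h2 := (hg'.len i).trans (hn i hin)
    rw [List.length_eq_zero_iff.1 h1, List.length_eq_zero_iff.1 h2]
  · obtain ⟨i, rfl⟩ := Nat.exists_eq_succ_of_ne_zero hi
    have h := hw i (by omega)
    rw [pw_sub g (by omega), pw_sub g' (by omega)] at h
    exact (List.append_inj' h (by rw [hg.len, hg'.len])).2

lemma ncard_down_closed {S : Set ℕ} (hS : S.Finite) (h0 : 0 ∉ S)
    (h : ∀ c, 1 ≤ c → c + 1 ∈ S → c ∈ S) (c : ℕ) : c ∈ S ↔ 1 ≤ c ∧ c ≤ S.ncard := by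
  have down : ∀ d c, 1 ≤ c → c ≤ d → d ∈ S → c ∈ S := by
    intro d
    induction d with
    | zero => intro c h1 h2; omega
    | succ d ih =>
      intro c h1 h2 h3
      by_cases hc : c = d + 1
      · exact hc ▸ h3
      · exact ih c h1 (by omega) (h d (by omega) h3)
  constructor
  · intro hc
    have h1 : 1 ≤ c := Nat.one_le_iff_ne_zero.2 fun h' => h0 (h' ▸ hc)
    refine ⟨h1, ?_⟩
    have : (Finset.Icc 1 c : Set ℕ) ⊆ S := fun d hd => by
      rw [Finset.coe_Icc, Set.mem_Icc] at hd
      exact down c d hd.1 hd.2 hc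
    simpa [Set.ncard_coe_finset] using Set.ncard_le_ncard this hS
  · rintro ⟨h1, h2⟩
    by_contra hc
    have : S ⊆ (Finset.Icc 1 (c - 1) : Finset ℕ) := fun d hd => by
      rw [Finset.coe_Icc, Set.mem_Icc]
      refine ⟨Nat.one_le_iff_ne_zero.2 fun h' => h0 (h' ▸ hd), ?_⟩
      by_contra hdc
      exact hc (down d c h1 (by omega) hd)
    have h3 := Set.ncard_le_ncard this (Finset.finite_toSet _)
    rw [Set.ncard_coe_finset, Nat.card_Icc] at h3
    omega

lemma ne_zero_iff_shapeOf {T : Tableau} (hT : IsKeyTableau T) (i c : ℕ) :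
    T (i : ℤ) c ≠ 0 ↔ 1 ≤ c ∧ c ≤ shapeOf T i := by
  refine ncard_down_closed (S := {c | T (i : ℤ) c ≠ 0}) ?_ ?_ ?_ c
  · refine (hT.2.2.1.image Prod.snd).subset fun c hc => ⟨((i : ℤ), c), hc, rfl⟩
  · exact fun h => h (hT.2.1 _)
  · exact fun c h1 h2 => hT.2.2.2.1 _ c h1 h2

lemma not_lt_of_columns {T T' : Tableau} (hT : IsKeyTableau T) (hT' : IsKeyTableau T')
    {r : ℤ} {c : ℕ} (hc : 1 ≤ c) (hsupp : T r c ≠ 0)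
    (hval : ∀ r, T r c ≠ 0 → ∃ k, T' k c = T r c)
    (hnext : T r (c + 1) = T' r (c + 1)) (hprev : ∀ k < r, T k c = T' k c) :
    ¬ T r c < T' r c := by
  intro hlt
  obtain ⟨k, hk⟩ := hval r hsupp
  have hk0 : T' k c ≠ 0 := hk ▸ hsupp
  rcases lt_trichotomy k r with h | rfl | h
  · have h1 := hprev k h
    exact hT.2.2.2.2.2.1 k r c h.ne (h1 ▸ hk0) hsupp (h1.trans hk)
  · omega
  · have h1 := hT'.2.2.2.2.2.2 r k c h (by omega) hk0 (hk ▸ hlt)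
    rw [← hnext, hk] at h1
    exact absurd (hT.2.2.2.2.1 r c hc h1.1) (not_le.2 h1.2)

/-- A key tableau is determined by its shape and the sets of entries of its columns. -/
lemma eq_of_columns {T T' : Tableau} (hT : IsKeyTableau T) (hT' : IsKeyTableau T')
    (hs : shapeOf T = shapeOf T')
    (hval : ∀ c v, v ≠ 0 → ((∃ r, T r (c + 1) = v) ↔ ∃ r, T' r (c + 1) = v)) : T = T' := by
  have hsupp : ∀ r c, T r c ≠ 0 ↔ T' r c ≠ 0 := by
    intro r c
    by_cases hr : r ≤ 0
    · rw [hT.1 r c hr, hT'.1 r c hr]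
    · obtain ⟨i, rfl⟩ : ∃ i : ℕ, r = i := ⟨r.toNat, by omega⟩
      rw [ne_zero_iff_shapeOf hT, ne_zero_iff_shapeOf hT', hs]
  obtain ⟨M, hM⟩ := (hT.2.2.1.image Prod.snd).bddAbove
  have key : ∀ d c, M < c + d → 1 ≤ c → ∀ r, T r c = T' r c := by
    intro d
    induction d with
    | zero =>
      intro c h1 _ r
      have h2 : ¬ T r c ≠ 0 := fun h => by
        have := hM ⟨(r, c), h, rfl⟩
        simp only at this
        omega
      have h3 := (hsupp r c).not.1 h2
      omega
    | succ d ih =>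
      intro c h1 hc r
      have hnext := ih (c + 1) (by omega) (by omega)
      obtain ⟨c, rfl⟩ := Nat.exists_eq_add_of_le' hc
      by_cases hr : r ≤ 0
      · rw [hT.1 r _ hr, hT'.1 r _ hr]
      obtain ⟨i, rfl⟩ : ∃ i : ℕ, r = i := ⟨r.toNat, by omega⟩
      clear hr
      induction i using Nat.strong_induction_on with
      | _ i ihi =>
        have hprev : ∀ k : ℤ, k < i → T k (c + 1) = T' k (c + 1) := by
          intro k hk
          by_cases hk0 : k ≤ 0
          · rw [hT.1 k _ hk0, hT'.1 k _ hk0]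
          · obtain ⟨j, rfl⟩ : ∃ j : ℕ, k = j := ⟨k.toNat, by omega⟩
            exact ihi j (by omega)
        by_cases h0 : T i (c + 1) = 0
        · have := (hsupp i (c + 1)).not.1 (not_not.2 h0)
          omega
        · refine le_antisymm (not_lt.1 ?_) (not_lt.1 ?_)
          · exact not_lt_of_columns hT' hT hc ((hsupp _ _).1 h0)
              (fun r h => (hval c _ h).2 ⟨r, rfl⟩) (hnext _).symm fun k hk => (hprev k hk).symm
          · exact not_lt_of_columns hT hT' hc h0
              (fun r h => (hval c _ h).1 ⟨r, rfl⟩) (hnext _) hprev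
  funext r c
  by_cases hc : c = 0
  · rw [hc, hT.2.1, hT'.2.1]
  · exact key (M + 1) c (by omega) (by omega) r

lemma KF.injective (hg : KF α n g) (hg' : KF α n g') (hn : ∀ i, n < i → α i = 0)
    (h : tabOf g n = tabOf g' n) : g = g' := by
  refine hg.eq_of_col_eq hg' hn fun c => ?_
  have hp : (col (pw g 0 n) c).Perm (col (pw g' 0 n) c) := by
    rw [List.perm_ext_iff_of_nodup (desc_col _ _).nodup (desc_col _ _).nodup]
    intro x
    rw [← hg.exists_tabOf_iff, ← hg'.exists_tabOf_iff, h]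
  exact hp.eq_of_pairwise (fun a b _ _ h h' => absurd h (lt_asymm h')) (desc_col _ _)
    (desc_col _ _)

end Determined

/-! ### Reverse insertion -/

section Reverse

lemma exists_unstep {L : Type*} [LinearOrder L] {C : List L} (hC : Desc C) {p : L}
    (h : ∃ a ∈ C, p ≤ a) :
    ∃ C' y, Desc C' ∧ stepO C' y = some p ∧ stepC C' y = C ∧ p ≤ y ∧
      ∀ a ∈ C, p ≤ a → y ≤ a := by
  induction C with
  | nil => simp at h
  | cons a l ih =>
    rw [Desc, List.pairwise_cons] at hC
    by_cases hl : ∃ b ∈ l, p ≤ b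
    · obtain ⟨C', y, h1, h2, h3, h4, h5⟩ := ih hC.2 hl
      have hy : y < a := hC.1 y (h3 ▸ self_mem_stepC C' y)
      have hs := step_perm C' y
      rw [h2, h3] at hs
      refine ⟨a :: C', y, List.pairwise_cons.2 ⟨fun b hb => ?_, h1⟩, ?_, ?_, h4, ?_⟩
      · have : b ∈ p :: l := by simpa using hs.mem_iff.2 (List.mem_cons_of_mem y hb)
        rcases List.mem_cons.1 this with rfl | hb
        · exact h4.trans_lt hy
        · exact hC.1 b hb
      · rw [stepO, if_neg (not_le.2 hy), h2]
      · rw [stepC, if_neg (not_le.2 hy), h3]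
      · intro b hb hpb
        rcases List.mem_cons.1 hb with rfl | hb
        · exact hy.le
        · exact h5 b hb hpb
    · push Not at hl
      have hpa : p ≤ a := by
        obtain ⟨b, hb, hpb⟩ := h
        rcases List.mem_cons.1 hb with rfl | hb
        · exact hpb
        · exact absurd hpb (not_le.2 (hl b hb))
      refine ⟨p :: l, a, List.pairwise_cons.2 ⟨hl, hC.2⟩, by simp [stepO, hpa],
        by simp [stepC, hpa], hpa, fun b hb hpb => ?_⟩
      rcases List.mem_cons.1 hb with rfl | hb
      · exact le_rfl
      · exact absurd hpb (not_le.2 (hl b hb))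

lemma Dom.cnt_add_one_le {C D : List ℕ} (h : Dom C D) {p t : ℕ} (hp : p ∈ D) (hpt : p ≤ t)
    (hC : ∀ a ∈ C, p ≤ a → t < a) : cnt t D + 1 ≤ cnt t C := by
  cases p with
  | zero =>
    rw [cnt_eq_length fun a ha => hC a ha (Nat.zero_le a)]
    exact (cnt_lt_length hp hpt).trans h.2
  | succ q =>
    have e1 : cnt q C = cnt t C := cnt_eq_of (by omega) fun a ha h' => hC a ha h'
    have e2 := cnt_lt_of hp (Nat.lt_succ_self q) hpt
    have e3 := h.1 q
    omega

lemma Dom.exists_le {C D : List ℕ} (h : Dom C D) {p : ℕ} (hp : p ∈ D) : ∃ a ∈ C, p ≤ a := by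
  by_contra hn
  push Not at hn
  have h1 := h.cnt_add_one_le hp le_rfl fun a ha hpa => absurd hpa (not_le.2 (hn a ha))
  have h2 : cnt p C = 0 :=
    List.countP_eq_zero.2 fun a ha => by simpa using (hn a ha).le
  omega

lemma InsF.exists_of_lt {d : ℕ} {S : ℕ → List ℕ} (hS : ∀ c, Desc (S c))
    (hD : ∀ c, Dom (S c) (S (c + 1))) (hd : (S (d + 1)).length < (S d).length) :
    ∃ S' y, InsF d S' y S ∧ (∀ c, Desc (S' c)) ∧ ∀ c, Dom (S' c) (S' (c + 1)) := by
  induction d generalizing S with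
  | zero =>
    obtain ⟨C, y, hC⟩ : ∃ C y, S 0 = C ++ [y] := by
      rcases List.eq_nil_or_concat (S 0) with h | ⟨C, y, h⟩
      · simp [h] at hd
      · exact ⟨C, y, by simpa using h⟩
    have h0 := hS 0
    rw [hC, Desc, List.pairwise_append] at h0
    have hy : ∀ a ∈ C, y < a := fun a ha => h0.2.2 a ha y (by simp)
    have hn := stepO_eq_none.2 hy
    refine ⟨fun c => Nat.casesOn c C fun c => S (c + 1), y,
      ⟨hn, hC.trans (stepC_of_none hn).symm, fun c => rfl⟩, ?_, ?_⟩
    · rintro (_ | c)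
      · exact h0.1
      · exact hS _
    · rintro (_ | c)
      · rw [hC, List.length_append, List.length_singleton] at hd
        refine ⟨fun t => ?_, Nat.lt_succ_iff.1 hd⟩
        have h1 := (hD 0).1 t
        simp only [hC, cnt_append, cnt_cons] at h1
        by_cases ht : t < y
        · exact (cnt_le_length t (S 1)).trans ((Nat.lt_succ_iff.1 hd).trans
            (cnt_eq_length fun a ha => ht.trans (hy a ha)).ge)
        · rw [if_neg ht] at h1
          simpa [cnt] using h1
      · exact hD _
  | succ d ih =>
    obtain ⟨S'', p, h1, h2, h3⟩ := ih (fun c => hS (c + 1)) (fun c => hD (c + 1)) hd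
    have hp : S 1 = stepC (S'' 0) p := by
      cases d with
      | zero => exact h1.2.1
      | succ d => obtain ⟨q, -, h, -⟩ := h1; exact h
    have hD0 : Dom (S 0) (S 1) := hD 0
    have hpm : p ∈ S 1 := hp ▸ self_mem_stepC _ _
    obtain ⟨C', y, k1, k2, k3, k4, k5⟩ := exists_unstep (hS 0) (hD0.exists_le hpm)
    refine ⟨fun c => Nat.casesOn c C' S'', y, ⟨p, k2, k3.symm, h1⟩, ?_, ?_⟩
    · rintro (_ | c)
      · exact k1
      · exact h2 c
    · rintro (_ | c)
      · refine ⟨fun t => ?_, ?_⟩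
        · have e1 := cnt_stepC_some k2 t
          rw [k3] at e1
          have e2 := hD0.1 t
          have e3 : p ≤ t → t < y → cnt t (S 1) + 1 ≤ cnt t (S 0) := fun h h' =>
            hD0.cnt_add_one_le hpm h fun a ha hpa => h'.trans_le (k5 a ha hpa)
          have e4 : cnt t (S'' 0) ≤ cnt t (S 1) := by
            rw [hp]
            cases hq : stepO (S'' 0) p with
            | none => rw [cnt_stepC_none hq]; omega
            | some q =>
              have := cnt_stepC_some hq t
              have := (mem_of_stepO hq).2
              split_ifs at * <;> omega
          change cnt t (S'' 0) ≤ cnt t C'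
          split_ifs at e1 <;> omega
        · have e1 := length_stepC_some k2
          rw [k3] at e1
          have e2 := hD0.2
          have e3 : (S'' 0).length ≤ (S 1).length := by
            rw [hp]
            cases hq : stepO (S'' 0) p with
            | none => rw [length_stepC_none hq]; omega
            | some q => rw [length_stepC_some hq]
          change (S'' 0).length ≤ C'.length
          omega
      · exact h3 c

lemma isChain_of_dlist {L : Type*} [LinearOrder L] {w b : List L}
    (h : (dlist w b).Pairwise (· < ·)) : b.IsChain (· ≤ ·) := by
  induction b generalizing w with
  | nil => exact List.IsChain.nil
  | cons y b ih =>
    rw [dlist, List.pairwise_cons] at h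
    cases b with
    | nil => exact List.IsChain.singleton y
    | cons z b =>
      refine List.IsChain.cons_cons ?_ (ih h.2)
      by_contra hlt
      exact absurd (h.1 _ (by simp [dlist])) (not_lt.2 (dcol_le_dcol (not_le.1 hlt)))

lemma exists_block {H : ℕ → ℕ} (hH : Antitone H) (a : ℕ) {S : ℕ → List ℕ}
    (hS : ∀ c, Desc (S c)) (hD : ∀ c, Dom (S c) (S (c + 1)))
    (hl : ∀ c, (S c).length = H c + if c < a then 1 else 0) :
    ∃ b S', (∀ c, Desc (S' c)) ∧ (∀ c, Dom (S' c) (S' (c + 1))) ∧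
      (∀ c, (S' c).length = H c) ∧
      ∀ w, col w = S' → col (w ++ b) = S ∧ dlist w b = List.range a := by
  induction a generalizing S with
  | zero => exact ⟨[], S, hS, hD, by simpa using hl, fun w h => ⟨by simpa using h, rfl⟩⟩
  | succ a ih =>
    have hd : (S (a + 1)).length < (S a).length := by
      have := hH (Nat.le_succ a)
      rw [hl, hl, if_neg (by omega), if_pos (by omega)]
      exact Nat.lt_succ_of_le this
    obtain ⟨S', y, h1, h2, h3⟩ := InsF.exists_of_lt hS hD hd
    have h4 : ∀ c, (S' c).length = H c + if c < a then 1 else 0 := by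
      intro c
      have e1 := h1.length c
      rw [hl] at e1
      split_ifs at e1 ⊢ <;> omega
    obtain ⟨b, S'', k1, k2, k3, k4⟩ := ih h2 h3 h4
    refine ⟨b ++ [y], S'', k1, k2, k3, fun w hw => ?_⟩
    obtain ⟨j1, j2⟩ := k4 w hw
    have f := insF_col (w ++ b) y
    rw [j1] at f
    obtain ⟨f1, f2⟩ := f.det h1
    refine ⟨?_, ?_⟩
    · rw [← List.append_assoc]
      exact funext f2
    · rw [dlist_append, j2, List.range_succ]
      simp [dlist, f1]

lemma hgt_antitone (α : ℕ → ℕ) (i k : ℕ) : Antitone fun c => hgt α c i k := by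
  intro c d h
  induction k with
  | zero => exact le_rfl
  | succ k ih =>
    simp only [hgt] at ih ⊢
    split_ifs <;> omega

lemma blk_congr {L : Type*} {g g' : ℕ → List L} {i k : ℕ}
    (h : ∀ j, i < j → j ≤ i + k → g j = g' j) : blk g i k = blk g' i k := by
  induction k with
  | zero => rfl
  | succ k ih =>
    rw [blk, blk, h _ (by omega) (by omega), ih fun j h1 h2 => h j h1 (by omega)]

lemma exists_pw (α : ℕ → ℕ) (k i : ℕ) {S : ℕ → List ℕ} (hS : ∀ c, Desc (S c))
    (hD : ∀ c, Dom (S c) (S (c + 1))) (hl : ∀ c, (S c).length = hgt α c i k) :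
    ∃ g : ℕ → List ℕ, col (pw g i k) = S ∧
      ∀ j, i < j → j ≤ i + k → (g j).length = α j ∧ (g j).IsChain (· ≤ ·) := by
  induction k generalizing i S with
  | zero =>
    refine ⟨fun _ => [], ?_, fun j h1 h2 => by omega⟩
    funext c
    rw [List.length_eq_zero_iff.1 (hl c)]
    exact col_eq_nil _ _ (by simp [pw, blk])
  | succ k ih =>
    have hl' : ∀ c, (S c).length = hgt α c (i + 1) k + if c < α (i + 1) then 1 else 0 := by
      intro c
      rw [hl, Nat.add_comm k 1, hgt_add, Nat.add_comm]
      simp [hgt]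
    obtain ⟨b, S', h1, h2, h3, h4⟩ := exists_block (hgt_antitone α (i + 1) k) _ hS hD hl'
    obtain ⟨g, g1, g2⟩ := ih (i + 1) h1 h2 h3
    obtain ⟨j1, j2⟩ := h4 _ g1
    have e : pw (Function.update g (i + 1) b) (i + 1) k = pw g (i + 1) k :=
      congrArg List.flatten (blk_congr fun j h1 h2 => Function.update_of_ne (by omega) _ _)
    refine ⟨Function.update g (i + 1) b, ?_, fun j hj1 hj2 => ?_⟩
    · rw [pw_succ', e, Function.update_self, j1]
    · by_cases hj : j = i + 1
      · rw [hj, Function.update_self]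
        refine ⟨by rw [← length_dlist (pw g (i + 1) k), j2, List.length_range],
          isChain_of_dlist (w := pw g (i + 1) k) ?_⟩
        rw [j2]
        exact List.pairwise_lt_range
      · rw [Function.update_of_ne hj]
        exact g2 j (by omega) (by omega)

lemma hgt_eq_card (α : ℕ → ℕ) (c n : ℕ) :
    hgt α c 0 n = ((Finset.Icc 1 n).filter fun i => c < α i).card := by
  induction n with
  | zero => rfl
  | succ n ih =>
    rw [Finset.card_filter, Finset.sum_Icc_succ_top (by omega), ← Finset.card_filter, ← ih, hgt,
      Nat.zero_add]

/-- Column `c` of a tableau with rows `1, …, n`, in decreasing order. -/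
def colOf (T : Tableau) (n c : ℕ) : List ℕ :=
  ((((Finset.Icc 1 n).filter fun i : ℕ => T i (c + 1) ≠ 0).image fun i : ℕ => T i (c + 1)).sort
    (· ≥ ·))

lemma desc_colOf (T : Tableau) (n c : ℕ) : Desc (colOf T n c) :=
  Finset.sortedGT_sort _ |>.pairwise

lemma mem_colOf {T : Tableau} {n c x : ℕ} :
    x ∈ colOf T n c ↔ ∃ i ∈ Finset.Icc 1 n, T (i : ℕ) (c + 1) = x ∧ x ≠ 0 := by
  rw [colOf, Finset.mem_sort, Finset.mem_image]
  constructor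
  · rintro ⟨i, h, rfl⟩
    rw [Finset.mem_filter] at h
    exact ⟨i, h.1, rfl, h.2⟩
  · rintro ⟨i, h, rfl, h0⟩
    exact ⟨i, Finset.mem_filter.2 ⟨h, h0⟩, rfl⟩

lemma cnt_colOf {T : Tableau} (hT : IsKeyTableau T) (n c t : ℕ) :
    cnt t (colOf T n c) = ((Finset.Icc 1 n).filter fun i : ℕ => t < T i (c + 1)).card := by
  rw [cnt, List.countP_eq_length_filter, 
    ← List.toFinset_card_of_nodup ((desc_colOf T n c).nodup.filter _)]
  symm
  refine Finset.card_bij (fun i _ => T (i : ℕ) (c + 1)) ?_ ?_ ?_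
  · intro i hi
    rw [Finset.mem_filter] at hi
    rw [List.mem_toFinset, List.mem_filter, mem_colOf]
    exact ⟨⟨i, hi.1, rfl, by omega⟩, by simpa using hi.2⟩
  · intro i hi j hj hij
    rw [Finset.mem_filter] at hi hj
    by_contra hne
    exact hT.2.2.2.2.2.1 i j (c + 1) (by exact_mod_cast hne) (by omega) (by omega) hij
  · intro x hx
    rw [List.mem_toFinset, List.mem_filter, mem_colOf] at hx
    obtain ⟨⟨i, hi, rfl, -⟩, h⟩ := hx
    exact ⟨i, Finset.mem_filter.2 ⟨hi, by simpa using h⟩, rfl⟩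

lemma length_colOf (T : Tableau) (n c : ℕ) : (colOf T n c).length = cnt 0 (colOf T n c) := by
  refine (cnt_eq_length fun a ha => ?_).symm
  obtain ⟨i, -, -, h⟩ := mem_colOf.1 ha
  omega

lemma dom_colOf {T : Tableau} (hT : IsKeyTableau T) (n c : ℕ) :
    Dom (colOf T n c) (colOf T n (c + 1)) := by
  have h : ∀ t, cnt t (colOf T n (c + 1)) ≤ cnt t (colOf T n c) := by
    intro t
    rw [cnt_colOf hT, cnt_colOf hT]
    refine Finset.card_le_card fun i hi => ?_
    rw [Finset.mem_filter] at hi ⊢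
    exact ⟨hi.1, hi.2.trans_le (hT.2.2.2.2.1 i (c + 1) (by omega) (by omega))⟩
  exact ⟨h, by rw [length_colOf, length_colOf]; exact h 0⟩

variable {α : ℕ → ℕ} {n : ℕ}

/-- Every key tableau arises from a factorization. -/
lemma exists_tabOf_eq {T : Tableau} (hT : IsKeyTableau T) (hs : shapeOf T = α) (h0 : α 0 = 0)
    (hn : ∀ i, n < i → α i = 0) : ∃ g, KF α n g ∧ tabOf g n = T := by
  have hl : ∀ c, (colOf T n c).length = hgt α c 0 n := by
    intro c
    rw [length_colOf, cnt_colOf hT, hgt_eq_card]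
    congr 1
    refine Finset.filter_congr fun i _ => ?_
    rw [Nat.pos_iff_ne_zero, ne_zero_iff_shapeOf hT, hs]
    omega
  obtain ⟨g, h1, h2⟩ := exists_pw α n 0 (desc_colOf T n) (dom_colOf hT n) hl
  obtain ⟨g', hg1, hg2⟩ : ∃ g' : ℕ → List ℕ, (∀ i, 1 ≤ i ∧ i ≤ n → g' i = g i) ∧
      ∀ i, ¬ (1 ≤ i ∧ i ≤ n) → g' i = [] :=
    ⟨fun i => if 1 ≤ i ∧ i ≤ n then g i else [], fun i h => if_pos h, fun i h => if_neg h⟩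
  have e : pw g' 0 n = pw g 0 n := by
    rw [pw, pw, blk_congr fun j j1 j2 => hg1 j ⟨j1, by omega⟩]
  have hKF : KF α n g' := by
    refine ⟨hg2 0 (by omega), fun i => ?_, fun i x hx => ?_, fun i => ?_, fun c => ?_⟩
    · by_cases hi : 1 ≤ i ∧ i ≤ n
      · rw [hg1 i hi]
        exact (h2 i (by omega) (by omega)).1
      · rw [hg2 i hi]
        by_cases hi0 : i = 0
        · rw [hi0, h0]; rfl
        · rw [hn i (by omega)]; rfl
    · by_cases hi : 1 ≤ i ∧ i ≤ n
      · have hx' : x ∈ pw g 0 n := e ▸ mem_pw.2 ⟨i, by omega, by omega, hx⟩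
        have h3 := count_eq_ncard (pw g 0 n) x
        have h4 : {c : ℕ | x ∈ col (pw g 0 n) c}.Nonempty := by
          refine Set.nonempty_of_ncard_ne_zero ?_
          rw [← h3]
          exact (List.count_pos_iff.2 hx').ne'
        obtain ⟨c, hc⟩ := h4
        rw [h1] at hc
        obtain ⟨j, -, -, h⟩ := mem_colOf.1 hc
        omega
      · rw [hg2 i hi] at hx
        simp at hx
    · by_cases hi : 1 ≤ i ∧ i ≤ n
      · rw [hg1 i hi]
        exact (h2 i (by omega) (by omega)).2
      · rw [hg2 i hi]
        exact List.IsChain.nil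
    · rw [e, ht, h1, hl]
  refine ⟨g', hKF, eq_of_columns hKF.isKeyTableau hT ((hKF.shapeOf_tabOf hn).trans hs.symm) ?_⟩
  intro c v hv
  have h3 := hKF.exists_tabOf_iff (c := c) (x := v)
  rw [e, h1, mem_colOf] at h3
  simp only [hv, ne_eq, not_false_eq_true, and_true] at h3
  rw [h3]
  constructor
  · rintro ⟨i, -, h⟩
    exact ⟨i, h⟩
  · rintro ⟨r, h⟩
    have hr : ¬ r ≤ 0 := fun hr => hv (h ▸ hT.1 r _ hr)
    obtain ⟨i, rfl⟩ : ∃ i : ℕ, r = i := ⟨r.toNat, by omega⟩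
    refine ⟨i, Finset.mem_Icc.2 ⟨by omega, ?_⟩, h⟩
    by_contra hi
    have h4 := (ne_zero_iff_shapeOf hT i (c + 1)).1 (h.trans_ne hv)
    rw [hs, hn i (by omega)] at h4
    omega

end Reverse

/-! ### Comparison with column insertion of tableaux -/

section Compare

open OrderDual

/-- The function `t` on rows has the entries of the column `C`, in some order. -/
def ColR (t : ℤ → ℕ) (C : List ℕᵒᵈ) : Prop :=
  (∀ r, t r ≠ 0 ↔ 1 ≤ r ∧ r ≤ C.length) ∧ ∀ x, x ≠ 0 → ((∃ r, t r = x) ↔ toDual x ∈ C)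

/-- The tableau `T` has the columns `S`, up to reordering of each column. -/
def TabR (T : Tableau) (S : ℕ → List ℕᵒᵈ) : Prop :=
  (∀ r, T r 0 = 0) ∧ ∀ c, ColR (fun r => T r (c + 1)) (S c)

lemma ColR.colHeight {T : Tableau} {c : ℕ} {C : List ℕᵒᵈ} (h : ColR (fun r => T r c) C) :
    colHeightN T c = C.length := by
  have e : {r : ℤ | T r c ≠ 0} = (Finset.Icc (1 : ℤ) C.length : Finset ℤ) := by
    ext r
    rw [Finset.coe_Icc, Set.mem_Icc]
    exact h.1 r
  rw [colHeightN, e, Set.ncard_coe_finset, Int.card_Icc]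
  omega

lemma ColR.append {t : ℤ → ℕ} {C : List ℕᵒᵈ} (h : ColR t C) {x : ℕ} (hx : x ≠ 0) :
    ColR (fun r => if r = (C.length : ℤ) + 1 then x else t r) (C ++ [toDual x]) := by
  refine ⟨fun r => ?_, fun z hz => ?_⟩
  · have := h.1 r
    rw [List.length_append, List.length_singleton]
    beta_reduce
    split_ifs with hr
    · simp only [ne_eq, hx, not_false_eq_true, true_iff]
      omega
    · rw [this]
      omega
  · rw [List.mem_append, List.mem_singleton, ← h.2 z hz]
    constructor
    · rintro ⟨r, hr⟩
      beta_reduce at hr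
      split_ifs at hr
      · exact Or.inr (hr ▸ rfl)
      · exact Or.inl ⟨r, hr⟩
    · rintro (⟨r, hr⟩ | hzx)
      · refine ⟨r, ?_⟩
        have := (h.1 r).1 (hr.trans_ne hz)
        exact (if_neg (by omega)).trans hr
      · exact ⟨(C.length : ℤ) + 1, (if_pos rfl).trans (toDual.injective hzx).symm⟩

lemma ColR.replace {t : ℤ → ℕ} {C : List ℕᵒᵈ} (h : ColR t C) (hC : Desc C) {x p : ℕ}
    (hx : x ≠ 0) (hp : stepO C (toDual x) = some (toDual p)) :
    ColR (fun r => if t r = p then x else t r) (stepC C (toDual x)) := by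
  have hpC := (mem_of_stepO hp).1
  have hp0 : p ≠ 0 := by
    have : x ≤ p := (mem_of_stepO hp).2
    omega
  refine ⟨fun r => ?_, fun z hz => ?_⟩
  · rw [length_stepC_some hp, ← h.1 r]
    beta_reduce
    split_ifs with hr
    · exact ⟨fun _ => hr.trans_ne hp0, fun _ => hx⟩
    · rfl
  · rw [mem_stepC_iff hC hp, ← h.2 z hz, toDual.injective.ne_iff, toDual.injective.eq_iff]
    constructor
    · rintro ⟨r, hr⟩
      beta_reduce at hr
      split_ifs at hr with h1
      · exact Or.inr hr.symm
      · exact Or.inl ⟨⟨r, hr⟩, hr ▸ h1⟩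
    · rintro (⟨⟨r, hr⟩, hzp⟩ | rfl)
      · exact ⟨r, (if_neg (hr.trans_ne hzp)).trans hr⟩
      · obtain ⟨r, hr⟩ := (h.2 p hp0).2 hpC
        exact ⟨r, if_pos hr⟩

lemma ColR.congr {t : ℤ → ℕ} {C D : List ℕᵒᵈ} (h : ColR t C) (hl : C.length = D.length)
    (hm : ∀ x, x ∈ C ↔ x ∈ D) : ColR t D :=
  ⟨fun r => hl ▸ h.1 r, fun x hx => (h.2 x hx).trans (hm _)⟩

lemma tabR_colInsertAux {d : ℕ} {fuel : ℕ} {T : Tableau} {a x : ℕ} {S S' : ℕ → List ℕᵒᵈ}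
    (hS : ∀ c, Desc (S c)) (hT : TabR T S) (hx : x ≠ 0) (hd : d < fuel)
    (hpre : ∀ c < a, S' c = S c)
    (h : InsF d (fun c => S (a + c)) (toDual x) (fun c => S' (a + c))) :
    TabR (colInsertAux fuel T (a + 1) x) S' := by
  induction d generalizing fuel T a x S with
  | zero =>
    obtain ⟨fuel, rfl⟩ := Nat.exists_eq_add_of_lt hd
    obtain ⟨h1, h2, h3⟩ := h
    simp only [Nat.add_zero] at h1 h2 h3
    have hcond : ∀ r : ℤ, T r (a + 1) ≠ 0 → T r (a + 1) < x := fun r hr =>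
      stepO_eq_none.1 h1 _ (((hT.2 a).2 _ hr).1 ⟨r, rfl⟩)
    rw [colInsertAux, if_pos hcond, (hT.2 a).colHeight]
    refine ⟨fun r => ?_, fun c => ?_⟩
    · exact (if_neg (by omega)).trans (hT.1 r)
    · rcases lt_trichotomy c a with hc | rfl | hc
      · rw [hpre c hc]
        simpa [hc.ne] using hT.2 c
      · rw [h2, stepC_of_none h1]
        simpa using (hT.2 c).append hx
      · obtain ⟨k, rfl⟩ := Nat.exists_eq_add_of_lt hc
        have := h3 k
        rw [← Nat.add_assoc] at this
        rw [this]
        have hne : a + k + 1 ≠ a := by omega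
        simpa [hne] using hT.2 (a + k + 1)
  | succ d ih =>
    obtain ⟨fuel, rfl⟩ := Nat.exists_eq_add_of_lt hd
    obtain ⟨p, h1, h2, h3⟩ := h
    obtain ⟨p, rfl⟩ := toDual.surjective p
    simp only [Nat.add_zero] at h1 h2
    have hxp : x ≤ p := (mem_of_stepO h1).2
    have hp0 : p ≠ 0 := by omega
    obtain ⟨rp, hrp⟩ := ((hT.2 a).2 p hp0).2 (mem_of_stepO h1).1
    have hcond : ¬ ∀ r : ℤ, T r (a + 1) ≠ 0 → T r (a + 1) < x := fun hall => by
      have := hall rp (hrp.trans_ne hp0)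
      simp only at hrp
      omega
    obtain ⟨S₁, s1, s2⟩ : ∃ S₁ : ℕ → List ℕᵒᵈ, (∀ c, c ≤ a → S₁ c = S' c) ∧
        ∀ c, a < c → S₁ c = S c :=
      ⟨fun c => if c ≤ a then S' c else S c, fun c h => if_pos h,
        fun c h => if_neg (not_le.2 h)⟩
    have hS₁ : ∀ c, Desc (S₁ c) := by
      intro c
      rcases lt_trichotomy c a with hc | rfl | hc
      · rw [s1 c hc.le, hpre c hc]; exact hS c
      · rw [s1 c le_rfl, h2]; exact desc_stepC (hS c) _
      · rw [s2 c hc]; exact hS c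
    have h4 : InsF d (fun c => S₁ (a + 1 + c)) (toDual p) (fun c => S' (a + 1 + c)) := by
      have e1 : (fun c => S₁ (a + 1 + c)) = fun c => S (a + (c + 1)) := by
        funext c
        rw [s2 _ (by omega)]
        congr 1
        omega
      have e2 : (fun c => S' (a + 1 + c)) = fun c => S' (a + (c + 1)) := by
        funext c
        congr 1
        omega
      rw [e1, e2]
      exact h3
    have hpre' : ∀ c < a + 1, S' c = S₁ c := fun c hc => (s1 c (by omega)).symm
    rw [colInsertAux, if_neg hcond]
    by_cases hmem : ∃ r : ℤ, T r (a + 1) = x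
    · rw [if_pos hmem]
      have hxC : toDual x ∈ S a := ((hT.2 a).2 x hx).1 hmem
      obtain rfl : p = x := le_antisymm (le_of_stepO (hS a) h1 _ hxC le_rfl) hxp
      refine ih hS₁ ⟨hT.1, fun c => ?_⟩ hx (by omega) hpre' h4
      rcases lt_trichotomy c a with hc | rfl | hc
      · rw [s1 c hc.le, hpre c hc]; exact hT.2 c
      · rw [s1 c le_rfl, h2]
        refine (hT.2 c).congr (length_stepC_some h1).symm fun z => ?_
        rw [mem_stepC_iff (hS c) h1]
        by_cases hz : z = toDual p
        · simp [hz, hxC]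
        · simp [hz]
      · rw [s2 c hc]; exact hT.2 c
    · rw [if_neg hmem]
      have hxp' : x < p := lt_of_le_of_ne hxp fun h => hmem ⟨rp, h ▸ hrp⟩
      have hy : sInf {v : ℕ | x < v ∧ ∃ r : ℤ, T r (a + 1) = v} = p := by
        refine le_antisymm (Nat.sInf_le ⟨hxp', rp, hrp⟩)
          (le_csInf ⟨p, hxp', rp, hrp⟩ ?_)
        rintro v ⟨hv, r, hr⟩
        exact le_of_stepO (hS a) h1 (toDual v) (((hT.2 a).2 v (by omega)).1 ⟨r, hr⟩) hv.le
      simp only [hy]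
      refine ih hS₁ ⟨fun r => ?_, fun c => ?_⟩ hp0 (by omega) hpre' h4
      · exact (if_neg (by omega)).trans (hT.1 r)
      · rcases lt_trichotomy c a with hc | rfl | hc
        · rw [s1 c hc.le, hpre c hc]
          simpa [hc.ne] using hT.2 c
        · rw [s1 c le_rfl, h2]
          simpa using (hT.2 c).replace (hS c) hx h1
        · rw [s2 c hc]
          simpa [hc.ne'] using hT.2 c

lemma tabR_foldl {u : List ℕ} (hu : ∀ x ∈ u, 1 ≤ x) :
    TabR (u.foldl colInsert fun _ _ => 0) (col (u.map toDual)) := by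
  induction u using List.reverseRecOn with
  | nil =>
    refine ⟨fun _ => rfl, fun c => ?_⟩
    rw [List.map_nil, col_eq_nil _ _ (by simp)]
    refine ⟨fun r => ?_, fun x hx => ?_⟩
    · simp only [List.foldl_nil, ne_eq, not_true_eq_false, List.length_nil, false_iff]
      omega
    · simp [hx.symm]
  | append_singleton u x ih =>
    have ih := ih fun y hy => hu y (by simp [hy])
    set T := u.foldl colInsert fun _ _ => 0 with hT
    have hx := hu x (by simp)
    rw [List.foldl_append, List.foldl_cons, List.foldl_nil, ← hT, List.map_append, List.map_cons,
      List.map_nil, colInsert]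
    have hins := insF_col (u.map toDual) (toDual x)
    refine tabR_colInsertAux (a := 0) (desc_col _) ih (by omega) ?_ (by simp)
      (by simpa using hins)
    generalize hd : dcol (u.map toDual) (toDual x) = d at hins ⊢
    cases d with
    | zero => omega
    | succ d =>
      have h1 := ht_antitone (u.map toDual ++ [toDual x]) (Nat.le_succ d)
      have h2 := ht_concat (u.map toDual) (toDual x) d
      have h3 := ht_concat (u.map toDual) (toDual x) (d + 1)
      rw [hd, if_neg (by omega)] at h2
      rw [hd, if_pos rfl] at h3
      have h4 : T 1 (d + 1) ≠ 0 := by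
        refine ((ih.2 d).1 1).2 ⟨le_rfl, ?_⟩
        simp only [ht] at h1 h2 h3
        rw [Nat.succ_eq_add_one] at h1
        omega
      have hb : BddAbove {c : ℕ | ∃ r : ℤ, T r c ≠ 0} := by
        refine ⟨u.length, ?_⟩
        rintro c ⟨r, hr⟩
        by_contra hc
        obtain ⟨c, rfl⟩ : ∃ k, c = k + 1 := ⟨c - 1, by omega⟩
        have := ((ih.2 c).1 r).1 hr
        rw [col_eq_nil _ _ (by simp; omega), List.length_nil] at this
        omega
      have := le_csSup hb (show d + 1 ∈ {c : ℕ | ∃ r : ℤ, T r c ≠ 0} from ⟨1, h4⟩)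
      omega

lemma ht_dual (v : List ℕ) (c : ℕ) : ht (v.map toDual).reverse c = ht v c :=
  ht_map_reverse (f := toDual) (f' := ofDual) (fun _ _ h => h) (fun _ _ h => h) (fun _ => rfl) v c

lemma insertP_ne_zero_iff {v : List ℕ} (hv : ∀ x ∈ v, 1 ≤ x) (r : ℤ) (c : ℕ) :
    insertP v r (c + 1) ≠ 0 ↔ 1 ≤ r ∧ r ≤ ht v c := by
  have h := tabR_foldl (u := v.reverse) (by simpa using hv)
  rw [insertP, ← ht_dual, ht, ← List.map_reverse]
  exact (h.2 c).1 r

lemma insertP_zero {v : List ℕ} (hv : ∀ x ∈ v, 1 ≤ x) (r : ℤ) : insertP v r 0 = 0 :=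
  (tabR_foldl (u := v.reverse) (by simpa using hv)).1 r

lemma ht_le_append (p s : List ℕ) (c : ℕ) : ht s c ≤ ht (p ++ s) c := by
  rw [← ht_dual s, ← ht_dual, List.map_append, List.reverse_append, ht_append]
  exact Nat.le_add_right _ _

lemma insertQ_zero {v : List ℕ} (hv : ∀ x ∈ v, 1 ≤ x) (r : ℤ) : insertQ v r 0 = 0 := by
  have : {j : ℕ | insertP (v.drop (v.length - j)) r 0 ≠ 0} = ∅ := by
    refine Set.eq_empty_of_forall_notMem fun j hj => hj ?_
    exact insertP_zero (fun x hx => hv x (List.mem_of_mem_drop hx)) r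
  rw [insertQ, this, Nat.sInf_empty]

lemma insertQ_ne_zero_iff {v : List ℕ} (hv : ∀ x ∈ v, 1 ≤ x) (r : ℤ) (c : ℕ) :
    insertQ v r (c + 1) ≠ 0 ↔ 1 ≤ r ∧ r ≤ ht v c := by
  have hd : ∀ j, ∀ x ∈ v.drop (v.length - j), 1 ≤ x := fun j x hx =>
    hv x (List.mem_of_mem_drop hx)
  constructor
  · intro h
    obtain ⟨j, hj⟩ := Nat.nonempty_of_sInf_eq_succ (Nat.exists_eq_succ_of_ne_zero h).choose_spec
    have h1 := (insertP_ne_zero_iff (hd j) r c).1 hj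
    have h2 := ht_le_append (v.take (v.length - j)) (v.drop (v.length - j)) c
    rw [List.take_append_drop] at h2
    omega
  · intro h hz
    have hne : {j : ℕ | insertP (v.drop (v.length - j)) r (c + 1) ≠ 0}.Nonempty := by
      refine ⟨v.length, ?_⟩
      rw [Set.mem_ofPred_eq, Nat.sub_self, List.drop_zero, insertP_ne_zero_iff hv]
      exact h
    have h1 := Nat.sInf_mem hne
    rw [insertQ] at hz
    rw [hz, Set.mem_ofPred_eq, Nat.sub_zero, List.drop_length,
      insertP_ne_zero_iff (by simp), ht_nil] at h1
    omega

lemma insertQ_eq {p s : List ℕ} {x : ℕ} (hv : ∀ y ∈ p ++ x :: s, 1 ≤ y) {r : ℤ} {c : ℕ}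
    (hr : 1 ≤ r) (h1 : r ≤ ht (x :: s) c) (h2 : ht s c < r) :
    insertQ (p ++ x :: s) r (c + 1) = s.length + 1 := by
  have hd : ∀ j, ∀ y ∈ (p ++ x :: s).drop ((p ++ x :: s).length - j), 1 ≤ y := fun j y hy =>
    hv y (List.mem_of_mem_drop hy)
  have hmem : s.length + 1 ∈ {j : ℕ | insertP ((p ++ x :: s).drop
      ((p ++ x :: s).length - j)) r (c + 1) ≠ 0} := by
    rw [Set.mem_ofPred_eq, insertP_ne_zero_iff (hd _),
      show (p ++ x :: s).length - (s.length + 1) = p.length by simp, List.drop_left]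
    exact ⟨hr, h1⟩
  refine le_antisymm (Nat.sInf_le hmem) (le_csInf ⟨_, hmem⟩ fun j hj => ?_)
  by_contra hlt
  have h3 := (insertP_ne_zero_iff (hd _) _ _).1 hj
  have h4 : (p ++ x :: s).drop ((p ++ x :: s).length - j) = s.drop (s.length - j) := by
    rw [show (p ++ x :: s).length - j = (p ++ [x]).length + (s.length - j) by simp; omega,
      show p ++ x :: s = (p ++ [x]) ++ s by simp, List.drop_append]
    simp
  have h5 := ht_le_append (s.take (s.length - j)) (s.drop (s.length - j)) c
  rw [List.take_append_drop] at h5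
  rw [h4] at h3
  omega

end Compare

/-! ### The recording tableau condition -/

section Record

lemma pw_eq_of_le {L : Type*} {g : ℕ → List L} {m n : ℕ} (h : m ≤ n)
    (hn : ∀ i, m < i → g i = []) : pw g 0 n = pw g 0 m := by
  have : pw g m (n - m) = [] := by
    refine List.eq_nil_iff_forall_not_mem.2 fun x hx => ?_
    obtain ⟨j, h1, -, h2⟩ := mem_pw.1 hx
    rw [hn j h1] at h2
    exact List.not_mem_nil h2
  rw [pw_split g h, this, List.nil_append]

lemma length_pw {L : Type*} (g : ℕ → List L) (n : ℕ) :
    (pw g 0 n).length = ∑ i ∈ Finset.Icc 1 n, (g i).length := by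
  induction n with
  | zero => rfl
  | succ n ih =>
    rw [pw_succ, List.length_append, ih, Finset.sum_Icc_succ_top (by omega), Nat.zero_add,
      Nat.add_comm]

lemma factWord_eq {g : ℕ → List ℕ} {n : ℕ} (h0 : g 0 = []) (hn : ∀ i, n < i → g i = []) :
    factWord g = pw g 0 n := by
  have key : ∀ m, (((List.range (m + 1)).reverse.map g).foldr (· ++ ·) []) = pw g 0 m := by
    intro m
    induction m with
    | zero => simp [h0, pw, blk]
    | succ m ih =>
      rw [List.range_succ, List.reverse_append, List.reverse_singleton, List.singleton_append,
        List.map_cons, List.foldr_cons, ih, pw_succ, Nat.zero_add]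
  have hb : n ∈ upperBounds {i : ℕ | g i ≠ []} := fun i hi => by
    by_contra hni
    exact hi (hn i (not_le.1 hni))
  have htop : topIdx g ≤ n := by
    rcases Set.eq_empty_or_nonempty {i : ℕ | g i ≠ []} with h | h
    · rw [topIdx, h, csSup_empty]
      exact Nat.zero_le _
    · exact csSup_le h hb
  have hgt : ∀ i, topIdx g < i → g i = [] := fun i hi => by
    by_contra hne
    exact absurd (le_csSup ⟨n, hb⟩ (show i ∈ {i : ℕ | g i ≠ []} from hne)) (not_le.2 hi)
  rw [factWord, factWordGe, List.filter_eq_self.2 (by simp), key, ← pw_eq_of_le htop hgt]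

variable {α : ℕ → ℕ} {n : ℕ} {g : ℕ → List ℕ}

lemma hgt_zero_succ (α : ℕ → ℕ) (c x : ℕ) :
    hgt α c 0 (x + 1) = hgt α c 0 x + if c < α (x + 1) then 1 else 0 := by
  rw [hgt, Nat.zero_add]

lemma hgt_le_of_le (α : ℕ → ℕ) (c : ℕ) {x y : ℕ} (h : x ≤ y) : hgt α c 0 x ≤ hgt α c 0 y := by
  obtain ⟨k, rfl⟩ := Nat.exists_eq_add_of_le h
  rw [hgt_add]
  exact Nat.le_add_right _ _

lemma eq_of_hgt_eq {c x y : ℕ} (hx : 1 ≤ x) (hy : 1 ≤ y) (hcx : c < α x) (hcy : c < α y)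
    (h : hgt α c 0 x = hgt α c 0 y) : x = y := by
  wlog hlt : x < y generalizing x y
  · rcases (not_lt.1 hlt).eq_or_lt with e | e
    · exact e.symm
    · exact (this hy hx hcy hcx h.symm e).symm
  obtain ⟨y, rfl⟩ := Nat.exists_eq_add_of_le' hy
  have := hgt_le_of_le α c (Nat.le_of_lt_succ hlt)
  rw [h, hgt_zero_succ, if_pos hcy] at this
  omega

lemma exists_hgt_eq {c r : ℕ} (hr : 1 ≤ r) (h : r ≤ hgt α c 0 n) :
    ∃ x, 1 ≤ x ∧ x ≤ n ∧ c < α x ∧ hgt α c 0 x = r := by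
  induction n with
  | zero =>
    rw [hgt] at h
    omega
  | succ n ih =>
    by_cases h1 : r ≤ hgt α c 0 n
    · obtain ⟨x, h2, h3, h4⟩ := ih h1
      exact ⟨x, h2, by omega, h4⟩
    · have h2 := h
      rw [hgt_zero_succ] at h2
      split_ifs at h2 with hc
      · exact ⟨n + 1, by omega, le_rfl, hc, by rw [hgt_zero_succ, if_pos hc]; omega⟩
      · omega

lemma keyTab_eq (α : ℕ → ℕ) (r : ℤ) (c : ℕ) :
    keyTab α r (c + 1) = sInf {x : ℕ | 1 ≤ x ∧ c < α x ∧ (hgt α c 0 x : ℤ) = r} := by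
  rw [keyTab, if_neg (by omega)]
  congr 1
  ext x
  have : {y : ℕ | 1 ≤ y ∧ c + 1 ≤ α y ∧ y ≤ x} =
      ((Finset.Icc 1 x).filter fun i => c < α i : Finset ℕ) := by
    ext y
    simp only [Set.mem_ofPred_eq, Finset.coe_filter, Finset.mem_Icc]
    omega
  rw [Set.mem_ofPred_eq, Set.mem_ofPred_eq, this, Set.ncard_coe_finset, hgt_eq_card]
  rfl

lemma keyTab_hgt {c x : ℕ} (hx : 1 ≤ x) (hc : c < α x) : keyTab α (hgt α c 0 x) (c + 1) = x := by
  have : {y : ℕ | 1 ≤ y ∧ c < α y ∧ (hgt α c 0 y : ℤ) = hgt α c 0 x} = {x} := by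
    refine Set.eq_singleton_iff_unique_mem.2 ⟨⟨hx, hc, rfl⟩, ?_⟩
    rintro y ⟨h1, h2, h3⟩
    exact eq_of_hgt_eq h1 hx h2 hc (by exact_mod_cast h3)
  rw [keyTab_eq, this, csInf_singleton]

lemma exists_of_keyTab_ne_zero {r : ℤ} {c : ℕ} (h : keyTab α r c ≠ 0) :
    ∃ c', c = c' + 1 ∧ 1 ≤ keyTab α r c ∧ c' < α (keyTab α r c) ∧
      (hgt α c' 0 (keyTab α r c) : ℤ) = r := by
  cases c with
  | zero => exact absurd (if_pos rfl) h
  | succ c =>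
    refine ⟨c, rfl, ?_⟩
    rw [keyTab_eq] at h ⊢
    exact Nat.sInf_mem (Nat.nonempty_of_sInf_eq_succ
      (Nat.exists_eq_succ_of_ne_zero h).choose_spec)

lemma stdTab_keyTab {c y : ℕ} (hc : c < α (y + 1)) :
    stdTab (keyTab α) (hgt α c 0 (y + 1)) (c + 1) = ∑ i ∈ Finset.Icc 1 y, α i + (c + 1) := by
  have hx := keyTab_hgt (Nat.le_add_left 1 y) hc
  rw [stdTab, hx, if_neg (by omega)]
  have e : {p : ℤ × ℕ | keyTab α p.1 p.2 ≠ 0 ∧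
      (keyTab α p.1 p.2 < y + 1 ∨ (keyTab α p.1 p.2 = y + 1 ∧ p.2 ≤ c + 1))} =
      (fun q : Σ _ : ℕ, ℕ => ((hgt α q.2 0 q.1 : ℤ), q.2 + 1)) ''
        ((Finset.Icc 1 (y + 1)).sigma fun i => Finset.range (if i ≤ y then α i else c + 1) :
          Finset (Σ _ : ℕ, ℕ)) := by
    ext ⟨r, d⟩
    simp only [Set.mem_ofPred_eq, Set.mem_image, Finset.mem_coe, Finset.mem_sigma, Finset.mem_Icc,
      Finset.mem_range, Sigma.exists, Prod.mk.injEq]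
    constructor
    · rintro ⟨h0, h⟩
      obtain ⟨d, rfl, h1, h2, h3⟩ := exists_of_keyTab_ne_zero h0
      refine ⟨_, d, ⟨⟨h1, by omega⟩, ?_⟩, h3, rfl⟩
      split_ifs
      · exact h2
      · omega
    · rintro ⟨i, d, ⟨⟨h1, h2⟩, h3⟩, rfl, rfl⟩
      split_ifs at h3 with h4
      · rw [keyTab_hgt h1 h3]
        omega
      · obtain rfl : i = y + 1 := by omega
        rw [keyTab_hgt h1 (by omega)]
        omega
  rw [e, Set.InjOn.ncard_image, Set.ncard_coe_finset, Finset.card_sigma,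
    Finset.sum_Icc_succ_top (by omega)]
  · simp only [Finset.card_range]
    rw [if_neg (by omega)]
    congr 1
    refine Finset.sum_congr rfl fun i hi => ?_
    rw [if_pos (Finset.mem_Icc.1 hi).2]
  · have key : ∀ q ∈ ((Finset.Icc 1 (y + 1)).sigma fun i =>
        Finset.range (if i ≤ y then α i else c + 1) : Finset (Σ _ : ℕ, ℕ)),
        1 ≤ q.1 ∧ q.2 < α q.1 := by
      rintro ⟨i, d⟩ h
      simp only [Finset.mem_sigma, Finset.mem_Icc, Finset.mem_range] at h ⊢
      obtain ⟨⟨h1, h2⟩, h3⟩ := h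
      refine ⟨h1, ?_⟩
      split_ifs at h3
      · exact h3
      · obtain rfl : i = y + 1 := by omega
        omega
    rintro ⟨i, d⟩ h ⟨i', d'⟩ h' he
    obtain ⟨he1, he2⟩ := Prod.mk.inj he
    obtain rfl : d = d' := by simpa using he2
    obtain rfl : i = i' := eq_of_hgt_eq (key _ h).1 (key _ h').1 (key _ h).2 (key _ h').2
      (by exact_mod_cast he1)
    rfl

lemma stdTab_keyTab_ne_zero_iff (hn : ∀ i, n < i → α i = 0) (r : ℤ) (c : ℕ) :
    stdTab (keyTab α) r (c + 1) ≠ 0 ↔ 1 ≤ r ∧ r ≤ hgt α c 0 n := by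
  constructor
  · intro h
    have h0 : keyTab α r (c + 1) ≠ 0 := fun h0 => h (if_pos h0)
    obtain ⟨d, hd, h1, h2, h3⟩ := exists_of_keyTab_ne_zero h0
    obtain rfl : c = d := by omega
    generalize keyTab α r (c + 1) = x at h1 h2 h3
    have hxn : x ≤ n := by
      by_contra hlt
      rw [hn x (not_le.1 hlt)] at h2
      omega
    have h4 := hgt_le_of_le α c hxn
    obtain ⟨y, rfl⟩ := Nat.exists_eq_add_of_le' h1
    have h5 := hgt_zero_succ α c y
    rw [if_pos h2] at h5
    omega
  · rintro ⟨h1, h2⟩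
    obtain ⟨r, rfl⟩ := Int.eq_ofNat_of_zero_le (by omega : 0 ≤ r)
    obtain ⟨x, hx, -, hc, rfl⟩ := exists_hgt_eq (α := α) (c := c) (r := r) (n := n)
      (by omega) (by omega)
    obtain ⟨y, rfl⟩ := Nat.exists_eq_add_of_le' hx
    rw [stdTab_keyTab hc]
    omega

section Dual

open OrderDual

/-- The reversed word over the opposite alphabet. -/
def rdual (b : List ℕ) : List ℕᵒᵈ := (b.map toDual).reverse

lemma rdual_append (b b' : List ℕ) : rdual (b ++ b') = rdual b' ++ rdual b := by
  simp [rdual]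

lemma rdual_flatten (B : List (List ℕ)) :
    rdual B.flatten = (B.reverse.map rdual).flatten := by
  induction B with
  | nil => rfl
  | cons b B ih => simp [rdual_append, ih]

lemma KF.dlist_rdual (hg : KF α n g) {i : ℕ} (hi : i < n) :
    dlist (rdual (pw g 0 i)) (rdual (g (i + 1))) = List.range (α (i + 1)) := by
  have e : blk g 0 n = blk g (i + 1) (n - (i + 1)) ++ g (i + 1) :: blk g 0 i := by
    obtain ⟨k, rfl⟩ := Nat.exists_eq_add_of_le (Nat.succ_le_of_lt hi)
    rw [blk_add]
    simp [blk]
  have e' : (blk g 0 i).reverse.map rdual ++ rdual (g (i + 1)) ::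
      (blk g (i + 1) (n - (i + 1))).reverse.map rdual = (blk g 0 n).reverse.map rdual := by
    simp [e]
  have hl : (rdual (g (i + 1))).length = α (i + 1) := by simp [rdual, hg.len]
  rw [pw, rdual_flatten, ← hl]
  refine dlist_block_eq_range (B' := (blk g (i + 1) (n - (i + 1))).reverse.map rdual) ?_ ?_
  · rw [e']
    intro a ha
    obtain ⟨b, hb, rfl⟩ := List.mem_map.1 ha
    obtain ⟨j, -, -, rfl⟩ := mem_blk (List.mem_reverse.1 hb)
    rw [rdual, List.isChain_reverse, List.isChain_map]
    exact hg.inc j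
  · intro c
    rw [e', ← rdual_flatten]
    refine (ht_dual _ c).trans ((hg.shape c).trans ?_)
    rw [← countP_blk hg.len, List.countP_map, List.countP_reverse]
    congr 1
    funext b
    simp [rdual]

lemma KF.ht_partial (hg : KF α n g) {i : ℕ} (hi : i < n) {b b' : List ℕ}
    (hb : b ++ b' = g (i + 1)) (c : ℕ) :
    ht (b' ++ pw g 0 i) c = ht (pw g 0 i) c + if c < b'.length then 1 else 0 := by
  have h := hg.dlist_rdual hi
  rw [← hb, rdual_append, dlist_append] at h
  have hl : (dlist (rdual (pw g 0 i)) (rdual b')).length = b'.length := by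
    rw [length_dlist]
    simp [rdual]
  have h' : dlist (rdual (pw g 0 i)) (rdual b') = List.range b'.length := by
    have h1 := congrArg (List.take b'.length) h
    rw [← hl, List.take_left, hl, List.take_range] at h1
    rw [h1, min_eq_left]
    rw [← hg.len, ← hb, List.length_append]
    omega
  rw [← ht_dual (b' ++ _), ← ht_dual (pw g 0 i)]
  change ht (rdual (b' ++ pw g 0 i)) c = ht (rdual (pw g 0 i)) c + _
  rw [rdual_append, ht_append, h', count_range]

end Dual

lemma KF.ht_pw (hg : KF α n g) {i : ℕ} (hi : i ≤ n) (c : ℕ) :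
    ht (pw g 0 i) c = hgt α c 0 i := by
  induction i with
  | zero => simp [pw, blk, hgt, ht_nil]
  | succ i ih =>
    rw [pw_succ, Nat.zero_add, hg.ht_partial (b := []) hi rfl, ih (by omega), hgt_zero_succ,
      hg.len]

lemma KF.posWord (hg : KF α n g) : ∀ x ∈ pw g 0 n, 1 ≤ x := fun _ hx =>
  let ⟨j, _, _, hj⟩ := mem_pw.1 hx
  hg.pos j _ hj

lemma KF.insertQ_eq (hg : KF α n g) (hn : ∀ i, n < i → α i = 0) :
    insertQ (pw g 0 n) = stdTab (keyTab α) := by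
  funext r c
  cases c with
  | zero =>
    rw [insertQ_zero hg.posWord]
    exact (if_pos (if_pos rfl)).symm
  | succ c =>
    have h1 := insertQ_ne_zero_iff hg.posWord r c
    have h2 := stdTab_keyTab_ne_zero_iff hn r c
    rw [hg.shape] at h1
    by_cases h : 1 ≤ r ∧ r ≤ hgt α c 0 n
    · obtain ⟨r, rfl⟩ := Int.eq_ofNat_of_zero_le (by omega : 0 ≤ r)
      obtain ⟨x, hx, hxn, hc, rfl⟩ := exists_hgt_eq (α := α) (c := c) (r := r) (n := n)
        (by omega) (by omega)
      obtain ⟨y, rfl⟩ := Nat.exists_eq_add_of_le' hx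
      have hlen := hg.len (y + 1)
      obtain ⟨b, a, b', hb, hb'⟩ : ∃ b a b', g (y + 1) = b ++ a :: b' ∧ b'.length = c := by
        have hlt : (g (y + 1)).length - (c + 1) < (g (y + 1)).length := by omega
        refine ⟨(g (y + 1)).take ((g (y + 1)).length - (c + 1)),
          (g (y + 1))[(g (y + 1)).length - (c + 1)],
          (g (y + 1)).drop ((g (y + 1)).length - (c + 1) + 1), ?_, ?_⟩
        · rw [List.getElem_cons_drop, List.take_append_drop]
        · rw [List.length_drop]
          omega
      have hw : pw g 0 n = (pw g (y + 1) (n - (y + 1)) ++ b) ++ a :: (b' ++ pw g 0 y) := by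
        rw [pw_split g hxn, pw_succ, Nat.zero_add, hb]
        simp
      have e1 := hg.ht_partial (b := b) (b' := a :: b') hxn hb.symm c
      have e2 := hg.ht_partial (b := b ++ [a]) (b' := b') hxn (by rw [hb]; simp) c
      have e3 := hgt_zero_succ α c y
      rw [hg.ht_pw (by omega)] at e1 e2
      rw [List.length_cons, if_pos (by omega)] at e1
      rw [if_neg (by omega)] at e2
      rw [if_pos hc] at e3
      rw [stdTab_keyTab hc, hw, FlaggedKey.insertQ_eq (by rw [← hw]; exact hg.posWord)
        (by omega) (by rw [← List.cons_append, e1, e3]) (by rw [e2, e3]; omega),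
        List.length_append, hb', length_pw]
      simp only [hg.len]
      omega
    · rw [not_not.1 (mt h1.1 h), not_not.1 (mt h2.1 h)]

lemma KF.of_insertQ_eq (zero : g 0 = []) (len : ∀ i, (g i).length = α i)
    (pos : ∀ i, ∀ x ∈ g i, 1 ≤ x) (inc : ∀ i, (g i).IsChain (· ≤ ·))
    (hn : ∀ i, n < i → α i = 0) (h : insertQ (pw g 0 n) = stdTab (keyTab α)) : KF α n g where
  zero := zero
  len := len
  pos := pos
  inc := inc
  shape c := by
    have hp : ∀ x ∈ pw g 0 n, 1 ≤ x := fun x hx =>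
      let ⟨j, _, _, hj⟩ := mem_pw.1 hx
      pos j x hj
    have key : ∀ r : ℤ, (1 ≤ r ∧ r ≤ ht (pw g 0 n) c) ↔ 1 ≤ r ∧ r ≤ hgt α c 0 n := fun r => by
      rw [← insertQ_ne_zero_iff hp, h, stdTab_keyTab_ne_zero_iff hn]
    have k1 := key (ht (pw g 0 n) c)
    have k2 := key (hgt α c 0 n)
    omega

lemma mem_Wset_iff (hn : ∀ i, n < i → α i = 0) {φ : ℕ → ℕ} :
    g ∈ Wset α φ ↔ KF α n g ∧ ∀ i, ∀ x ∈ g i, x ≤ φ i := by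
  have hw : g 0 = [] → (∀ i, (g i).length = α i) → factWord g = pw g 0 n := fun h0 hl =>
    factWord_eq h0 fun i hi => List.length_eq_zero_iff.1 ((hl i).trans (hn i hi))
  constructor
  · rintro ⟨h0, hl, hp, hi, -, hf, hQ⟩
    rw [hw h0 hl] at hQ
    exact ⟨.of_insertQ_eq h0 hl hp hi hn hQ, hf⟩
  · rintro ⟨hg, hf⟩
    refine ⟨hg.zero, hg.len, hg.pos, hg.inc, hg.maxFact hn, hf, ?_⟩
    rw [hw hg.zero hg.len, hg.insertQ_eq hn]

lemma bijOn_tabOf (h0 : α 0 = 0) (hn : ∀ i, n < i → α i = 0) {φ : ℕ → ℕ} (hφ : IsFlag φ) :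
    Set.BijOn (fun g => tabOf g n) (Wset α φ) (SSKT α φ) := by
  refine ⟨fun g hg => ?_, fun g hg g' hg' h => ?_, fun T hT => ?_⟩
  · obtain ⟨hg, hf⟩ := (mem_Wset_iff hn).1 hg
    exact ⟨hg.isKeyTableau, hg.shapeOf_tabOf hn, (hg.flaggedTab_iff hn hφ).2 hf⟩
  · exact ((mem_Wset_iff hn).1 hg).1.injective ((mem_Wset_iff hn).1 hg').1 hn h
  · obtain ⟨hk, hs, hf⟩ := hT
    obtain ⟨g, hg, rfl⟩ := exists_tabOf_eq hk hs h0 hn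
    exact ⟨g, (mem_Wset_iff hn).2 ⟨hg, (hg.flaggedTab_iff hn hφ).1 hf⟩, rfl⟩

end Record

end FlaggedKey

/-- Theorem `thm 4.17`.
For every weak composition `α` and flag `φ`, the `φ`-flagged key polynomial defined via
flagged key tableaux equals Reiner and Shimozono's flagged key polynomial:
`κ_{(α,φ)} = Σ_{u^• ∈ 𝒲(α,φ)} x^{wt(u^•)}`. -/
theorem flagged_key_eq_RS (α : ℕ → ℕ) (hα : WeakComp α) (φ : ℕ → ℕ) (hφ : IsFlag φ) :
    flaggedKeyPoly α φ = ∑ᶠ g ∈ Wset α φ, xExp (wtWord (factWord g)) := by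
  obtain ⟨h0, hfin⟩ := hα
  obtain ⟨n, hn⟩ : ∃ n, ∀ i, n < i → α i = 0 := by
    obtain ⟨n, hn⟩ := hfin.bddAbove
    exact ⟨n, fun i hi => by_contra fun h => absurd (hn h) (not_le.2 hi)⟩
  refine (finsum_mem_eq_of_bijOn _ (FlaggedKey.bijOn_tabOf h0 hn hφ) fun g hg => ?_).symm
  obtain ⟨hg, -⟩ := (FlaggedKey.mem_Wset_iff hn).1 hg
  rw [hg.wtTab_tabOf, FlaggedKey.factWord_eq hg.zero fun i hi =>
    List.length_eq_zero_iff.1 ((hg.len i).trans (hn i hi))]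

end
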